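/- Every homeomorphism of the real projective plane ℝP² is isotopic to the identity, i.e. the group of self-homeomorphisms of ℝP², equipped with the topology of uniform convergence, is arcwise connected. -/

import Mathlib

open unitInterval

/-- The antipodal identification on the `2`-sphere. -/
def antipodalSetoid : Setoid (Metric.sphere (0 : EuclideanSpace ℝ (Fin 3)) 1) where
  r x y := (x : EuclideanSpace ℝ (Fin 3)) = y ∨ (x : EuclideanSpace ℝ (Fin 3)) = -y
  iseqv := by
    refine ⟨fun x => Or.inl rfl, ?_, ?_⟩
    · rintro x y (h | h)
      · exact Or.inl h.symm
      · right; rw [h, neg_neg]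
    · rintro x y z (h1 | h1) (h2 | h2)
      · exact Or.inl (h1.trans h2)
      · right; rw [h1, h2]
      · right; rw [h1, h2]
      · left; rw [h1, h2, neg_neg]

/-- The real projective plane: the quotient of the `2`-sphere by the antipodal map. -/
def RP2 : Type := Quotient antipodalSetoid

noncomputable instance : TopologicalSpace RP2 :=
  inferInstanceAs (TopologicalSpace (Quotient antipodalSetoid))

/-- `f` is isotopic to the identity: there is a continuous path of homeomorphisms
(for the topology of uniform convergence) from the identity to `f`. -/
def IsotopicToId (M : Type*) [TopologicalSpace M] (f : M ≃ₜ M) : Prop :=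
  ∃ H : unitInterval → M ≃ₜ M,
    Continuous (fun p : M × unitInterval => H p.2 p.1) ∧
    Continuous (fun p : M × unitInterval => (H p.2).symm p.1) ∧
    H 0 = Homeomorph.refl M ∧ H 1 = f

section Isotopy

open Set Filter Topology

variable {X : Type*} [TopologicalSpace X] [CompactSpace X] [T2Space X]

/-- On a compact Hausdorff space the inverse of a continuous family of bijections is
automatically continuous. -/
theorem isotopicToId_of_bijective {H : unitInterval → X → X} (f : X ≃ₜ X)
    (hc : Continuous (fun p : X × unitInterval => H p.2 p.1))
    (hb : ∀ t, Function.Bijective (H t)) (h0 : ∀ x, H 0 x = x) (h1 : ∀ x, H 1 x = f x) :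
    IsotopicToId X f := by
  have hct : ∀ t, Continuous (H t) := fun t =>
    hc.comp (Continuous.prodMk continuous_id continuous_const)
  let E : X × unitInterval ≃ X × unitInterval :=
    Equiv.ofBijective (fun p => (H p.2 p.1, p.2)) (by
      constructor
      · rintro ⟨x, t⟩ ⟨y, s⟩ h
        simp only [Prod.mk.injEq] at h
        obtain ⟨h, rfl⟩ := h
        rw [(hb t).1 h]
      · rintro ⟨y, t⟩
        obtain ⟨x, rfl⟩ := (hb t).2 y
        exact ⟨(x, t), rfl⟩)
  have hE : Continuous E := hc.prodMk continuous_snd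
  let Eh : X × unitInterval ≃ₜ X × unitInterval := hE.homeoOfEquivCompactToT2
  let K : unitInterval → X ≃ₜ X := fun t =>
    Continuous.homeoOfEquivCompactToT2 (f := Equiv.ofBijective (H t) (hb t)) (hct t)
  refine ⟨K, hc, ?_, ?_, ?_⟩
  · have : (fun p : X × unitInterval => (K p.2).symm p.1) = fun p => (Eh.symm p).1 := by
      funext p
      have h : Eh ((K p.2).symm p.1, p.2) = p := by
        change (K p.2 ((K p.2).symm p.1), p.2) = p
        rw [Homeomorph.apply_symm_apply]
      have := congrArg Eh.symm h
      rw [Homeomorph.symm_apply_apply] at this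
      rw [← this]
    rw [this]
    exact continuous_fst.comp Eh.symm.continuous
  · ext x; exact h0 x
  · ext x; exact h1 x

/-- The group of homeomorphisms isotopic to the identity. -/
def isotopyGroup (X : Type*) [TopologicalSpace X] [CompactSpace X] [T2Space X] :
    Subgroup (X ≃ₜ X) where
  carrier := {f | IsotopicToId X f}
  mul_mem' := by
    rintro f g ⟨H, hH, -, hH0, hH1⟩ ⟨K, hK, -, hK0, hK1⟩
    refine isotopicToId_of_bijective (H := fun t x => H t (K t x)) _
      (hH.comp (hK.prodMk continuous_snd)) (fun t => (H t).bijective.comp (K t).bijective) ?_ ?_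
    · intro x; simp [hH0, hK0]
    · intro x; simp [hH1, hK1]
  one_mem' := isotopicToId_of_bijective (H := fun _ x => x) _ continuous_fst
    (fun _ => Function.bijective_id) (fun _ => rfl) (fun _ => rfl)
  inv_mem' := by
    rintro f ⟨H, hH, hH', hH0, hH1⟩
    refine isotopicToId_of_bijective (H := fun t x => (H t).symm x) _ hH'
      (fun t => (H t).symm.bijective) ?_ ?_
    · intro x; simp only [hH0]; rfl
    · intro x; simp only [hH1]; rfl

theorem mem_isotopyGroup {f : X ≃ₜ X} : f ∈ isotopyGroup X ↔ IsotopicToId X f := Iff.rfl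

/-- An isotopy of the plane supported in `U` can be transported to `X` along a map `B` which is an
open embedding of `U`, and which is only assumed continuous on the compact set `K ⊇ U`. -/
theorem exists_isotopy_of_supported {B : ℂ → X} {K U : Set ℂ} (hK : IsCompact K)
    (hUK : U ⊆ K) (hB : ContinuousOn B K) (hinj : InjOn B U) (hopen : IsOpen (B '' U))
    (hdisj : ∀ x ∈ U, ∀ y ∈ K, y ∉ U → B x ≠ B y)
    {H : unitInterval → ℂ → ℂ} (hH : Continuous (fun p : ℂ × unitInterval => H p.2 p.1))
    (hHb : ∀ t, Function.Bijective (H t)) (hHU : ∀ t, ∀ z ∉ U, H t z = z) (h0 : ∀ z, H 0 z = z) :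
    ∃ g ∈ isotopyGroup X, (∀ z ∈ K, g (B z) = B (H 1 z)) ∧ ∀ x ∉ B '' U, g x = x := by
  classical
  have hHmem : ∀ t, ∀ z, H t z ∈ U ↔ z ∈ U := by
    intro t z
    constructor
    · intro h
      by_contra hz
      rw [hHU t z hz] at h
      exact hz h
    · intro h
      by_contra hz
      have := (hHb t).1 (hHU t _ hz)
      rw [this] at hz
      exact hz h
  have hHK : ∀ t, ∀ z ∈ K, H t z ∈ K := by
    intro t z hz
    by_cases h : z ∈ U
    · exact hUK ((hHmem t z).2 h)
    · rwa [hHU t z h]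
  let inv : X → ℂ := fun x => if h : x ∈ B '' U then h.choose else 0
  have inv_mem : ∀ x ∈ B '' U, inv x ∈ U ∧ B (inv x) = x := by
    intro x hx
    simp only [inv, dif_pos hx]
    exact hx.choose_spec
  have inv_B : ∀ z ∈ U, inv (B z) = z := fun z hz =>
    hinj (inv_mem _ ⟨z, hz, rfl⟩).1 hz (inv_mem _ ⟨z, hz, rfl⟩).2
  let G : unitInterval → X → X := fun t x => if x ∈ B '' U then B (H t (inv x)) else x
  have GB : ∀ t, ∀ z ∈ K, G t (B z) = B (H t z) := by
    intro t z hz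
    by_cases h : z ∈ U
    · have : B z ∈ B '' U := ⟨z, h, rfl⟩
      simp only [G, if_pos this, inv_B z h]
    · have : B z ∉ B '' U := by
        rintro ⟨x, hx, hxz⟩
        exact hdisj x hx z hz h hxz
      simp only [G, if_neg this, hHU t z h]
  have Gout : ∀ t, ∀ x ∉ B '' U, G t x = x := fun t x hx => by simp only [G, if_neg hx]
  have Gcont : Continuous (fun p : X × unitInterval => G p.2 p.1) := by
    have hBK : IsCompact (B '' K) := hK.image_of_continuousOn hB
    have c1 : ContinuousOn (fun p : X × unitInterval => G p.2 p.1) ((B '' U)ᶜ ×ˢ univ) :=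
      continuous_fst.continuousOn.congr (fun p hp => Gout p.2 p.1 hp.1)
    have c2 : ContinuousOn (fun p : X × unitInterval => G p.2 p.1) ((B '' K) ×ˢ univ) := by
      rw [continuousOn_iff_continuous_domRestrict]
      have : CompactSpace K := isCompact_iff_compactSpace.1 hK
      let q : K × unitInterval → ((B '' K) ×ˢ (univ : Set unitInterval) : Set (X × unitInterval)) :=
        fun p => ⟨(B p.1, p.2), ⟨⟨p.1, p.1.2, rfl⟩, trivial⟩⟩
      have hq : Continuous q := by
        refine Continuous.subtype_mk ?_ _
        exact ((hB.domRestrict).comp continuous_fst).prodMk continuous_snd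
      have hqs : Function.Surjective q := by
        rintro ⟨⟨x, t⟩, h⟩
        obtain ⟨z, hz, hzx⟩ := h.1
        exact ⟨(⟨z, hz⟩, t), Subtype.ext (Prod.ext hzx rfl)⟩
      have hqq : IsQuotientMap q := hq.isClosedMap.isQuotientMap hq hqs
      rw [hqq.continuous_iff]
      have : (Set.domRestrict ((B '' K) ×ˢ univ) (fun p : X × unitInterval => G p.2 p.1)) ∘ q
          = fun p : K × unitInterval => B (H p.2 p.1) := by
        funext p
        exact GB p.2 p.1 p.1.2
      rw [this]
      refine hB.comp_continuous (f := fun p : K × unitInterval => H p.2 p.1) ?_ ?_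
      · exact hH.comp ((continuous_subtype_val.comp continuous_fst).prodMk continuous_snd)
      · exact fun p => hHK p.2 p.1 p.1.2
    have := c1.union_of_isClosed c2 (hopen.isClosed_compl.prod isClosed_univ)
      (hBK.isClosed.prod isClosed_univ)
    rw [← continuousOn_univ]
    refine this.mono ?_
    rintro ⟨x, t⟩ -
    by_cases h : x ∈ B '' U
    · exact Or.inr ⟨image_mono hUK h, trivial⟩
    · exact Or.inl ⟨h, trivial⟩
  have Gbij : ∀ t, Function.Bijective (G t) := by
    intro t
    have hmem : ∀ x, G t x ∈ B '' U ↔ x ∈ B '' U := by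
      intro x
      by_cases h : x ∈ B '' U
      · simp only [h, iff_true]
        obtain ⟨z, hz, rfl⟩ := h
        rw [GB t z (hUK hz)]
        exact ⟨_, (hHmem t z).2 hz, rfl⟩
      · rw [Gout t x h]
    constructor
    · intro x y hxy
      by_cases h : x ∈ B '' U
      · have h' : y ∈ B '' U := by rwa [← hmem, ← hxy, hmem]
        obtain ⟨z, hz, rfl⟩ := h
        obtain ⟨w, hw, rfl⟩ := h'
        rw [GB t z (hUK hz), GB t w (hUK hw)] at hxy
        rw [(hHb t).1 (hinj ((hHmem t z).2 hz) ((hHmem t w).2 hw) hxy)]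
      · have h' : y ∉ B '' U := by rwa [← hmem, ← hxy, hmem]
        rwa [Gout t x h, Gout t y h'] at hxy
    · intro y
      by_cases h : y ∈ B '' U
      · obtain ⟨z, hz, rfl⟩ := h
        obtain ⟨w, rfl⟩ := (hHb t).2 z
        exact ⟨B w, GB t w (hUK ((hHmem t w).1 hz))⟩
      · exact ⟨y, Gout t y h⟩
  have G1 : Continuous (G 1) := Gcont.comp (continuous_id.prodMk continuous_const)
  let g : X ≃ₜ X := Continuous.homeoOfEquivCompactToT2 (f := Equiv.ofBijective (G 1) (Gbij 1)) G1
  refine ⟨g, isotopicToId_of_bijective g Gcont Gbij ?_ (fun _ => rfl), GB 1, Gout 1⟩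
  intro x
  by_cases h : x ∈ B '' U
  · obtain ⟨z, hz, rfl⟩ := h
    rw [GB 0 z (hUK hz), h0]
  · exact Gout 0 x h

end Isotopy

section Push

open Set Filter Topology

variable {X : Type*} [TopologicalSpace X] [CompactSpace X] [T2Space X]

theorem bijective_id_add_of_lipschitz {v : ℂ → ℂ} {c : NNReal} (hv : LipschitzWith c v) (hc : c < 1) :
    Function.Bijective (fun z => z + v z) := by
  have h : ApproximatesLinearOn (fun z => z + v z)
      ((ContinuousLinearEquiv.refl ℝ ℂ : ℂ ≃L[ℝ] ℂ) : ℂ →L[ℝ] ℂ) univ c := by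
    rw [ApproximatesLinearOn.approximatesLinearOn_iff_lipschitzOnWith, lipschitzOnWith_univ]
    convert hv using 1
    funext z
    simp
  have hc' : Subsingleton ℂ ∨
      c < ‖((ContinuousLinearEquiv.refl ℝ ℂ).symm : ℂ →L[ℝ] ℂ)‖₊⁻¹ := by
    right
    have : ‖((ContinuousLinearEquiv.refl ℝ ℂ).symm : ℂ →L[ℝ] ℂ)‖₊ = 1 := by
      ext
      simp
    rw [this]; simpa using hc
  exact (h.toHomeomorph _ hc').bijective

/-- A compactly supported vector field with small Lipschitz constant can be pushed to `X` along an
open embedding. -/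
theorem exists_isotopy_push {B : ℂ → X} {O : Set ℂ} (hB : ContinuousOn B O)
    (hinj : InjOn B O) (hopen : ∀ V ⊆ O, IsOpen V → IsOpen (B '' V)) {u : ℂ → ℂ} {c : NNReal}
    (hu : LipschitzWith c u) (hc : c < 1) (hus : HasCompactSupport u) (huO : tsupport u ⊆ O) :
    ∃ g ∈ isotopyGroup X, (∀ z ∈ O, z + u z ∈ O ∧ g (B z) = B (z + u z)) ∧ ∀ x ∉ B '' O, g x = x := by
  have hsO : Function.support u ⊆ O := (subset_tsupport u).trans huO
  have hso : IsOpen (Function.support u) := hu.continuous.isOpen_support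
  obtain ⟨g, hg, h1, h2⟩ := exists_isotopy_of_supported (K := tsupport u)
    (U := Function.support u) (B := B) (H := fun t z => z + (t : ℝ) * u z) hus
    (subset_tsupport u) (hB.mono huO) (hinj.mono hsO) (hopen _ hsO hso)
    (fun x hx y hy hxy h => hxy (hinj (hsO hx) (huO hy) h ▸ hx))
    (by
      have := hu.continuous
      fun_prop)
    (fun t => by
      have : LipschitzWith c (fun z => ((t : ℝ) : ℂ) * u z) := by
        refine LipschitzWith.of_dist_le_mul fun x y => ?_
        rw [dist_eq_norm, ← mul_sub, norm_mul, ← dist_eq_norm]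
        have h1 : ‖((t : ℝ) : ℂ)‖ ≤ 1 := by
          rw [Complex.norm_real, Real.norm_of_nonneg t.2.1]; exact t.2.2
        calc _ ≤ 1 * dist (u x) (u y) := by gcongr
          _ ≤ _ := by rw [one_mul]; exact hu.dist_le_mul x y
      exact bijective_id_add_of_lipschitz this hc)
    (fun t z hz => by simp [Function.notMem_support.1 hz])
    (fun z => by simp)
  refine ⟨g, hg, fun z hz => ⟨?_, ?_⟩, fun x hx => h2 x fun h => hx (image_mono hsO h)⟩
  · by_contra h
    have h0 : u (z + u z) = 0 := Function.notMem_support.1 fun h' => h (hsO h')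
    have := (bijective_id_add_of_lipschitz hu hc).1 (a₁ := z + u z) (a₂ := z)
      (by simp only [h0, add_zero])
    exact h (this.symm ▸ hz)
  by_cases h : z ∈ tsupport u
  · simpa using h1 z h
  · have hz' : z ∉ Function.support u := fun h' => h (subset_tsupport u h')
    rw [Function.notMem_support.1 hz', add_zero]
    refine h2 _ ?_
    rintro ⟨w, hw, hwz⟩
    exact hz' (hinj (hsO hw) hz hwz ▸ hw)

/-- Alexander's trick on a star-shaped region. -/
theorem exists_isotopy_alexander {B : ℂ → X} {K U : Set ℂ} (hK : IsCompact K)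
    (hUK : U ⊆ K) (hB : ContinuousOn B K) (hinj : InjOn B U) (hopen : IsOpen (B '' U))
    (hdisj : ∀ x ∈ U, ∀ y ∈ K, y ∉ U → B x ≠ B y)
    {c : ℂ} (hstar : StarConvex ℝ c U) {F : ℂ → ℂ} (hF : Continuous F)
    (hFb : Function.Bijective F) (hFU : ∀ z ∉ U, F z = z) :
    ∃ g ∈ isotopyGroup X, (∀ z ∈ K, g (B z) = B (F z)) ∧ ∀ x ∉ B '' U, g x = x := by
  let H : unitInterval → ℂ → ℂ := fun t z =>
    z + (t : ℝ) * (F (c + (t : ℝ)⁻¹ * (z - c)) - (c + (t : ℝ)⁻¹ * (z - c)))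
  obtain ⟨M, hM⟩ : ∃ M, ∀ z, ‖F z - z‖ ≤ M := by
    obtain ⟨M, hM⟩ := hK.exists_bound_of_continuousOn (f := fun z => F z - z)
      (hF.sub continuous_id).continuousOn
    refine ⟨max M 0, fun z => ?_⟩
    by_cases hz : z ∈ K
    · exact (hM z hz).trans (le_max_left _ _)
    · rw [hFU z fun h => hz (hUK h)]; simp
  have hH1 : ∀ z, H 1 z = F z := fun z => by simp [H]
  have hHU : ∀ t, ∀ z ∉ U, H t z = z := by
    intro t z hz
    by_cases ht : (t : ℝ) = 0
    · simp [H, ht]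
    have : c + ((t : ℝ) : ℂ)⁻¹ * (z - c) ∉ U := by
      intro h
      have := hstar h (a := 1 - t) (b := t) (by linarith [t.2.2]) t.2.1 (by ring)
      apply hz
      convert this using 1
      have ht' : ((t : ℝ) : ℂ) ≠ 0 := by exact_mod_cast ht
      simp only [Complex.real_smul]
      push_cast
      field_simp
      ring
    simp [H, hFU _ this]
  have hHc : Continuous (fun p : ℂ × unitInterval => H p.2 p.1) := by
    rw [continuous_iff_continuousAt]
    rintro ⟨z, t⟩
    by_cases ht : (t : ℝ) = 0
    · have h0 : Tendsto (fun p : ℂ × unitInterval => p.1 - H p.2 p.1) (𝓝 (z, t)) (𝓝 0) := by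
        have hlim : Tendsto (fun p : ℂ × unitInterval => (p.2 : ℝ) * M) (𝓝 (z, t)) (𝓝 0) := by
          have : Continuous (fun p : ℂ × unitInterval => (p.2 : ℝ) * M) := by fun_prop
          have := this.tendsto (z, t)
          simpa [ht] using this
        refine squeeze_zero_norm (fun p => ?_) hlim
        simp only [H, sub_add_cancel_left, norm_neg, norm_mul, Complex.norm_real,
          Real.norm_of_nonneg p.2.2.1]
        exact mul_le_mul_of_nonneg_left (hM _) p.2.2.1
      have h1 : Tendsto (fun p : ℂ × unitInterval => p.1) (𝓝 (z, t)) (𝓝 z) :=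
        continuous_fst.tendsto _
      have := h1.sub h0
      simp only [sub_sub_cancel, sub_zero] at this
      have h2 : H t z = z := by simp [H, ht]
      simpa [ContinuousAt, h2] using this
    · have ht' : ((t : ℝ) : ℂ) ≠ 0 := by exact_mod_cast ht
      have : ContinuousAt (fun p : ℂ × unitInterval => (((p.2 : ℝ) : ℂ))⁻¹) (z, t) :=
        ContinuousAt.inv₀ (by fun_prop) ht'
      simp only [H]
      have h3 : ContinuousAt (fun p : ℂ × unitInterval => c + (((p.2 : ℝ) : ℂ))⁻¹ * (p.1 - c)) (z, t) := by
        fun_prop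
      have h4 : ContinuousAt (fun p : ℂ × unitInterval =>
          F (c + (((p.2 : ℝ) : ℂ))⁻¹ * (p.1 - c))) (z, t) :=
        hF.continuousAt.comp' h3
      fun_prop
  have hHb : ∀ t, Function.Bijective (H t) := by
    intro t
    by_cases ht : (t : ℝ) = 0
    · have : H t = id := by funext z; simp [H, ht]
      rw [this]; exact Function.bijective_id
    have ht' : ((t : ℝ) : ℂ) ≠ 0 := by exact_mod_cast ht
    let e : ℂ ≃ ℂ := ((Equiv.subRight c).trans (Equiv.mulLeft₀ (((t : ℝ) : ℂ))⁻¹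
      (inv_ne_zero ht'))).trans (Equiv.addLeft c)
    have he : ∀ z, e z = c + ((t : ℝ) : ℂ)⁻¹ * (z - c) := fun z => rfl
    have : H t = e.symm ∘ F ∘ e := by
      funext z
      have key : H t z = z + (t : ℝ) * (F (e z) - e z) := by
        simp only [H, he, Complex.ofReal_inv]
      rw [Function.comp_apply, Function.comp_apply, Equiv.eq_symm_apply, key]
      generalize F (e z) = y
      rw [he, he]
      field_simp
      ring
    rw [this]
    exact e.symm.bijective.comp (hFb.comp e.bijective)
  obtain ⟨g, hg, h1, h2⟩ := exists_isotopy_of_supported (H := H) hK hUK hB hinj hopen hdisj hHc hHb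
    hHU (fun z => by simp [H])
  exact ⟨g, hg, fun z hz => by rw [h1 z hz, hH1], h2⟩

end Push

section Slide

open Set Filter Topology

theorem exists_lipschitz_bump {C O : Set ℂ} (hC : IsCompact C) (hO : IsOpen O) (hCO : C ⊆ O) :
    ∃ (χ : ℂ → ℝ) (L : NNReal), LipschitzWith L χ ∧ (∀ z, χ z ∈ Icc (0 : ℝ) 1) ∧
      (∀ z ∈ C, χ z = 1) ∧ HasCompactSupport χ ∧ tsupport χ ⊆ O := by
  obtain ⟨δ, hδ, h⟩ := hC.exists_cthickening_subset_open hO hCO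
  have hs : tsupport (fun z => (thickenedIndicator hδ C z : ℝ)) ⊆ Metric.cthickening δ C := by
    refine closure_minimal ?_ Metric.isClosed_cthickening
    intro z hz
    by_contra hz'
    refine hz ?_
    have := thickenedIndicator_zero hδ C (x := z)
      (fun h => hz' (Metric.thickening_subset_cthickening _ _ h))
    simp [this]
  refine ⟨fun z => thickenedIndicator hδ C z, _, LipschitzWith.of_dist_le_mul fun x y =>
    (lipschitzWith_thickenedIndicator hδ C).dist_le_mul x y, fun z => ⟨?_, ?_⟩, ?_, ?_, ?_⟩
  · positivity
  · exact_mod_cast thickenedIndicator_le_one hδ C z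
  · intro z hz
    simp [thickenedIndicator_one hδ C hz]
  · exact HasCompactSupport.of_support_subset_isCompact hC.cthickening
      ((subset_tsupport _).trans hs)
  · exact hs.trans h

theorem lipschitzWith_mul_of_support {κ e : ℂ → ℂ} {S : Set ℂ} {A L Lκ M : NNReal}
    (hκ : LipschitzWith Lκ κ) (hS : Function.support κ ⊆ S) (hA : ∀ z, ‖κ z‖ ≤ A)
    (hM : ∀ z ∈ S, ‖e z‖ ≤ M) (he : LipschitzOnWith L e S) :
    LipschitzWith (A * L + Lκ * M) (fun z => κ z * e z) := by
  have key : ∀ z w, w ∈ S → ‖κ z * e z - κ w * e w‖ ≤ (A * L + Lκ * M) * ‖z - w‖ := by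
    intro z w hw
    have h1 : ‖κ z - κ w‖ ≤ Lκ * ‖z - w‖ := by
      simpa [dist_eq_norm] using hκ.dist_le_mul z w
    by_cases hz : z ∈ S
    · have h2 : ‖e z - e w‖ ≤ L * ‖z - w‖ := by
        simpa [dist_eq_norm] using he.dist_le_mul z hz w hw
      calc ‖κ z * e z - κ w * e w‖ = ‖κ z * (e z - e w) + (κ z - κ w) * e w‖ := by ring_nf
        _ ≤ ‖κ z‖ * ‖e z - e w‖ + ‖κ z - κ w‖ * ‖e w‖ := by
          rw [← norm_mul, ← norm_mul]; exact norm_add_le _ _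
        _ ≤ A * (L * ‖z - w‖) + (Lκ * ‖z - w‖) * M := by
          gcongr
          · exact hA z
          · exact hM w hw
        _ = _ := by ring
    · have : κ z = 0 := by
        by_contra h
        exact hz (hS h)
      rw [this, zero_sub, norm_neg] at h1
      calc ‖κ z * e z - κ w * e w‖ = ‖κ w‖ * ‖e w‖ := by rw [this]; simp
        _ ≤ (Lκ * ‖z - w‖) * M := by
          gcongr
          exact hM w hw
        _ ≤ _ := by
          have : 0 ≤ (A * L : ℝ) * ‖z - w‖ := by positivity
          nlinarith
  refine LipschitzWith.of_dist_le_mul fun z w => ?_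
  rw [dist_eq_norm, dist_eq_norm]
  push_cast
  by_cases hw : w ∈ S
  · exact key z w hw
  · by_cases hz : z ∈ S
    · rw [norm_sub_rev, norm_sub_rev z w]; exact key w z hz
    · have h1 : κ z = 0 := by
        by_contra h
        exact hz (hS h)
      have h2 : κ w = 0 := by
        by_contra h
        exact hw (hS h)
      simp only [h1, h2, zero_mul, sub_zero, norm_zero]
      positivity

variable {X : Type*} [TopologicalSpace X] [CompactSpace X] [T2Space X]

theorem exists_isotopy_slide {B : ℂ → X} {W J : Set ℂ} (hW : IsOpen W) (hB : ContinuousOn B W)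
    (hopen : ∀ V ⊆ W, IsOpen V → IsOpen (B '' V)) (hloc : ∀ z ∈ W, ∃ V ∈ 𝓝 z, InjOn B V)
    (hJ : IsCompact J) {r₀ r₁ : ℝ} (h0 : 0 < r₀) (h01 : r₀ ≤ r₁)
    (hsub : ∀ r ∈ Icc r₀ r₁, ∀ j ∈ J, (r : ℂ) * j ∈ W)
    (hinj : ∀ r ∈ Icc r₀ r₁, InjOn (fun j : ℂ => B (r * j)) J) :
    ∃ g ∈ isotopyGroup X, (∀ j ∈ J, g (B (r₁ * j)) = B (r₀ * j)) ∧
      ∀ T : Set X, (∀ w ∈ W, ∀ s : ℝ, 0 < s → (s : ℂ) * w ∈ W → B w ∈ T → B (s * w) ∈ T) →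
        ∀ x, g x ∈ T ↔ x ∈ T := by
  let P : ℝ → ℝ → Prop := fun a b =>
    ∃ g ∈ isotopyGroup X, (∀ j ∈ J, g (B (a * j)) = B (b * j)) ∧
      ∀ T : Set X, (∀ w ∈ W, ∀ s : ℝ, 0 < s → (s : ℂ) * w ∈ W → B w ∈ T → B (s * w) ∈ T) →
        ∀ x, g x ∈ T ↔ x ∈ T
  suffices P r₁ r₀ from this
  have htrans : ∀ a b c, P a b → P b c → P a c := by
    rintro a b c ⟨g, hg, h1, h2⟩ ⟨k, hk, h3, h4⟩
    refine ⟨k * g, mul_mem hk hg, fun j hj => ?_, fun T hT x => ?_⟩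
    · rw [Homeomorph.mul_apply, h1 j hj, h3 j hj]
    · rw [Homeomorph.mul_apply, h4 T hT, h2 T hT]
  have hsymm : ∀ a b, P a b → P b a := by
    rintro a b ⟨g, hg, h1, h2⟩
    refine ⟨g⁻¹, inv_mem hg, fun j hj => ?_, fun T hT x => ?_⟩
    · rw [← h1 j hj]; exact g.symm_apply_apply _
    · rw [← h2 T hT]; exact iff_of_eq (congrArg (· ∈ T) (g.apply_symm_apply x))
  refine (isPreconnected_Icc (a := r₀) (b := r₁)).induction₂ P ?_
    (fun a b c _ _ _ => htrans a b c) (fun a b _ _ => hsymm a b)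
    (right_mem_Icc.2 h01) (left_mem_Icc.2 h01)
  intro r hr
  have hr0 : 0 < r := h0.trans_le hr.1
  let C : Set ℂ := (fun j => (r : ℂ) * j) '' J
  have hC : IsCompact C := hJ.image (by fun_prop)
  have hCW : C ⊆ W := by
    rintro _ ⟨j, hj, rfl⟩
    exact hsub r hr j hj
  have hCi : InjOn B C := by
    rintro _ ⟨j, hj, rfl⟩ _ ⟨k, hk, rfl⟩ h
    exact congrArg _ (hinj r hr hj hk h)
  obtain ⟨N, hN, hNi⟩ := hCi.exists_mem_nhdsSet hC
    (fun z hz => hB.continuousAt (hW.mem_nhds (hCW hz))) (fun z hz => hloc z (hCW hz))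
  obtain ⟨O', hO', hCO', hON'⟩ := mem_nhdsSet_iff_exists.1 hN
  let O := O' ∩ W
  have hO : IsOpen O := hO'.inter hW
  have hOW : O ⊆ W := inter_subset_right
  have hOi : InjOn B O := hNi.mono (inter_subset_left.trans hON')
  obtain ⟨χ, L, hχ, hχI, hχ1, hχc, hχO⟩ := exists_lipschitz_bump hC hO (fun z hz => ⟨hCO' hz, hCW hz⟩)
  obtain ⟨M, hM0, hM⟩ := hχc.isBounded.exists_pos_norm_le
  have hlip : ∃ c : NNReal, LipschitzWith c (fun z => (χ z : ℂ) * z) := by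
    refine ⟨_, lipschitzWith_mul_of_support (κ := fun z => (χ z : ℂ)) (e := id) (S := tsupport χ)
      (A := 1) (L := 1) (M := ⟨M, hM0.le⟩) (Lκ := L) ?_ ?_ ?_ hM (LipschitzWith.id.lipschitzOnWith)⟩
    · have := Complex.isometry_ofReal.lipschitz.comp hχ
      rwa [one_mul] at this
    · intro z hz
      refine subset_tsupport _ ?_
      intro h
      exact hz (by simp [h])
    · intro z
      simpa [abs_of_nonneg (hχI z).1] using (hχI z).2
  obtain ⟨c, hc⟩ := hlip
  have hlim : ∀ᶠ r' : ℝ in 𝓝 r, |r' / r - 1| * c < 1 ∧ 0 < r' ∧ |r' / r - 1| < 1 := by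
    have h1 : ContinuousAt (fun r' : ℝ => |r' / r - 1| * c) r := by fun_prop
    have h2 := h1.tendsto.eventually_lt_const (u := 1)
      (show |r / r - 1| * c < 1 by simp [hr0.ne'])
    have h3 : ContinuousAt (fun r' : ℝ => |r' / r - 1|) r := by fun_prop
    have h4 := h3.tendsto.eventually_lt_const (u := 1)
      (show |r / r - 1| < 1 by simp [hr0.ne'])
    filter_upwards [h2, lt_mem_nhds hr0, h4] with r' h1 h2 h3
    exact ⟨h1, h2, h3⟩
  filter_upwards [nhdsWithin_le_nhds hlim] with r' hr'
  let η : ℝ := r' / r - 1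
  have hu : LipschitzWith (Real.nnabs η * c) (fun z => (η : ℂ) * ((χ z : ℂ) * z)) := by
    refine LipschitzWith.of_dist_le_mul fun x y => ?_
    rw [dist_eq_norm, ← mul_sub, norm_mul, ← dist_eq_norm]
    push_cast
    rw [mul_assoc]
    have := hc.dist_le_mul x y
    simp only [Complex.norm_real, Real.norm_eq_abs]
    gcongr
  have hsupp : Function.support (fun z => (η : ℂ) * ((χ z : ℂ) * z)) ⊆ Function.support χ := by
    intro z hz h
    exact hz (by simp [h])
  obtain ⟨g, hg, h1, h2⟩ := exists_isotopy_push (hB.mono hOW) hOi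
    (fun V hV => hopen V (hV.trans hOW)) hu (by exact_mod_cast hr'.1)
    (HasCompactSupport.of_support_subset_isCompact hχc (hsupp.trans (subset_tsupport _)))
    ((closure_mono hsupp).trans hχO)
  have hform : ∀ z, z + (η : ℂ) * ((χ z : ℂ) * z) = ((1 + η * χ z : ℝ) : ℂ) * z := by
    intro z; push_cast; ring
  have hpos : ∀ z, 0 < 1 + η * χ z := by
    intro z
    have h3 : |η| < 1 := hr'.2.2
    have h4 := hχI z
    have h5 := abs_lt.1 h3
    nlinarith [h4.1, h4.2]
  refine ⟨g, hg, ?_, ?_⟩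
  · intro j hj
    have hjC : (r : ℂ) * j ∈ C := ⟨j, hj, rfl⟩
    rw [(h1 _ ⟨hCO' hjC, hCW hjC⟩).2, hχ1 _ hjC]
    congr 1
    have : (r : ℂ) ≠ 0 := by exact_mod_cast hr0.ne'
    simp only [η]; push_cast
    field_simp
    ring
  · intro T hT x
    by_cases hx : x ∈ B '' O
    · obtain ⟨z, hz, rfl⟩ := hx
      obtain ⟨h3, h4⟩ := h1 z hz
      rw [h4]
      rw [hform] at h3 ⊢
      constructor
      · intro h
        have := hT _ (hOW h3) (1 + η * χ z)⁻¹ (inv_pos.2 (hpos z))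
        have h5 : (((1 + η * χ z)⁻¹ : ℝ) : ℂ) * (((1 + η * χ z : ℝ) : ℂ) * z) = z := by
          rw [← mul_assoc, ← Complex.ofReal_mul, inv_mul_cancel₀ (hpos z).ne']; simp
        rw [h5] at this
        exact this (hOW hz) h
      · exact hT z (hOW hz) _ (hpos z) (hOW h3)
    · rw [h2 x hx]

theorem exists_isotopy_linearize {B : ℂ → X} {W J O : Set ℂ} (hB : ContinuousOn B W)
    (hopen : ∀ V ⊆ W, IsOpen V → IsOpen (B '' V)) (hJ : IsCompact J) (hO : IsOpen O) (hJO : J ⊆ O)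
    {φ : ℂ → ℂ} {a ρ r₁ : ℝ} (ha : 0 < a) (hρ : 0 < ρ)
    (hφ : DifferentiableOn ℂ φ (Metric.ball 0 ρ)) (hφ0 : φ 0 = 0) (hφa : deriv φ 0 = a)
    (hr₁ : 0 < r₁) (hinj : ∀ r ∈ Ioc 0 r₁, InjOn (fun w : ℂ => B (r * w)) O)
    (hsub : ∀ r ∈ Ioc 0 r₁, ∀ w ∈ O, (r : ℂ) * w ∈ W) :
    ∃ r₂ > 0, ∀ r ∈ Ioc 0 r₂, ∃ g ∈ isotopyGroup X,
      (∀ j ∈ J, g (B ((r * a : ℝ) * j)) = B (φ (r * j))) ∧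
      ∀ (T : Set X) (S : Submodule ℝ ℂ), (∀ w ∈ W, B w ∈ T ↔ w ∈ S) →
        (∀ w ∈ S, ‖w‖ < ρ → φ w ∈ S) → ∀ x ∈ T, g x ∈ T := by
  obtain ⟨χ, Lχ, hχ, hχI, hχ1, hχc, hχO⟩ := exists_lipschitz_bump hJ hO hJO
  obtain ⟨R, hR0, hR⟩ := hχc.isBounded.exists_pos_norm_le
  -- the second order remainder
  let h : ℂ → ℂ := dslope (fun z => dslope φ 0 z) 0
  have hdiff : DifferentiableOn ℂ h (Metric.ball 0 ρ) := by
    have := Metric.ball_mem_nhds (0 : ℂ) hρ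
    exact (Complex.differentiableOn_dslope this).2 ((Complex.differentiableOn_dslope this).2 hφ)
  have hform : ∀ z, φ z = a * z + z ^ 2 * h z := by
    intro z
    have h1 := sub_smul_dslope φ 0 z
    have h2 := sub_smul_dslope (fun z => dslope φ 0 z) 0 z
    simp only [sub_zero, smul_eq_mul, hφ0, dslope_same, hφa] at h1 h2
    rw [← h1, pow_two, mul_assoc, h2]; ring
  obtain ⟨M, hM⟩ : ∃ M : NNReal, ∀ z ∈ Metric.closedBall (0 : ℂ) (ρ / 2), ‖h z‖ ≤ M := by
    obtain ⟨M, hM⟩ := (isCompact_closedBall (0 : ℂ) (ρ / 2)).exists_bound_of_continuousOn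
      (hdiff.continuousOn.mono (Metric.closedBall_subset_ball (by linarith)))
    exact ⟨Real.toNNReal M, fun z hz => (hM z hz).trans (Real.le_coe_toNNReal M)⟩
  obtain ⟨L, hL⟩ : ∃ L : NNReal, LipschitzOnWith L h (Metric.closedBall (0 : ℂ) (ρ / 2)) := by
    obtain ⟨M, hM⟩ := (isCompact_closedBall (0 : ℂ) (ρ / 2)).exists_bound_of_continuousOn
      ((hdiff.deriv Metric.isOpen_ball).continuousOn.mono
        (Metric.closedBall_subset_ball (by linarith)))
    refine ⟨Real.toNNReal M, (convex_closedBall _ _).lipschitzOnWith_of_nnnorm_deriv_le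
      (fun z hz => hdiff.differentiableAt
        (Metric.isOpen_ball.mem_nhds (Metric.closedBall_subset_ball (by linarith) hz)))
      fun z hz => ?_⟩
    rw [← NNReal.coe_le_coe]
    exact (hM z hz).trans (Real.le_coe_toNNReal M)
  -- the cut-off quadratic
  obtain ⟨Lκ, hκ⟩ : ∃ c : NNReal, LipschitzWith c (fun z => (χ z : ℂ) * z ^ 2) := by
    have hsq : LipschitzOnWith (Real.toNNReal (2 * R)) (fun z : ℂ => z ^ 2) (tsupport χ) := by
      refine LipschitzOnWith.of_dist_le_mul fun z hz w hw => ?_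
      rw [dist_eq_norm, dist_eq_norm, Real.coe_toNNReal _ (by positivity),
        show z ^ 2 - w ^ 2 = (z + w) * (z - w) by ring, norm_mul]
      gcongr
      calc _ ≤ ‖z‖ + ‖w‖ := norm_add_le _ _
        _ ≤ _ := by linarith [hR z hz, hR w hw]
    refine ⟨_, lipschitzWith_mul_of_support (κ := fun z => (χ z : ℂ)) (S := tsupport χ)
      (A := 1) (M := Real.toNNReal (R ^ 2)) (Lκ := Lχ) ?_ ?_ ?_ ?_ hsq⟩
    · have := Complex.isometry_ofReal.lipschitz.comp hχ
      rwa [one_mul] at this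
    · intro z hz
      refine subset_tsupport _ ?_
      intro h
      exact hz (by simp [h])
    · intro z
      simpa [abs_of_nonneg (hχI z).1] using (hχI z).2
    · intro z hz
      rw [norm_pow, Real.coe_toNNReal _ (by positivity)]
      exact pow_le_pow_left₀ (norm_nonneg _) (hR z hz) 2
  have hsuppκ : Function.support (fun z => (χ z : ℂ) * z ^ 2) ⊆ tsupport χ := by
    intro z hz
    refine subset_tsupport _ ?_
    intro h
    exact hz (by simp [h])
  have hAκ : ∀ z, ‖(χ z : ℂ) * z ^ 2‖ ≤ (Real.toNNReal (R ^ 2) : ℝ) := by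
    intro z
    rw [Real.coe_toNNReal _ (by positivity)]
    by_cases hz : z ∈ tsupport χ
    · rw [norm_mul, norm_pow, Complex.norm_real, Real.norm_of_nonneg (hχI z).1]
      calc _ ≤ 1 * R ^ 2 := by
            gcongr
            · exact (hχI z).2
            · exact hR z hz
        _ = _ := one_mul _
    · have : (χ z : ℂ) * z ^ 2 = 0 := by
        by_contra h
        exact hz (hsuppκ h)
      rw [this, norm_zero]; positivity
  obtain ⟨c, hcpos, hc⟩ : ∃ c : NNReal, 0 < c ∧ ∀ r : ℝ, 0 < r → r * R ≤ ρ / 2 → r ≤ 1 →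
      LipschitzWith c (fun z => ((χ z : ℂ) * z ^ 2) * h (r * z)) := by
    refine ⟨Real.toNNReal (R ^ 2) * L + Lκ * M + 1, by positivity, fun r hr hrR hr1 => ?_⟩
    have hmem : ∀ z ∈ tsupport χ, (r : ℂ) * z ∈ Metric.closedBall (0 : ℂ) (ρ / 2) := by
      intro z hz
      rw [mem_closedBall_zero_iff, norm_mul, Complex.norm_real, Real.norm_of_nonneg hr.le]
      exact (mul_le_mul_of_nonneg_left (hR z hz) hr.le).trans hrR
    refine (lipschitzWith_mul_of_support (e := fun z => h (r * z)) (L := L) (M := M) hκ hsuppκ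
      hAκ (fun z hz => hM _ (hmem z hz)) ?_).weaken (le_add_of_nonneg_right zero_le_one)
    refine LipschitzOnWith.of_dist_le_mul fun z hz w hw => ?_
    refine (hL.dist_le_mul _ (hmem z hz) _ (hmem w hw)).trans ?_
    rw [dist_eq_norm, ← mul_sub, norm_mul, ← dist_eq_norm, Complex.norm_real,
      Real.norm_of_nonneg hr.le]
    gcongr
    exact mul_le_of_le_one_left dist_nonneg hr1
  refine ⟨min (min (r₁ / a) 1) (min (ρ / (2 * R)) (a / (2 * c))), by positivity, fun r hr => ?_⟩
  obtain ⟨hr0, hr2⟩ := hr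
  simp only [le_min_iff] at hr2
  obtain ⟨⟨hr1, hr3⟩, hr4, hr5⟩ := hr2
  have hrR : r * R ≤ ρ / 2 := by
    rw [le_div_iff₀ (by positivity)] at hr4
    linarith
  have hra : r * a ∈ Ioc 0 r₁ := ⟨by positivity, by rwa [le_div_iff₀ ha] at hr1⟩
  let u : ℂ → ℂ := fun z => ((r / a : ℝ) : ℂ) * (((χ z : ℂ) * z ^ 2) * h (r * z))
  have hu : LipschitzWith (Real.toNNReal (r / a) * c) u := by
    refine LipschitzWith.of_dist_le_mul fun x y => ?_
    rw [dist_eq_norm, ← mul_sub, norm_mul, ← dist_eq_norm, Complex.norm_real,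
      Real.norm_of_nonneg (by positivity)]
    push_cast
    rw [Real.coe_toNNReal _ (by positivity), mul_assoc (r / a)]
    have := (hc r hr0 hrR hr3).dist_le_mul x y
    gcongr
  have hc1 : Real.toNNReal (r / a) * c < 1 := by
    rw [← NNReal.coe_lt_coe]
    push_cast
    rw [Real.coe_toNNReal _ (by positivity)]
    rw [le_div_iff₀ (by positivity)] at hr5
    rw [div_mul_eq_mul_div, div_lt_one ha]
    have : 0 < r * (c : ℝ) := by positivity
    linarith
  have hsuppu : Function.support u ⊆ tsupport χ := by
    intro z hz
    refine hsuppκ fun h => hz ?_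
    simp only [u, h, zero_mul, mul_zero]
  have hBc : ContinuousOn (fun w : ℂ => B ((r * a : ℝ) * w)) O :=
    hB.comp (by fun_prop) (fun w hw => hsub _ hra w hw)
  obtain ⟨g, hg, h1, h2⟩ := exists_isotopy_push (B := fun w : ℂ => B ((r * a : ℝ) * w)) hBc
    (hinj _ hra) (fun V hV hVo => by
      have : (fun w : ℂ => B ((r * a : ℝ) * w)) '' V =
          B '' ((fun w : ℂ => ((r * a : ℝ) : ℂ) * w) '' V) := by
        rw [image_image]
      rw [this]
      refine hopen _ ?_ ?_
      · rintro _ ⟨w, hw, rfl⟩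
        exact hsub _ hra w (hV hw)
      · have hne : ((r * a : ℝ) : ℂ) ≠ 0 := by exact_mod_cast hra.1.ne'
        exact (Homeomorph.mulLeft₀ _ hne).isOpenMap _ hVo) hu hc1
    (HasCompactSupport.of_support_subset_isCompact hχc hsuppu)
    ((closure_minimal hsuppu (isClosed_tsupport _)).trans hχO)
  have hane : (a : ℂ) ≠ 0 := by exact_mod_cast ha.ne'
  have hrne : (r : ℂ) ≠ 0 := by exact_mod_cast hr0.ne'
  have huform : ∀ z, ((r * a : ℝ) : ℂ) * (z + u z) =
      ((r * a : ℝ) : ℂ) * z + (χ z : ℂ) * (φ (r * z) - ((r * a : ℝ) : ℂ) * z) := by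
    intro z
    simp only [u]
    rw [hform (r * z)]
    push_cast
    field_simp
    ring
  refine ⟨g, hg, fun j hj => ?_, fun T S hTS hφS x hx => ?_⟩
  · rw [(h1 j (hJO hj)).2, huform, hχ1 j hj]
    congr 1
    push_cast
    ring
  · by_cases hxO : x ∈ (fun w : ℂ => B ((r * a : ℝ) * w)) '' O
    · obtain ⟨z, hz, rfl⟩ := hxO
      have hx' := hx
      simp only at hx ⊢
      rw [hTS _ (hsub _ hra z hz)] at hx
      obtain ⟨h3, h4⟩ := h1 z hz
      rw [h4, hTS _ (hsub _ hra _ h3), huform]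
      by_cases hχz : χ z = 0
      · simpa [hχz] using hx
      have hzt : z ∈ tsupport χ := subset_tsupport _ hχz
      have hzS : z ∈ S := by
        have : ((r * a)⁻¹ : ℝ) • (((r * a : ℝ) : ℂ) * z) ∈ S := S.smul_mem _ hx
        rwa [← Complex.real_smul, smul_smul, inv_mul_cancel₀ hra.1.ne', one_smul] at this
      have hrzS : (r : ℂ) * z ∈ S := by rw [← Complex.real_smul]; exact S.smul_mem _ hzS
      refine S.add_mem hx ?_
      rw [← Complex.real_smul]
      refine S.smul_mem _ (S.sub_mem (hφS _ hrzS ?_) hx)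
      rw [norm_mul, Complex.norm_real, Real.norm_of_nonneg hr0.le]
      have := mul_le_mul_of_nonneg_left (hR z hzt) hr0.le
      linarith
    · rwa [h2 x hxO]

end Slide

section Mobius

open Set Filter Topology Metric

/-- The disc automorphism exchanging `c` and `0` up to sign. -/
noncomputable def discAut (c z : ℂ) : ℂ := (z - c) / (1 - (starRingEnd ℂ) c * z)

theorem discAut_denom_ne_zero {c z : ℂ} (hc : ‖c‖ < 1) (hz : ‖z‖ < 1) :
    1 - (starRingEnd ℂ) c * z ≠ 0 := by
  intro h
  have h1 : ‖(starRingEnd ℂ) c * z‖ < 1 := by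
    rw [norm_mul, RCLike.norm_conj]
    calc ‖c‖ * ‖z‖ ≤ ‖c‖ * 1 := by gcongr
      _ < 1 := by linarith
  rw [← sub_eq_zero.1 h] at h1
  simp at h1

theorem norm_discAut_lt_one {c z : ℂ} (hc : ‖c‖ < 1) (hz : ‖z‖ < 1) : ‖discAut c z‖ < 1 := by
  have hne := discAut_denom_ne_zero hc hz
  rw [discAut, norm_div, div_lt_one (norm_pos_iff.2 hne), ← sq_lt_sq₀ (norm_nonneg _) (norm_nonneg _)]
  have h1 : ‖c‖ ^ 2 < 1 := by nlinarith [norm_nonneg c]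
  have h2 : ‖z‖ ^ 2 < 1 := by nlinarith [norm_nonneg z]
  rw [← Complex.normSq_eq_norm_sq] at h1 h2 ⊢
  rw [← Complex.normSq_eq_norm_sq]
  simp only [Complex.normSq_apply, Complex.sub_re, Complex.sub_im, Complex.one_re, Complex.one_im,
    Complex.mul_re, Complex.mul_im, Complex.conj_re, Complex.conj_im] at *
  nlinarith

theorem discAut_injOn {c : ℂ} (hc : ‖c‖ < 1) : InjOn (discAut c) (ball 0 1) := by
  intro z hz w hw h
  rw [mem_ball_zero_iff] at hz hw
  have h1 := discAut_denom_ne_zero hc hz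
  have h2 := discAut_denom_ne_zero hc hw
  rw [discAut, discAut, div_eq_div_iff h1 h2] at h
  have h3 : (z - w) * (1 - (starRingEnd ℂ) c * c) = 0 := by linear_combination h
  rcases mul_eq_zero.1 h3 with h4 | h4
  · exact sub_eq_zero.1 h4
  · exact absurd h4 (discAut_denom_ne_zero hc hc)

theorem hasDerivAt_discAut {c z : ℂ} (hc : ‖c‖ < 1) (hz : ‖z‖ < 1) :
    HasDerivAt (discAut c) ((1 - (starRingEnd ℂ) c * c) / (1 - (starRingEnd ℂ) c * z) ^ 2) z := by
  have h1 := discAut_denom_ne_zero hc hz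
  have h2 : HasDerivAt (fun z : ℂ => z - c) 1 z := (hasDerivAt_id z).sub_const c
  have h3 : HasDerivAt (fun z : ℂ => 1 - (starRingEnd ℂ) c * z) (-((starRingEnd ℂ) c * 1)) z :=
    ((hasDerivAt_id z).const_mul _).const_sub 1
  have h4 : HasDerivAt (discAut c) _ z := h2.div h3 h1
  exact h4.congr_deriv (by congr 1; ring)

theorem one_sub_conj_mul_self (b : ℂ) : 1 - (starRingEnd ℂ) b * b = ((1 - ‖b‖ ^ 2 : ℝ) : ℂ) := by
  rw [← Complex.normSq_eq_conj_mul_self, Complex.normSq_eq_norm_sq]; push_cast; rfl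

end Mobius

section Riemann

open Set Filter Topology Metric

/-- The injective holomorphic maps from `U` to the unit disc fixing `0`. -/
def IsDiscEmbedding (U : Set ℂ) (h : ℂ → ℂ) : Prop :=
  DifferentiableOn ℂ h U ∧ InjOn h U ∧ MapsTo h U (ball 0 1) ∧ h 0 = 0

theorem hasDerivAt_of_sq {U : Set ℂ} (hU : IsOpen U) {f g : ℂ → ℂ} {z f' : ℂ} (hz : z ∈ U)
    (hg : ContinuousOn g U) (hfg : ∀ w ∈ U, g w ^ 2 = f w) (hf : HasDerivAt f f' z)
    (hz0 : g z ≠ 0) : HasDerivAt g (f' / (2 * g z)) z := by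
  have hgz : ContinuousAt g z := hg.continuousAt (hU.mem_nhds hz)
  rw [hasDerivAt_iff_tendsto_slope] at hf ⊢
  have h1 : Tendsto (fun w => g w + g z) (𝓝[≠] z) (𝓝 (2 * g z)) := by
    rw [two_mul]
    exact (hgz.tendsto.mono_left nhdsWithin_le_nhds).add_const _
  have h2 : 2 * g z ≠ 0 := mul_ne_zero two_ne_zero hz0
  refine (hf.div h1 h2).congr' ?_
  filter_upwards [h1.eventually_ne h2, nhdsWithin_le_nhds (hU.mem_nhds hz), self_mem_nhdsWithin]
    with w hw hwU hwz
  rw [Pi.div_apply, slope_def_field, slope_def_field, ← hfg w hwU, ← hfg z hz]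
  have : w - z ≠ 0 := sub_ne_zero.2 hwz
  field_simp
  ring

/-- The square root trick: a non-surjective embedding does not have maximal derivative. -/
theorem IsDiscEmbedding.exists_deriv_lt {U : Set ℂ} (hU : IsOpen U) (h0 : (0 : ℂ) ∈ U)
    (hsqrt : ∀ f : ℂ → ℂ, ContinuousOn f U → (∀ z ∈ U, f z ≠ 0) →
      ∃ g : ℂ → ℂ, ContinuousOn g U ∧ ∀ z ∈ U, g z ^ 2 = f z)
    {h : ℂ → ℂ} (hh : IsDiscEmbedding U h) (hd : deriv h 0 ≠ 0) {c : ℂ} (hc : ‖c‖ < 1)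
    (hcU : c ∉ h '' U) : ∃ k, IsDiscEmbedding U k ∧ ‖deriv h 0‖ < ‖deriv k 0‖ := by
  obtain ⟨hdiff, hinj, hmaps, hh0⟩ := hh
  have hlt : ∀ z ∈ U, ‖h z‖ < 1 := fun z hz => mem_ball_zero_iff.1 (hmaps hz)
  have hc0 : c ≠ 0 := by
    rintro rfl
    exact hcU ⟨0, h0, hh0⟩
  let f : ℂ → ℂ := fun z => discAut c (h z)
  have hfd : ∀ z ∈ U, HasDerivAt f _ z := fun z hz =>
    (hasDerivAt_discAut hc (hlt z hz)).comp z (hdiff.hasDerivAt (hU.mem_nhds hz))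
  have hf0 : ∀ z ∈ U, f z ≠ 0 := by
    intro z hz hz0
    have hz0 : discAut c (h z) = 0 := hz0
    rw [discAut, div_eq_zero_iff] at hz0
    rcases hz0 with hz0 | hz0
    · exact hcU ⟨z, hz, sub_eq_zero.1 hz0⟩
    · exact discAut_denom_ne_zero hc (hlt z hz) hz0
  obtain ⟨g, hg, hgf⟩ := hsqrt f (fun z hz => (hfd z hz).continuousAt.continuousWithinAt) hf0
  have hg0 : ∀ z ∈ U, g z ≠ 0 := by
    intro z hz h
    apply hf0 z hz
    rw [← hgf z hz, h]; simp
  have hgd : ∀ z ∈ U, HasDerivAt g _ z := fun z hz =>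
    hasDerivAt_of_sq hU hz hg hgf (hfd z hz) (hg0 z hz)
  have hg1 : ∀ z ∈ U, ‖g z‖ < 1 := by
    intro z hz
    have := norm_discAut_lt_one hc (hlt z hz)
    change ‖f z‖ < 1 at this
    rw [← hgf z hz, norm_pow] at this
    by_contra hcon
    push Not at hcon
    nlinarith
  have hb := hg1 0 h0
  have hkd : ∀ z ∈ U, HasDerivAt (fun z => discAut (g 0) (g z)) _ z := fun z hz =>
    (hasDerivAt_discAut hb (hg1 z hz)).comp z (hgd z hz)
  refine ⟨fun z => discAut (g 0) (g z), ⟨?_, ?_, ?_, ?_⟩, ?_⟩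
  · exact fun z hz => (hkd z hz).differentiableAt.differentiableWithinAt
  · intro z hz w hw hzw
    have h1 := discAut_injOn hb (mem_ball_zero_iff.2 (hg1 z hz)) (mem_ball_zero_iff.2 (hg1 w hw)) hzw
    have h2 : f z = f w := by rw [← hgf z hz, ← hgf w hw, h1]
    exact hinj hz hw (discAut_injOn hc (hmaps hz) (hmaps hw) h2)
  · exact fun z hz => mem_ball_zero_iff.2 (norm_discAut_lt_one hb (hg1 z hz))
  · simp [discAut]
  · rw [(hkd 0 h0).deriv, hh0]
    have hbsq : ‖g 0‖ ^ 2 = ‖c‖ := by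
      rw [← norm_pow, hgf 0 h0]
      simp [f, discAut, hh0]
    have hb0 : 0 < ‖g 0‖ := norm_pos_iff.2 (hg0 0 h0)
    have hd0 : 0 < ‖deriv h 0‖ := norm_pos_iff.2 hd
    simp only [one_sub_conj_mul_self, mul_zero, sub_zero, one_pow, div_one, norm_mul, norm_div,
      norm_pow, Complex.norm_real, Complex.norm_ofNat, Real.norm_eq_abs]
    have h1 : 0 < 1 - ‖g 0‖ ^ 2 := by nlinarith
    have h2 : 0 < 1 - ‖c‖ ^ 2 := by nlinarith [norm_nonneg c]
    rw [abs_of_pos h1, abs_of_pos h2, ← hbsq]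
    have : (1 - ‖g 0‖ ^ 2) / (1 - ‖g 0‖ ^ 2) ^ 2 *
        ((1 - (‖g 0‖ ^ 2) ^ 2) * ‖deriv h 0‖ / (2 * ‖g 0‖)) =
        (1 + ‖g 0‖ ^ 2) * ‖deriv h 0‖ / (2 * ‖g 0‖) := by
      field_simp
      ring
    rw [this, lt_div_iff₀ (by positivity)]
    nlinarith [sq_nonneg (1 - ‖g 0‖), mul_pos hd0 (pow_pos (sub_pos.2 hb) 2)]

/-- Pointwise limits of uniformly bounded holomorphic functions are locally uniform. -/
theorem tendstoLocallyUniformlyOn_of_bounded {U : Set ℂ} (hU : IsOpen U) {ι : Type*} {l : Filter ι}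
    [l.NeBot] {F : ι → ℂ → ℂ} {f : ℂ → ℂ} (hF : ∀ i, DifferentiableOn ℂ (F i) U)
    (hb : ∀ i, ∀ z ∈ U, ‖F i z‖ ≤ 1) (hlim : ∀ z ∈ U, Tendsto (fun i => F i z) l (𝓝 (f z))) :
    TendstoLocallyUniformlyOn F f l U := by
  rw [Metric.tendstoLocallyUniformlyOn_iff]
  intro ε hε z hz
  obtain ⟨δ, hδ, hδU⟩ := Metric.isOpen_iff.1 hU z hz
  have hL : ∀ i, ∀ w ∈ ball z δ, dist (F i w) (F i z) ≤ 2 / δ * dist w z := by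
    intro i w hw
    refine Complex.dist_le_div_mul_dist_of_mapsTo_ball ((hF i).mono hδU) (fun y hy => ?_) hw
    rw [mem_closedBall, dist_eq_norm]
    have := norm_sub_le (F i y) (F i z)
    linarith [hb i y (hδU hy), hb i z hz]
  have hL' : ∀ w ∈ ball z δ, dist (f w) (f z) ≤ 2 / δ * dist w z := by
    intro w hw
    exact le_of_tendsto ((hlim w (hδU hw)).dist (hlim z hz)) (Eventually.of_forall fun i => hL i w hw)
  refine ⟨ball z (min δ (ε * δ / 8)), mem_nhdsWithin_of_mem_nhds (ball_mem_nhds _ (by positivity)), ?_⟩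
  filter_upwards [(Metric.tendsto_nhds.1 (hlim z hz)) (ε / 4) (by positivity)] with i hi w hw
  have hwδ : w ∈ ball z δ := ball_subset_ball (min_le_left _ _) hw
  have h1 : dist w z < ε * δ / 8 := (mem_ball.1 hw).trans_le (min_le_right _ _)
  have h2 : 2 / δ * dist w z ≤ ε / 4 := by
    calc 2 / δ * dist w z ≤ 2 / δ * (ε * δ / 8) := by gcongr
      _ = ε / 4 := by field_simp; norm_num
  have h3 := hL i w hwδ
  have h4 := hL' w hwδ
  have h5 := dist_triangle4 (f w) (f z) (F i z) (F i w)
  linarith [dist_comm (f z) (F i z), dist_comm (F i z) (F i w)]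

/-- Hurwitz' theorem for injectivity. -/
theorem injOn_of_tendstoLocallyUniformlyOn {U : Set ℂ} (hU : IsOpen U) (hUc : IsPreconnected U)
    {ι : Type*} {l : Filter ι} [l.NeBot] {F : ι → ℂ → ℂ} {f : ℂ → ℂ}
    (hF : ∀ i, DifferentiableOn ℂ (F i) U) (hinj : ∀ i, InjOn (F i) U)
    (hlim : TendstoLocallyUniformlyOn F f l U) {p : ℂ} (hp : p ∈ U) (hfp : deriv f p ≠ 0) :
    InjOn f U := by
  have hf : DifferentiableOn ℂ f U := hlim.differentiableOn (Eventually.of_forall hF) hU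
  have hfan : AnalyticOnNhd ℂ f U := hf.analyticOnNhd hU
  -- if `f a = c` then for many `i`, `F i` takes the value `c` near `a`
  have key : ∀ a ∈ U, ∀ ρ > 0, ∀ᶠ i in l, ∃ w ∈ ball a ρ ∩ U, F i w = f a := by
    intro a ha ρ hρ
    have hiso : ∀ᶠ z in 𝓝[≠] a, f z ≠ f a := by
      rcases (hfan a ha).eventually_eq_or_eventually_ne (analyticAt_const (v := f a)) with h | h
      · exfalso
        have h2 := hfan.eqOn_of_preconnected_of_eventuallyEq (analyticOnNhd_const (v := f a)) hUc ha h
        have h3 : f =ᶠ[𝓝 p] fun _ => f a := by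
          filter_upwards [hU.mem_nhds hp] with z hz using h2 hz
        rw [h3.deriv_eq] at hfp
        simp at hfp
      · exact h
    rw [eventually_nhdsWithin_iff, Metric.eventually_nhds_iff_ball] at hiso
    obtain ⟨r1, hr1, h1⟩ := hiso
    obtain ⟨r2, hr2, h2⟩ := Metric.isOpen_iff.1 hU a ha
    let r := min (min r1 r2) ρ / 2
    have hr : 0 < r := by positivity
    have hrlt : r < min (min r1 r2) ρ := half_lt_self (by positivity)
    have hrU : closedBall a r ⊆ U :=
      (closedBall_subset_ball (hrlt.trans_le ((min_le_left _ _).trans (min_le_right _ _)))).trans h2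
    obtain ⟨ε, hε, hεs⟩ : ∃ ε > 0, ∀ z ∈ sphere a r, ε ≤ ‖f z - f a‖ := by
      obtain ⟨z, hz, hzm⟩ := (isCompact_sphere a r).exists_isMinOn
        (NormedSpace.sphere_nonempty.2 hr.le) (f := fun z => ‖f z - f a‖)
        ((hf.continuousOn.mono (sphere_subset_closedBall.trans hrU)).sub continuousOn_const).norm
      refine ⟨_, norm_pos_iff.2 (sub_ne_zero.2 (h1 z ?_ ?_)), fun w hw => hzm hw⟩
      · rw [mem_ball, mem_sphere.1 hz]
        exact hrlt.trans_le ((min_le_left _ _).trans (min_le_left _ _))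
      · exact ne_of_mem_sphere hz hr.ne'
    have hunif := (tendstoLocallyUniformlyOn_iff_forall_isCompact hU).1 hlim _ hrU
      (isCompact_closedBall a r)
    rw [Metric.tendstoUniformlyOn_iff] at hunif
    filter_upwards [hunif (ε / 8) (by positivity)] with i hi
    have hia := hi a (mem_closedBall_self hr.le)
    have hdc : DiffContOnCl ℂ (F i) (ball a r) :=
      ((hF i).mono (by rw [closure_ball a hr.ne']; exact hrU)).diffContOnCl
    have hsub := hdc.ball_subset_image_closedBall (ε := ε / 2) hr (fun z hz => ?_) ?_
    · have : f a ∈ ball (F i a) (ε / 2 / 2) := by rw [mem_ball]; linarith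
      obtain ⟨w, hw, hwf⟩ := hsub this
      exact ⟨w, ⟨closedBall_subset_ball (hrlt.trans_le (min_le_right _ _)) hw, hrU hw⟩, hwf⟩
    · have hz' := hi z (sphere_subset_closedBall hz)
      have h4 := dist_triangle4 (f z) (F i z) (F i a) (f a)
      rw [dist_comm (F i a), ← dist_eq_norm] at *
      have := hεs z hz
      rw [← dist_eq_norm] at this
      linarith
    · refine Eventually.frequently (f := 𝓝[≠] a) ?_ |>.filter_mono nhdsWithin_le_nhds
      filter_upwards [self_mem_nhdsWithin, nhdsWithin_le_nhds (hU.mem_nhds ha)] with z hz hzU h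
      exact hz (hinj i hzU ha h)
  intro a ha b hb hab
  by_contra hne
  have hd : 0 < dist a b / 2 := half_pos (dist_pos.2 hne)
  obtain ⟨i, ⟨w, hw, hwa⟩, ⟨w', hw', hwb⟩⟩ := ((key a ha _ hd).and (key b hb _ hd)).exists
  have := hinj i hw.2 hw'.2 (by rw [hwa, hwb, hab])
  subst this
  have h1 := mem_ball.1 hw.1
  have h2 := mem_ball.1 hw'.1
  have := dist_triangle_left a b w
  linarith

theorem exists_bijective_isDiscEmbedding {U : Set ℂ} (hU : IsOpen U) (hUc : IsPreconnected U)
    (hUb : Bornology.IsBounded U) (h0 : (0 : ℂ) ∈ U)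
    (hsqrt : ∀ f : ℂ → ℂ, ContinuousOn f U → (∀ z ∈ U, f z ≠ 0) →
      ∃ g : ℂ → ℂ, ContinuousOn g U ∧ ∀ z ∈ U, g z ^ 2 = f z) :
    ∃ h, IsDiscEmbedding U h ∧ h '' U = ball 0 1 ∧ deriv h 0 ≠ 0 := by
  obtain ⟨R, hR0, hR⟩ := hUb.exists_pos_norm_lt
  let S : Set ℝ := {s | ∃ h, IsDiscEmbedding U h ∧ s = ‖deriv h 0‖}
  have hRc : (R : ℂ) ≠ 0 := by exact_mod_cast hR0.ne'
  have hmem : R⁻¹ ∈ S := by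
    refine ⟨fun z => z / R, ⟨by fun_prop, ?_, ?_, by simp⟩, ?_⟩
    · intro z _ w _ h
      exact (div_left_inj' hRc).1 h
    · intro z hz
      rw [mem_ball_zero_iff, norm_div, Complex.norm_real, Real.norm_of_nonneg hR0.le,
        div_lt_one hR0]
      exact hR z hz
    · simp [abs_of_pos hR0]
  obtain ⟨δ, hδ, hδU⟩ := Metric.isOpen_iff.1 hU 0 h0
  have hbdd : BddAbove S := by
    refine ⟨1 / δ, ?_⟩
    rintro _ ⟨h, hh, rfl⟩
    refine Complex.norm_deriv_le_div_of_mapsTo_ball (hh.1.mono hδU) (fun z hz => ?_) hδ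
    rw [hh.2.2.2]
    exact ball_subset_closedBall (hh.2.2.1 (hδU hz))
  obtain ⟨s, -, hs, hsS⟩ := exists_seq_tendsto_sSup ⟨_, hmem⟩ hbdd
  choose F hF hFs using hsS
  let l : Ultrafilter ℕ := Ultrafilter.of atTop
  have hl : (l : Filter ℕ) ≤ atTop := Ultrafilter.of_le atTop
  have hex : ∀ z, ∃ y, z ∈ U → Tendsto (fun n => F n z) l (𝓝 y) := by
    intro z
    by_cases hz : z ∈ U
    · obtain ⟨y, -, hy⟩ := (isCompact_closedBall (0 : ℂ) 1).ultrafilter_le_nhds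
        (l.map fun n => F n z) (by
          rw [le_principal_iff]
          exact mem_map.2 (univ_mem' fun n : ℕ => ball_subset_closedBall ((hF n).2.2.1 hz)))
      exact ⟨y, fun _ => hy⟩
    · exact ⟨0, fun h => absurd h hz⟩
  choose f hf using hex
  have hlim : TendstoLocallyUniformlyOn F f l U :=
    tendstoLocallyUniformlyOn_of_bounded hU (fun n => (hF n).1)
      (fun n z hz => (mem_ball_zero_iff.1 ((hF n).2.2.1 hz)).le) (fun z hz => hf z hz)
  have hfd : DifferentiableOn ℂ f U :=
    hlim.differentiableOn (Eventually.of_forall fun n => (hF n).1) hU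
  have hderiv : ‖deriv f 0‖ = sSup S := by
    have h1 := ((hlim.deriv (Eventually.of_forall fun n => (hF n).1) hU).tendsto_at h0).norm
    refine tendsto_nhds_unique h1 ((hs.mono_left hl).congr fun n => ?_)
    rw [hFs n]; rfl
  have hpos : 0 < sSup S := (inv_pos.2 hR0).trans_le (le_csSup hbdd hmem)
  have hd0 : deriv f 0 ≠ 0 := norm_pos_iff.1 (hderiv ▸ hpos)
  have hinj : InjOn f U := injOn_of_tendstoLocallyUniformlyOn hU hUc (fun n => (hF n).1)
    (fun n => (hF n).2.1) hlim h0 hd0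
  have hle : ∀ z ∈ U, ‖f z‖ ≤ 1 := fun z hz =>
    le_of_tendsto (hf z hz).norm (Eventually.of_forall fun n =>
      (mem_ball_zero_iff.1 ((hF n).2.2.1 hz)).le)
  have hopen : IsOpen (f '' U) := by
    rcases (hfd.analyticOnNhd hU).is_constant_or_isOpen hUc with ⟨w, hw⟩ | h
    · exfalso
      have h3 : f =ᶠ[𝓝 0] fun _ => w := by
        filter_upwards [hU.mem_nhds h0] with z hz using hw z hz
      rw [h3.deriv_eq] at hd0
      simp at hd0
    · exact h U Subset.rfl hU
  have hlt : f '' U ⊆ ball 0 1 := by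
    have h1 : f '' U ⊆ interior (closedBall 0 1) := by
      refine interior_maximal ?_ hopen
      rintro _ ⟨z, hz, rfl⟩
      exact mem_closedBall_zero_iff.2 (hle z hz)
    rwa [interior_closedBall _ one_ne_zero] at h1
  have hf0 : f 0 = 0 := by
    refine tendsto_nhds_unique (hf 0 h0) ?_
    simp only [(hF _).2.2.2]
    exact tendsto_const_nhds
  have hemb : IsDiscEmbedding U f := ⟨hfd, hinj, fun z hz => hlt ⟨z, hz, rfl⟩, hf0⟩
  refine ⟨f, hemb, hlt.antisymm fun c hc => ?_, hd0⟩
  by_contra hcU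
  obtain ⟨k, hk, hkd⟩ := hemb.exists_deriv_lt hU h0 hsqrt hd0 (mem_ball_zero_iff.1 hc) hcU
  exact absurd (le_csSup hbdd ⟨k, hk, rfl⟩) (not_le.2 (hderiv ▸ hkd))

end Riemann

section InverseHolomorphic

open Set Filter Topology Metric

theorem isOpen_image_of_injOn_holomorphic {U V : Set ℂ} {h : ℂ → ℂ}
    (hh : DifferentiableOn ℂ h U) (hinj : InjOn h U) (hV : IsOpen V) (hVU : V ⊆ U) :
    IsOpen (h '' V) := by
  rw [isOpen_iff_mem_nhds]
  rintro _ ⟨z, hz, rfl⟩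
  obtain ⟨r, hr, hrV⟩ := Metric.isOpen_iff.1 hV z hz
  rcases ((hh.mono (hrV.trans hVU)).analyticOnNhd isOpen_ball).is_constant_or_isOpen
    (convex_ball z r).isPreconnected with ⟨w, hw⟩ | h1
  · exfalso
    have h2 : ∀ᶠ y in 𝓝[≠] z, y ∈ ball z r ∧ y ≠ z :=
      (eventually_mem_set.2 (nhdsWithin_le_nhds (ball_mem_nhds z hr))).and
        self_mem_nhdsWithin
    obtain ⟨y, hy, hyz⟩ := h2.exists
    exact hyz (hinj (hVU (hrV hy)) (hVU hz) (by rw [hw y hy, hw z (mem_ball_self hr)]))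
  · exact mem_of_superset ((h1 _ Subset.rfl isOpen_ball).mem_nhds ⟨z, mem_ball_self hr, rfl⟩)
      (image_mono hrV)

theorem differentiableOn_inverse_of_injOn {U : Set ℂ} (hU : IsOpen U) {h ψ : ℂ → ℂ}
    (hh : DifferentiableOn ℂ h U) (hinj : InjOn h U) (hψ : ∀ z ∈ U, ψ (h z) = z) :
    DifferentiableOn ℂ ψ (h '' U) := by
  have hop : IsOpen (h '' U) := isOpen_image_of_injOn_holomorphic hh hinj hU Subset.rfl
  have hright : ∀ w ∈ h '' U, h (ψ w) = w := by
    rintro _ ⟨z, hz, rfl⟩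
    rw [hψ z hz]
  have hmaps : ∀ w ∈ h '' U, ψ w ∈ U := by
    rintro _ ⟨z, hz, rfl⟩
    rwa [hψ z hz]
  have hcont : ∀ w ∈ h '' U, ContinuousAt ψ w := by
    rintro _ ⟨z, hz, rfl⟩
    rw [ContinuousAt, hψ z hz]
    intro V hV
    obtain ⟨V', hV', hVo, hzV⟩ := _root_.mem_nhds_iff.1 (inter_mem hV (hU.mem_nhds hz))
    have h1 := isOpen_image_of_injOn_holomorphic hh hinj hVo (hV'.trans inter_subset_right)
    refine mem_map.2 (mem_of_superset (h1.mem_nhds ⟨z, hzV, rfl⟩) ?_)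
    rintro _ ⟨y, hy, rfl⟩
    rw [mem_preimage, hψ y (hV' hy).2]
    exact (hV' hy).1
  have hreg : ∀ w ∈ h '' U, deriv h (ψ w) ≠ 0 → DifferentiableAt ℂ ψ w := by
    intro w hw hd
    refine (HasDerivAt.of_local_left_inverse (hcont w hw)
      (hh.hasDerivAt (hU.mem_nhds (hmaps w hw))) hd ?_).differentiableAt
    filter_upwards [hop.mem_nhds hw] with y hy using hright y hy
  intro w hw
  refine (Complex.analyticAt_of_differentiable_on_punctured_nhds_of_continuousAt ?_
    (hcont w hw)).differentiableAt.differentiableWithinAt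
  have hz := hmaps w hw
  have hiso : ∀ᶠ z in 𝓝[≠] (ψ w), deriv h z ≠ 0 := by
    have hana : AnalyticAt ℂ (deriv h) (ψ w) := (hh.analyticOnNhd hU _ hz).deriv
    rcases hana.eventually_eq_zero_or_eventually_ne_zero with h1 | h1
    · exfalso
      obtain ⟨r, hr, hrU⟩ := Metric.eventually_nhds_iff_ball.1 (h1.and (hU.mem_nhds hz))
      have h2 : ∀ᶠ y in 𝓝[≠] (ψ w), y ∈ ball (ψ w) r ∧ y ≠ ψ w :=
        (eventually_mem_set.2 (nhdsWithin_le_nhds (ball_mem_nhds _ hr))).and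
          self_mem_nhdsWithin
      obtain ⟨y, hy, hyz⟩ := h2.exists
      refine hyz (hinj (hrU y hy).2 hz ?_)
      exact (convex_ball (ψ w) r).is_const_of_fderivWithin_eq_zero (𝕜 := ℂ)
        (hh.mono fun y hy => (hrU y hy).2) (fun x hx => by
          rw [fderivWithin_of_isOpen isOpen_ball hx]
          ext
          simpa using (hrU x hx).1) hy (mem_ball_self hr)
    · exact h1
  have htend : Tendsto ψ (𝓝[≠] w) (𝓝[≠] (ψ w)) := by
    refine tendsto_nhdsWithin_iff.2 ⟨(hcont w hw).tendsto.mono_left nhdsWithin_le_nhds, ?_⟩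
    filter_upwards [self_mem_nhdsWithin, nhdsWithin_le_nhds (hop.mem_nhds hw)] with y hy hyU hyw
    exact hy (by rw [mem_singleton_iff, ← hright y hyU, hyw, hright w hw])
  filter_upwards [htend.eventually hiso, nhdsWithin_le_nhds (hop.mem_nhds hw)] with y hy hyU
  exact hreg y hyU hy

end InverseHolomorphic

section RiemannMap

open Set Filter Topology Metric

/-- The data of a normalized Riemann map onto `U`. -/
structure IsRiemannMap (U : Set ℂ) (φ : ℂ → ℂ) (a : ℝ) : Prop where
  pos : 0 < a
  diff : DifferentiableOn ℂ φ (ball 0 1)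
  inj : InjOn φ (ball 0 1)
  image : φ '' ball 0 1 = U
  zero : φ 0 = 0
  deriv_zero : deriv φ 0 = a

theorem isSimplyConnected_unitBall : IsSimplyConnected (ball (0 : ℂ) 1) := by
  have : ContractibleSpace (ball (0 : ℂ) 1) :=
    (convex_ball 0 1).contractibleSpace ⟨0, mem_ball_self one_pos⟩
  exact inferInstanceAs (SimplyConnectedSpace (ball (0 : ℂ) 1))

theorem exists_isRiemannMap {G : ℂ → ℂ} (hG : ContinuousOn G (closedBall 0 1))
    (hinj : InjOn G (closedBall 0 1)) (hopen : ∀ V ⊆ ball (0 : ℂ) 1, IsOpen V → IsOpen (G '' V))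
    (hG0 : G 0 = 0) : ∃ φ a, IsRiemannMap (G '' ball 0 1) φ a := by
  let U := G '' ball 0 1
  have hU : IsOpen U := hopen _ Subset.rfl isOpen_ball
  have hGc : ContinuousOn G (ball 0 1) := hG.mono ball_subset_closedBall
  have h0 : (0 : ℂ) ∈ U := ⟨0, mem_ball_self one_pos, hG0⟩
  have hinv : ∀ w ∈ U, Function.invFunOn G (ball 0 1) w ∈ ball (0 : ℂ) 1 ∧
      G (Function.invFunOn G (ball 0 1) w) = w := fun w hw =>
    ⟨Function.invFunOn_mem hw, Function.invFunOn_eq hw⟩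
  set P := Function.invFunOn G (ball 0 1) with hP
  have hPc : ContinuousOn P U := by
    rw [continuousOn_open_iff hU]
    intro V hV
    have h1 : U ∩ P ⁻¹' V = G '' (ball 0 1 ∩ V) := by
      ext w
      constructor
      · rintro ⟨hw, hwV⟩
        exact ⟨P w, ⟨(hinv w hw).1, hwV⟩, (hinv w hw).2⟩
      · rintro ⟨z, ⟨hz, hzV⟩, rfl⟩
        refine ⟨⟨z, hz, rfl⟩, ?_⟩
        have h2 := hinv (G z) ⟨z, hz, rfl⟩
        rwa [mem_preimage, hinj (ball_subset_closedBall h2.1) (ball_subset_closedBall hz) h2.2]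
    rw [h1]
    exact hopen _ inter_subset_left (isOpen_ball.inter hV)
  obtain ⟨h, hh, him, hd⟩ := exists_bijective_isDiscEmbedding hU
    ((convex_ball (0 : ℂ) 1).isPreconnected.image G hGc)
    (((isCompact_closedBall (0 : ℂ) 1).image_of_continuousOn hG).isBounded.subset
      (image_mono ball_subset_closedBall)) h0 (by
    intro f hf hf0
    obtain ⟨g, hg, hgf⟩ := Complex.exists_continuousOn_pow_eq isSimplyConnected_unitBall isOpen_ball
      (g := f ∘ G) (hf.comp hGc (mapsTo_image _ _)) (by
        rintro ⟨z, hz, hz0⟩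
        exact hf0 _ ⟨z, hz, rfl⟩ hz0) two_ne_zero
    refine ⟨g ∘ P, hg.comp hPc fun w hw => (hinv w hw).1, fun w hw => ?_⟩
    simp [hgf, (hinv w hw).2])
  have hψ : ∀ z ∈ U, Function.invFunOn h U (h z) = z := fun z hz =>
    hh.2.1.leftInvOn_invFunOn hz
  set ψ := Function.invFunOn h U
  have hψd : DifferentiableOn ℂ ψ (ball 0 1) := by
    rw [← him]
    exact differentiableOn_inverse_of_injOn hU hh.1 hh.2.1 hψ
  have hψr : ∀ w ∈ ball (0 : ℂ) 1, ψ w ∈ U ∧ h (ψ w) = w := by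
    rw [← him]
    rintro _ ⟨z, hz, rfl⟩
    rw [hψ z hz]
    exact ⟨hz, rfl⟩
  have hψ0 : ψ 0 = 0 := by
    have := hψ 0 h0
    rwa [hh.2.2.2] at this
  have hb0 : ball (0 : ℂ) 1 ∈ 𝓝 0 := ball_mem_nhds _ one_pos
  have hψd0 : deriv ψ 0 ≠ 0 := by
    intro hc
    have h1 : HasDerivAt (fun w => h (ψ w)) (deriv h 0 * deriv ψ 0) 0 := by
      have h2 : HasDerivAt h (deriv h 0) (ψ 0) := by
        rw [hψ0]
        exact hh.1.hasDerivAt (hU.mem_nhds h0)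
      exact h2.comp 0 (hψd.hasDerivAt hb0)
    have h3 : HasDerivAt (fun w : ℂ => w) (deriv h 0 * deriv ψ 0) 0 :=
      h1.congr_of_eventuallyEq (by filter_upwards [hb0] with w hw using (hψr w hw).2.symm)
    have := h3.unique (hasDerivAt_id 0)
    rw [hc, mul_zero] at this
    exact zero_ne_one this
  let u : ℂ := (starRingEnd ℂ) (deriv ψ 0) / ‖deriv ψ 0‖
  have hnn : ((‖deriv ψ 0‖ : ℝ) : ℂ) ≠ 0 := by
    exact_mod_cast (norm_pos_iff.2 hψd0).ne'
  have hu : ‖u‖ = 1 := by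
    rw [norm_div, RCLike.norm_conj, Complex.norm_real, norm_norm, div_self (norm_ne_zero_iff.2 hψd0)]
  have hu0 : u ≠ 0 := norm_ne_zero_iff.1 (by rw [hu]; exact one_ne_zero)
  have hub : ∀ z ∈ ball (0 : ℂ) 1, u * z ∈ ball (0 : ℂ) 1 := by
    intro z hz
    rw [mem_ball_zero_iff] at hz ⊢
    rwa [norm_mul, hu, one_mul]
  refine ⟨fun z => ψ (u * z), ‖deriv ψ 0‖, norm_pos_iff.2 hψd0, ?_, ?_, ?_, by simp [hψ0], ?_⟩
  · exact hψd.comp (by fun_prop) hub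
  · intro z hz w hw hzw
    have h1 := congrArg h hzw
    simp only [(hψr _ (hub z hz)).2, (hψr _ (hub w hw)).2] at h1
    exact mul_left_cancel₀ hu0 h1
  · apply Subset.antisymm
    · rintro _ ⟨z, hz, rfl⟩
      exact (hψr _ (hub z hz)).1
    · intro w hw
      refine ⟨h w / u, ?_, ?_⟩
      · rw [mem_ball_zero_iff, norm_div, hu, div_one]
        exact mem_ball_zero_iff.1 (hh.2.2.1 hw)
      · simp only [mul_div_cancel₀ _ hu0]
        exact hψ w hw
  · have h2 : HasDerivAt ψ (deriv ψ 0) (u * 0) := by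
      rw [mul_zero]
      exact hψd.hasDerivAt hb0
    have h1 := h2.comp (0 : ℂ) ((hasDerivAt_id (0 : ℂ)).const_mul u)
    have h3 : deriv (fun z => ψ (u * z)) 0 = deriv ψ 0 * (u * 1) := h1.deriv
    rw [h3, mul_one, mul_div_assoc', Complex.mul_conj, Complex.normSq_eq_norm_sq]
    field_simp
    push_cast
    ring

/-- The inverse of a Riemann map. -/
theorem IsRiemannMap.exists_inverse {U : Set ℂ} {φ : ℂ → ℂ} {a : ℝ} (hφ : IsRiemannMap U φ a) :
    ∃ ψ : ℂ → ℂ, DifferentiableOn ℂ ψ U ∧ MapsTo ψ U (ball 0 1) ∧ (∀ z ∈ ball 0 1, ψ (φ z) = z) ∧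
      (∀ w ∈ U, φ (ψ w) = w) ∧ ψ 0 = 0 := by
  have hl : ∀ z ∈ ball (0 : ℂ) 1, Function.invFunOn φ (ball 0 1) (φ z) = z := fun z hz =>
    hφ.inj.leftInvOn_invFunOn hz
  refine ⟨Function.invFunOn φ (ball 0 1), ?_, ?_, hl, ?_, ?_⟩
  · have := differentiableOn_inverse_of_injOn isOpen_ball hφ.diff hφ.inj hl
    rwa [hφ.image] at this
  · rw [← hφ.image]
    rintro _ ⟨z, hz, rfl⟩
    rwa [hl z hz]
  · rw [← hφ.image]
    rintro _ ⟨z, hz, rfl⟩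
    rw [hl z hz]
  · have := hl 0 (mem_ball_self one_pos)
    rwa [hφ.zero] at this

/-- Uniqueness of the Riemann map up to a normalization of the derivative. -/
theorem IsRiemannMap.eqOn {U : Set ℂ} {φ φ' : ℂ → ℂ} {a a' : ℝ} (hφ : IsRiemannMap U φ a)
    (hφ' : IsRiemannMap U φ' a') : EqOn φ φ' (ball 0 1) := by
  obtain ⟨ψ, hψd, hψm, hψl, hψr, hψ0⟩ := hφ.exists_inverse
  obtain ⟨ψ', hψd', hψm', hψl', hψr', hψ0'⟩ := hφ'.exists_inverse
  have hm : MapsTo φ (ball 0 1) U := fun z hz => hφ.image ▸ ⟨z, hz, rfl⟩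
  have hm' : MapsTo φ' (ball 0 1) U := fun z hz => hφ'.image ▸ ⟨z, hz, rfl⟩
  have hb0 : ball (0 : ℂ) 1 ∈ 𝓝 0 := ball_mem_nhds _ one_pos
  let f : ℂ → ℂ := fun z => ψ' (φ z)
  have hf : DifferentiableOn ℂ f (ball 0 1) := hψd'.comp hφ.diff hm
  have hfm : MapsTo f (ball 0 1) (ball 0 1) := fun z hz => hψm' (hm hz)
  have hf0 : f 0 = 0 := by simp [f, hφ.zero, hψ0']
  have hle : ∀ z ∈ ball (0 : ℂ) 1, ‖f z‖ ≤ ‖z‖ := fun z hz =>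
    Complex.norm_le_norm_of_mapsTo_ball hf (hfm.mono_right ball_subset_closedBall) hf0
      (mem_ball_zero_iff.1 hz)
  have hge : ∀ z ∈ ball (0 : ℂ) 1, ‖ψ (φ' z)‖ ≤ ‖z‖ := fun z hz =>
    Complex.norm_le_norm_of_mapsTo_ball (f := fun z => ψ (φ' z)) (hψd.comp hφ'.diff hm')
      (fun z hz => ball_subset_closedBall (hψm (hm' hz))) (by simp [hφ'.zero, hψ0])
      (mem_ball_zero_iff.1 hz)
  have hff : ∀ z ∈ ball (0 : ℂ) 1, φ' (f z) = φ z := fun z hz => hψr' _ (hm hz)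
  have heq : ∀ z ∈ ball (0 : ℂ) 1, ‖f z‖ = ‖z‖ := fun z hz => (hle z hz).antisymm (by
    have := hge (f z) (hfm hz)
    rwa [hff z hz, hψl z hz] at this)
  have hz0 : (1 / 2 : ℂ) ∈ ball (0 : ℂ) 1 := by
    rw [mem_ball_zero_iff]; norm_num
  have haff := Complex.affine_of_mapsTo_ball_of_norm_dslope_eq_div (f := f) (c := 0) (R₁ := 1)
    (R₂ := 1) (z₀ := 1 / 2) hf (by rw [hf0]; exact hfm.mono_right ball_subset_closedBall) hz0 (by
      rw [dslope_of_ne _ (by norm_num), slope_def_field, hf0, sub_zero, sub_zero, norm_div,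
        heq _ hz0]
      norm_num)
  obtain ⟨c, hc⟩ : ∃ c : ℂ, ∀ z ∈ ball (0 : ℂ) 1, f z = z * c :=
    ⟨dslope f 0 (1 / 2), fun z hz => by simpa [hf0] using haff hz⟩
  have hcn : ‖c‖ = 1 := by
    have h1 := heq _ hz0
    rw [hc _ hz0, norm_mul] at h1
    norm_num at h1
    exact h1
  have hd : (a : ℂ) = a' * c := by
    have h1 : HasDerivAt (fun z => φ' (f z)) (a' * c) 0 := by
      have h2 : HasDerivAt φ' a' (f 0) := by
        rw [hf0, ← hφ'.deriv_zero]
        exact hφ'.diff.hasDerivAt hb0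
      have h3 : HasDerivAt f c 0 := by
        have h4 := (hasDerivAt_id (0 : ℂ)).mul_const c
        rw [one_mul] at h4
        exact h4.congr_of_eventuallyEq (by filter_upwards [hb0] with z hz using hc z hz)
      exact h2.comp 0 h3
    have h5 : HasDerivAt φ a 0 := by
      rw [← hφ.deriv_zero]
      exact hφ.diff.hasDerivAt hb0
    exact h5.unique (h1.congr_of_eventuallyEq (by
      filter_upwards [hb0] with z hz using (hff z hz).symm))
  have hac : a = a' := by
    have h1 := congrArg norm hd
    rwa [norm_mul, hcn, mul_one, Complex.norm_real, Complex.norm_real, Real.norm_of_nonneg hφ.pos.le,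
      Real.norm_of_nonneg hφ'.pos.le] at h1
  have hc1 : c = 1 := by
    rw [hac] at hd
    have h1 : (a' : ℂ) ≠ 0 := by exact_mod_cast hφ'.pos.ne'
    exact (mul_eq_left₀ h1).1 hd.symm
  intro z hz
  rw [← hff z hz, hc z hz, hc1, mul_one]

end RiemannMap

section LengthArea

open Set Filter Topology Metric MeasureTheory

theorem lintegral_norm_deriv_sq {U : Set ℂ} (hU : IsOpen U) {f : ℂ → ℂ}
    (hf : DifferentiableOn ℂ f U) (hinj : InjOn f U) :
    ∫⁻ z in U, ENNReal.ofReal (‖deriv f z‖ ^ 2) = volume (f '' U) := by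
  rw [← lintegral_abs_det_fderiv_eq_addHaar_image volume hU.measurableSet
    (f' := fun z => (ContinuousLinearMap.toSpanSingleton ℂ (deriv f z)).restrictScalars ℝ)
    (fun z hz => ((hf.hasDerivAt (hU.mem_nhds hz)).hasFDerivAt.restrictScalars
      ℝ).hasFDerivWithinAt) hinj]
  congr 1
  ext z
  congr 1
  have h1 : ((ContinuousLinearMap.toSpanSingleton ℂ (deriv f z)).restrictScalars ℝ).det =
      Complex.normSq (deriv f z) := by
    rw [← Algebra.norm_complex_apply, Algebra.norm_apply]
    change LinearMap.det _ = _
    congr 1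
    ext w
    simp [mul_comm]
  rw [h1, abs_of_nonneg (Complex.normSq_nonneg _), Complex.normSq_eq_norm_sq]

theorem polar_mem_ball_one_iff {r θ : ℝ} (hr : 0 < r) :
    (r * Complex.exp (θ * Complex.I) : ℂ) ∈ ball (1 : ℂ) 1 ↔ r < 2 * Real.cos θ := by
  rw [mem_ball_iff_norm, ← sq_lt_sq₀ (norm_nonneg _) zero_le_one, ← Complex.normSq_eq_norm_sq,
    Complex.exp_mul_I, ← Complex.ofReal_cos, ← Complex.ofReal_sin]
  simp only [Complex.normSq_apply, Complex.sub_re, Complex.sub_im, Complex.one_re, Complex.one_im,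
    Complex.mul_re, Complex.mul_im, Complex.add_re, Complex.add_im, Complex.ofReal_re,
    Complex.ofReal_im, Complex.I_re, Complex.I_im]
  have h := Real.cos_sq_add_sin_sq θ
  constructor
  · intro h1
    have h2 : r * r < r * (2 * Real.cos θ) := by nlinarith
    exact lt_of_mul_lt_mul_left h2 hr.le
  · intro h1
    have h2 : r * r < r * (2 * Real.cos θ) := by gcongr
    nlinarith

theorem norm_sub_le_of_arc {f : ℂ → ℂ} (hf : DifferentiableOn ℂ f (ball 1 1)) {ε r θ₁ θ₂ : ℝ}
    (hε : 0 < ε) (hr : 0 < r) (h12 : θ₁ ≤ θ₂) (h1 : -Real.pi < θ₁) (h2 : θ₂ ≤ Real.pi)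
    (hm1 : r < 2 * Real.cos θ₁) (hm2 : r < 2 * Real.cos θ₂)
    (hA : ∫⁻ θ in Ioo (-Real.pi) Real.pi, (ball (1 : ℂ) 1).indicator
      (fun z => ENNReal.ofReal (‖deriv f z‖ ^ 2)) (r * Complex.exp (θ * Complex.I)) ≤
        ENNReal.ofReal (ε ^ 2 / (2 * Real.pi) / r ^ 2)) :
    ‖f (r * Complex.exp (θ₂ * Complex.I)) - f (r * Complex.exp (θ₁ * Complex.I))‖ ≤ ε := by
  have hpi := Real.pi_pos
  let γ : ℝ → ℂ := fun θ => r * Complex.exp (θ * Complex.I)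
  have hγ : ∀ θ : ℝ, HasDerivAt γ (r * (Complex.exp (θ * Complex.I) * Complex.I)) θ := by
    intro θ
    have h3 : HasDerivAt (fun z : ℂ => (r : ℂ) * Complex.exp (z * Complex.I))
        (r * (Complex.exp (θ * Complex.I) * (1 * Complex.I))) (θ : ℂ) :=
      (((hasDerivAt_id (θ : ℂ)).mul_const Complex.I).cexp).const_mul (r : ℂ)
    rw [one_mul] at h3
    exact h3.comp_ofReal
  have hmem : ∀ θ ∈ Icc θ₁ θ₂, γ θ ∈ ball (1 : ℂ) 1 := by
    intro θ hθ
    rw [polar_mem_ball_one_iff hr]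
    rcases le_total 0 θ with h | h
    · have := Real.cos_le_cos_of_nonneg_of_le_pi h h2 hθ.2
      linarith
    · have := Real.cos_le_cos_of_nonneg_of_le_pi (neg_nonneg.2 h) (by linarith : -θ₁ ≤ Real.pi)
        (neg_le_neg hθ.1)
      rw [Real.cos_neg, Real.cos_neg] at this
      linarith
  have hγc : Continuous γ := by fun_prop
  have hdc : ContinuousOn (fun θ => deriv f (γ θ)) (Icc θ₁ θ₂) :=
    ((hf.analyticOnNhd isOpen_ball).deriv.continuousOn).comp hγc.continuousOn hmem
  have hsq : ContinuousOn (fun θ => ‖deriv f (γ θ)‖ ^ 2) (Icc θ₁ θ₂) := hdc.norm.pow 2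
  have huIcc : uIcc θ₁ θ₂ = Icc θ₁ θ₂ := uIcc_of_le h12
  have hftc : ∫ θ in θ₁..θ₂, deriv f (γ θ) * (r * (Complex.exp (θ * Complex.I) * Complex.I)) =
      f (γ θ₂) - f (γ θ₁) := by
    refine intervalIntegral.integral_eq_sub_of_hasDerivAt (f := f ∘ γ) (fun θ hθ => ?_) ?_
    · rw [huIcc] at hθ
      exact (hf.hasDerivAt (isOpen_ball.mem_nhds (hmem θ hθ))).comp θ (hγ θ)
    · refine ContinuousOn.intervalIntegrable ?_
      rw [huIcc]
      exact hdc.mul (by fun_prop)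
  let t : ℝ := ε / (2 * Real.pi)
  have ht : 0 < t := by positivity
  have hii : IntervalIntegrable (fun θ => ‖deriv f (γ θ)‖ ^ 2) volume θ₁ θ₂ := by
    refine ContinuousOn.intervalIntegrable ?_
    rwa [huIcc]
  have hbound : ‖f (γ θ₂) - f (γ θ₁)‖ ≤
      ∫ θ in θ₁..θ₂, (t / 2 + r ^ 2 / (2 * t) * ‖deriv f (γ θ)‖ ^ 2) := by
    rw [← hftc]
    refine intervalIntegral.norm_integral_le_of_norm_le h12 (Eventually.of_forall fun θ hθ => ?_)
      ((intervalIntegrable_const).add (hii.const_mul _))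
    rw [norm_mul, norm_mul, norm_mul, Complex.norm_exp_ofReal_mul_I, Complex.norm_I,
      Complex.norm_real, Real.norm_of_nonneg hr.le]
    have h3 : t / 2 + r ^ 2 / (2 * t) * ‖deriv f (γ θ)‖ ^ 2 - ‖deriv f (γ θ)‖ * (r * (1 * 1)) =
        (t - r * ‖deriv f (γ θ)‖) ^ 2 / (2 * t) := by
      field_simp
      ring
    have h4 : 0 ≤ (t - r * ‖deriv f (γ θ)‖) ^ 2 / (2 * t) := by positivity
    linarith
  rw [intervalIntegral.integral_add intervalIntegrable_const (hii.const_mul _),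
    intervalIntegral.integral_const, intervalIntegral.integral_const_mul, smul_eq_mul] at hbound
  have hI : ∫ θ in θ₁..θ₂, ‖deriv f (γ θ)‖ ^ 2 ≤ ε ^ 2 / (2 * Real.pi) / r ^ 2 := by
    rw [← ENNReal.ofReal_le_ofReal_iff (by positivity), intervalIntegral.integral_of_le h12,
      ofReal_integral_eq_lintegral_ofReal hii.1 (Eventually.of_forall fun _ => sq_nonneg _)]
    refine le_trans ?_ hA
    rw [← restrict_Ioo_eq_restrict_Ioc]
    calc ∫⁻ θ in Ioo θ₁ θ₂, ENNReal.ofReal (‖deriv f (γ θ)‖ ^ 2)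
        = ∫⁻ θ in Ioo θ₁ θ₂, (ball (1 : ℂ) 1).indicator
          (fun z => ENNReal.ofReal (‖deriv f z‖ ^ 2)) (γ θ) := by
          refine setLIntegral_congr_fun measurableSet_Ioo fun θ hθ => ?_
          rw [indicator_of_mem (hmem θ (Ioo_subset_Icc_self hθ))]
      _ ≤ _ := lintegral_mono_set (Ioo_subset_Ioo h1.le h2)
  have h5 : r ^ 2 / (2 * t) * ∫ θ in θ₁..θ₂, ‖deriv f (γ θ)‖ ^ 2 ≤
      r ^ 2 / (2 * t) * (ε ^ 2 / (2 * Real.pi) / r ^ 2) := by gcongr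
  have h6 : r ^ 2 / (2 * t) * (ε ^ 2 / (2 * Real.pi) / r ^ 2) = ε / 2 := by
    simp only [t]
    field_simp
  have h7 : (θ₂ - θ₁) * (t / 2) ≤ ε / 2 := by
    calc (θ₂ - θ₁) * (t / 2) ≤ (2 * Real.pi) * (t / 2) := by gcongr; linarith
      _ = ε / 2 := by simp only [t]; field_simp
  change ‖f (γ θ₂) - f (γ θ₁)‖ ≤ ε
  linarith

/-- The length-area principle at the boundary point `0` of the disc of centre `1`. -/
theorem exists_arc_small_oscillation {f : ℂ → ℂ} (hf : DifferentiableOn ℂ f (ball 1 1))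
    (hinj : InjOn f (ball 1 1)) (hb : Bornology.IsBounded (f '' ball 1 1)) {ε δ : ℝ} (hε : 0 < ε)
    (hδ : 0 < δ) : ∃ r ∈ Ioo 0 δ, ∀ z ∈ ball (1 : ℂ) 1, ∀ w ∈ ball (1 : ℂ) 1, ‖z‖ = r → ‖w‖ = r →
      ‖f z - f w‖ ≤ ε := by
  by_contra hcon
  push Not at hcon
  let F : ℂ → ENNReal := (ball (1 : ℂ) 1).indicator (fun z => ENNReal.ofReal (‖deriv f z‖ ^ 2))
  have hFm : Measurable F :=
    ((measurable_deriv f).norm.pow_const 2).ennreal_ofReal.indicator measurableSet_ball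
  let A : ℝ → ENNReal := fun r => ∫⁻ θ in Ioo (-Real.pi) Real.pi, F (r * Complex.exp (θ * Complex.I))
  let c : ℝ := ε ^ 2 / (2 * Real.pi)
  have hpi := Real.pi_pos
  have hc : 0 < c := by positivity
  have hA : ∀ r ∈ Ioo 0 δ, ENNReal.ofReal (c / r ^ 2) < A r := by
    intro r hr
    by_contra hle
    push Not at hle
    obtain ⟨z, hz, w, hw, hzr, hwr, hzw⟩ := hcon r hr
    have hpol : ∀ z : ℂ, ‖z‖ = r → z = r * Complex.exp (z.arg * Complex.I) := by
      rintro z rfl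
      exact (Complex.norm_mul_exp_arg_mul_I z).symm
    rw [hpol z hzr, polar_mem_ball_one_iff hr.1] at hz
    rw [hpol w hwr, polar_mem_ball_one_iff hr.1] at hw
    rw [hpol z hzr, hpol w hwr] at hzw
    rcases le_total z.arg w.arg with h | h
    · rw [norm_sub_rev] at hzw
      exact absurd (norm_sub_le_of_arc hf hε hr.1 h (Complex.neg_pi_lt_arg z) (Complex.arg_le_pi w)
        hz hw hle) (not_le.2 hzw)
    · exact absurd (norm_sub_le_of_arc hf hε hr.1 h (Complex.neg_pi_lt_arg w) (Complex.arg_le_pi z)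
        hw hz hle) (not_le.2 hzw)
  have htot : ∫⁻ r in Ioi (0 : ℝ), ENNReal.ofReal r * A r = volume (f '' ball 1 1) := by
    rw [← lintegral_norm_deriv_sq isOpen_ball hf hinj, ← lintegral_indicator measurableSet_ball,
      ← Complex.lintegral_comp_polarCoord_symm, polarCoord_target, Measure.volume_eq_prod,
      setLIntegral_prod]
    · refine setLIntegral_congr_fun measurableSet_Ioi fun r hr => ?_
      simp only [smul_eq_mul]
      rw [lintegral_const_mul]
      · simp only [A]
        congr 2
        ext θ
        rw [Complex.polarCoord_symm_apply, Complex.exp_mul_I, Complex.ofReal_cos, Complex.ofReal_sin]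
      · simp only [Complex.polarCoord_symm_apply]
        exact hFm.comp (by fun_prop)
    · simp only [Complex.polarCoord_symm_apply, smul_eq_mul]
      exact (measurable_fst.ennreal_ofReal.mul (hFm.comp (by fun_prop))).aemeasurable
  have hfin : ∫⁻ r in Ioo 0 δ, ENNReal.ofReal (c / r) < ⊤ := by
    calc ∫⁻ r in Ioo 0 δ, ENNReal.ofReal (c / r) ≤ ∫⁻ r in Ioo 0 δ, ENNReal.ofReal r * A r := by
          refine setLIntegral_mono' measurableSet_Ioo fun r hr => ?_
          have h1 : c / r = r * (c / r ^ 2) := by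
            have := hr.1.ne'
            field_simp
          rw [h1, ENNReal.ofReal_mul hr.1.le]
          gcongr
          exact (hA r hr).le
      _ ≤ ∫⁻ r in Ioi (0 : ℝ), ENNReal.ofReal r * A r := lintegral_mono_set Ioo_subset_Ioi_self
      _ < ⊤ := by rw [htot]; exact hb.measure_lt_top
  have hii : IntervalIntegrable (fun r : ℝ => c / r) volume 0 δ := by
    rw [intervalIntegrable_iff_integrableOn_Ioo_of_le hδ.le]
    refine ⟨(measurable_const.div measurable_id).aestronglyMeasurable, ?_⟩
    rw [hasFiniteIntegral_iff_ofReal]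
    · exact hfin
    · filter_upwards [ae_restrict_mem measurableSet_Ioo] with r hr
      exact div_nonneg hc.le hr.1.le
  have h2 : IntervalIntegrable (fun r : ℝ => r⁻¹) volume 0 δ := by
    refine (hii.const_mul c⁻¹).congr (fun r _ => ?_)
    change c⁻¹ * (c / r) = r⁻¹
    field_simp
  rw [intervalIntegrable_inv_iff] at h2
  rcases h2 with h2 | h2
  · exact hδ.ne h2
  · exact h2 left_mem_uIcc

end LengthArea

section Caratheodory

open Set Filter Topology Metric

/-- Injective continuous maps of the closed unit disc that are open on the open disc. -/
structure IsDiscChart (G : ℂ → ℂ) : Prop where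
  cont : ContinuousOn G (closedBall 0 1)
  inj : InjOn G (closedBall 0 1)
  isOpen_image : ∀ V ⊆ ball (0 : ℂ) 1, IsOpen V → IsOpen (G '' V)
  zero : G 0 = 0

theorem exists_modulus_of_injOn {X Y : Type*} [PseudoMetricSpace X] [MetricSpace Y] {K : Set X}
    {G : X → Y} (hK : IsCompact K) (hG : ContinuousOn G K) (hinj : InjOn G K) {η : ℝ} (hη : 0 < η) :
    ∃ ε > 0, ∀ x ∈ K, ∀ y ∈ K, dist (G x) (G y) < ε → dist x y < η := by
  let S : Set (X × X) := (K ×ˢ K) ∩ {p | η ≤ dist p.1 p.2}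
  have hS : IsCompact S :=
    (hK.prod hK).inter_right (isClosed_le continuous_const (by fun_prop))
  have hc1 : ContinuousOn (fun p : X × X => G p.1) S := hG.comp continuousOn_fst fun p hp => hp.1.1
  have hc2 : ContinuousOn (fun p : X × X => G p.2) S := hG.comp continuousOn_snd fun p hp => hp.1.2
  have hc : ContinuousOn (fun p : X × X => dist (G p.1) (G p.2)) S :=
    continuous_dist.comp_continuousOn (hc1.prodMk hc2)
  rcases S.eq_empty_or_nonempty with h | h
  · refine ⟨1, one_pos, fun x hx y hy _ => ?_⟩
    by_contra hcon
    have : (x, y) ∈ S := ⟨⟨hx, hy⟩, not_lt.1 hcon⟩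
    rw [h] at this
    exact this
  · obtain ⟨p, hp, hpm⟩ := hS.exists_isMinOn h hc
    refine ⟨dist (G p.1) (G p.2), dist_pos.2 fun heq => ?_, fun x hx y hy hxy => ?_⟩
    · have h1 := hinj hp.1.1 hp.1.2 heq
      have h2 : η ≤ dist p.1 p.2 := hp.2
      rw [h1, dist_self] at h2
      linarith
    · by_contra hcon
      exact absurd hxy (not_lt.2 (hpm (show (x, y) ∈ S from ⟨⟨hx, hy⟩, not_lt.1 hcon⟩)))

/-- The interior part of the boundary correspondence. -/
structure IsDiscFactor (G φ g : ℂ → ℂ) : Prop where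
  maps : MapsTo g (ball 0 1) (ball 0 1)
  eq : ∀ z ∈ ball (0 : ℂ) 1, G (g z) = φ z

variable {G φ g : ℂ → ℂ} {a : ℝ}

theorem exists_isDiscFactor (hφ : IsRiemannMap (G '' ball 0 1) φ a) : ∃ g, IsDiscFactor G φ g := by
  have h : ∀ z, ∃ y, z ∈ ball (0 : ℂ) 1 → y ∈ ball (0 : ℂ) 1 ∧ G y = φ z := by
    intro z
    by_cases hz : z ∈ ball (0 : ℂ) 1
    · have h1 : φ z ∈ G '' ball 0 1 := hφ.image ▸ mem_image_of_mem φ hz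
      obtain ⟨y, hy, hyz⟩ := h1
      exact ⟨y, fun _ => ⟨hy, hyz⟩⟩
    · exact ⟨0, fun h => absurd h hz⟩
  choose g hg using h
  exact ⟨g, fun z hz => (hg z hz).1, fun z hz => (hg z hz).2⟩

namespace IsDiscFactor

theorem continuousOn (hg : IsDiscFactor G φ g) (hG : IsDiscChart G)
    (hφ : IsRiemannMap (G '' ball 0 1) φ a) : ContinuousOn g (ball 0 1) := by
  rw [Metric.continuousOn_iff]
  intro z hz η hη
  obtain ⟨ε, hε, h⟩ := exists_modulus_of_injOn (isCompact_closedBall 0 1) hG.cont hG.inj hη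
  obtain ⟨δ, hδ, hδ'⟩ := Metric.continuousOn_iff.1 hφ.diff.continuousOn z hz ε hε
  refine ⟨δ, hδ, fun w hw hwz => h _ (ball_subset_closedBall (hg.maps hw)) _
    (ball_subset_closedBall (hg.maps hz)) ?_⟩
  rw [hg.eq w hw, hg.eq z hz]
  exact hδ' w hw hwz

theorem injOn (hg : IsDiscFactor G φ g) (hφ : IsRiemannMap (G '' ball 0 1) φ a) :
    InjOn g (ball 0 1) := fun z hz w hw h =>
  hφ.inj hz hw (by rw [← hg.eq z hz, ← hg.eq w hw, h])

/-- The inverse of the interior correspondence. -/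
theorem exists_inverse (hg : IsDiscFactor G φ g) (hG : IsDiscChart G)
    (hφ : IsRiemannMap (G '' ball 0 1) φ a) :
    ∃ k : ℂ → ℂ, ContinuousOn k (ball 0 1) ∧ MapsTo k (ball 0 1) (ball 0 1) ∧
      (∀ z ∈ ball 0 1, k (g z) = z) ∧ ∀ z ∈ ball 0 1, g (k z) = z := by
  obtain ⟨ψ, hψd, hψm, hψl, hψr, -⟩ := hφ.exists_inverse
  refine ⟨fun z => ψ (G z), hψd.continuousOn.comp (hG.cont.mono ball_subset_closedBall)
    (mapsTo_image _ _), fun z hz => hψm ⟨z, hz, rfl⟩, fun z hz => ?_, fun z hz => ?_⟩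
  · simp only [hg.eq z hz, hψl z hz]
  · have h1 : ψ (G z) ∈ ball (0 : ℂ) 1 := hψm ⟨z, hz, rfl⟩
    refine hG.inj (ball_subset_closedBall (hg.maps h1)) (ball_subset_closedBall hz) ?_
    rw [hg.eq _ h1, hψr _ ⟨z, hz, rfl⟩]

/-- The interior correspondence is proper. -/
theorem exists_norm_gt (hg : IsDiscFactor G φ g) (hG : IsDiscChart G)
    (hφ : IsRiemannMap (G '' ball 0 1) φ a) {s : ℝ} (hs : s < 1) :
    ∃ δ > 0, ∀ z ∈ ball (0 : ℂ) 1, 1 - δ < ‖z‖ → s < ‖g z‖ := by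
  obtain ⟨k, hkc, hkm, hkl, -⟩ := hg.exists_inverse hG hφ
  have hsub : closedBall (0 : ℂ) s ⊆ ball 0 1 := closedBall_subset_ball hs
  have hcomp : IsCompact (k '' closedBall 0 s) :=
    (isCompact_closedBall 0 s).image_of_continuousOn (hkc.mono hsub)
  have hopen : IsOpen (ball (0 : ℂ) 1) := isOpen_ball
  obtain ⟨t, ht1, ht⟩ : ∃ t < 1, k '' closedBall 0 s ⊆ closedBall 0 t := by
    rcases (k '' closedBall (0 : ℂ) s).eq_empty_or_nonempty with h | h
    · exact ⟨0, one_pos, by rw [h]; exact empty_subset _⟩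
    · obtain ⟨z, hz, hzm⟩ := hcomp.exists_isMaxOn h continuous_norm.continuousOn
      refine ⟨‖z‖, ?_, fun w hw => mem_closedBall_zero_iff.2 (hzm hw)⟩
      obtain ⟨y, hy, rfl⟩ := hz
      exact mem_ball_zero_iff.1 (hkm (hsub hy))
  refine ⟨1 - t, by linarith, fun z hz hzt => ?_⟩
  by_contra hcon
  have h1 := ht ⟨g z, mem_closedBall_zero_iff.2 (not_lt.1 hcon), rfl⟩
  rw [hkl z hz, mem_closedBall_zero_iff] at h1
  linarith

/-- Small neighbourhoods of boundary points are mapped to small sets. -/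
theorem exists_small_image (hg : IsDiscFactor G φ g) (hG : IsDiscChart G)
    (hφ : IsRiemannMap (G '' ball 0 1) φ a) {ζ : ℂ} (hζ : ‖ζ‖ = 1) {η : ℝ} (hη : 0 < η) :
    ∃ r > 0, ∃ p : ℂ, ∀ z ∈ ball (0 : ℂ) 1, dist z ζ < r → dist (g z) p < η := by
  obtain ⟨k, hkc, hkm, hkl, hkr⟩ := hg.exists_inverse hG hφ
  let ρ : ℝ := min (1 / 4) (η ^ 2 / 8)
  have hρ : 0 < ρ := by positivity
  have hρ4 : ρ ≤ 1 / 4 := min_le_left _ _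
  have hρη : ρ ≤ η ^ 2 / 8 := min_le_right _ _
  obtain ⟨ε, hε, hmod⟩ := exists_modulus_of_injOn (isCompact_closedBall 0 1) hG.cont hG.inj hρ
  obtain ⟨δ, hδ, hprop⟩ := hg.exists_norm_gt hG hφ (s := 1 - ρ) (by linarith)
  have hmap : ∀ z ∈ ball (1 : ℂ) 1, ζ * (1 - z) ∈ ball (0 : ℂ) 1 := by
    intro z hz
    rw [mem_ball_zero_iff, norm_mul, hζ, one_mul, norm_sub_rev]
    exact mem_ball_iff_norm.1 hz
  have hζ0 : ζ ≠ 0 := norm_ne_zero_iff.1 (by rw [hζ]; exact one_ne_zero)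
  obtain ⟨r, hr, harc⟩ := exists_arc_small_oscillation (f := fun z => φ (ζ * (1 - z)))
    (hφ.diff.comp (by fun_prop) hmap) (fun z hz w hw h => by
      have h1 := hφ.inj (hmap z hz) (hmap w hw) h
      have h2 := mul_left_cancel₀ hζ0 h1
      linear_combination -h2)
    (((isCompact_closedBall (0 : ℂ) 1).image_of_continuousOn hG.cont).isBounded.subset (by
      rintro _ ⟨z, hz, rfl⟩
      have h1 : φ (ζ * (1 - z)) ∈ G '' ball 0 1 := hφ.image ▸ mem_image_of_mem φ (hmap z hz)
      exact image_mono ball_subset_closedBall h1)) (half_pos hε) (lt_min hδ one_pos)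
  have hrδ : r < δ := hr.2.trans_le (min_le_left _ _)
  have hr1 : r < 1 := hr.2.trans_le (min_le_right _ _)
  have harc' : ∀ z ∈ ball (0 : ℂ) 1, ∀ w ∈ ball (0 : ℂ) 1, dist z ζ = r → dist w ζ = r →
      dist (g z) (g w) < ρ := by
    intro z hz w hw hzr hwr
    refine hmod _ (ball_subset_closedBall (hg.maps hz)) _ (ball_subset_closedBall (hg.maps hw)) ?_
    rw [hg.eq z hz, hg.eq w hw, dist_eq_norm]
    have hb : ∀ z ∈ ball (0 : ℂ) 1, dist z ζ = r → 1 - z / ζ ∈ ball (1 : ℂ) 1 ∧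
        ‖1 - z / ζ‖ = r ∧ ζ * (1 - (1 - z / ζ)) = z := by
      intro z hz hzr
      refine ⟨?_, ?_, by field_simp; ring⟩
      · rw [mem_ball_iff_norm, sub_sub_cancel_left, norm_neg, norm_div, hζ, div_one]
        exact mem_ball_zero_iff.1 hz
      · rw [← hzr, one_sub_div hζ0, norm_div, hζ, div_one, dist_comm, dist_eq_norm]
    obtain ⟨h1, h2, h3⟩ := hb z hz hzr
    obtain ⟨h4, h5, h6⟩ := hb w hw hwr
    have := harc _ h1 _ h4 h2 h5
    rw [h3, h6] at this
    linarith
  let w₀ : ℂ := ((1 - r : ℝ) : ℂ) * ζ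
  have hw₀n : ‖w₀‖ = 1 - r := by
    rw [norm_mul, hζ, mul_one, Complex.norm_real, Real.norm_of_nonneg (by linarith)]
  have hw₀ : w₀ ∈ ball (0 : ℂ) 1 := by
    rw [mem_ball_zero_iff, hw₀n]; linarith [hr.1]
  have hw₀r : dist w₀ ζ = r := by
    rw [dist_eq_norm]
    have : w₀ - ζ = ((-r : ℝ) : ℂ) * ζ := by simp only [w₀]; push_cast; ring
    rw [this, norm_mul, hζ, mul_one, Complex.norm_real, norm_neg, Real.norm_of_nonneg hr.1.le]
  have hq := hprop w₀ hw₀ (by rw [hw₀n]; linarith)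
  have hq1 : ‖g w₀‖ < 1 := mem_ball_zero_iff.1 (hg.maps hw₀)
  set q := g w₀
  have hqpos : 0 < ‖q‖ := by linarith
  have hqc : (‖q‖ : ℂ) ≠ 0 := by exact_mod_cast hqpos.ne'
  let p : ℂ := q / ‖q‖
  have hp : ‖p‖ = 1 := by
    rw [norm_div, Complex.norm_real, norm_norm, div_self hqpos.ne']
  have hpq : q = ‖q‖ * p := by simp only [p]; field_simp
  let L : ℂ → ℝ := fun z => (z * (starRingEnd ℂ) p).re
  have hL : ∀ z, L z = z.re * p.re + z.im * p.im := by
    intro z; simp [L]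
  have hpsq : p.re * p.re + p.im * p.im = 1 := by
    rw [← Complex.normSq_apply, Complex.normSq_eq_norm_sq, hp, one_pow]
  have hLq : L q = ‖q‖ := by
    rw [hL, hpq]
    simp only [Complex.mul_re, Complex.mul_im, Complex.ofReal_re, Complex.ofReal_im, norm_mul,
      Complex.norm_real, norm_norm, hp]
    linear_combination ‖q‖ * hpsq
  have hLlip : ∀ z w, L z - L w ≤ dist z w := by
    intro z w
    have h1 : L z - L w = ((z - w) * (starRingEnd ℂ) p).re := by
      simp only [L, sub_mul, Complex.sub_re]
    rw [h1, dist_eq_norm]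
    calc _ ≤ ‖(z - w) * (starRingEnd ℂ) p‖ := Complex.re_le_norm _
      _ = ‖z - w‖ := by rw [norm_mul, RCLike.norm_conj, hp, mul_one]
  -- the complement of a cap is convex
  let X : Set ℂ := ball 0 1 ∩ {z | L z ≤ ‖q‖ - ρ}
  have hXc : Convex ℝ X := by
    refine (convex_ball 0 1).inter ?_
    have hlin : IsLinearMap ℝ L := ⟨fun z w => by simp [hL]; ring, fun c z => by simp [hL]; ring⟩
    exact convex_halfSpace_le hlin _
  have hX0 : (0 : ℂ) ∈ X := ⟨mem_ball_self one_pos, by simp [hL]; linarith⟩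
  have hkX : IsPreconnected (k '' X) :=
    hXc.isPreconnected.image k (hkc.mono inter_subset_left)
  have hfar : ∀ z ∈ k '' X, r < dist z ζ := by
    have hne : ∀ z ∈ k '' X, dist z ζ ≠ r := by
      rintro _ ⟨x, hx, rfl⟩ hxr
      have h1 := harc' _ hw₀ _ (hkm hx.1) hw₀r hxr
      rw [hkr x hx.1] at h1
      have h2 := hLlip q x
      have h3 : L x ≤ ‖q‖ - ρ := hx.2
      linarith
    intro z hz
    by_contra hcon
    have hlt : dist z ζ < r := lt_of_le_of_ne (not_lt.1 hcon) (hne z hz)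
    have hg0 : g 0 = 0 := by
      refine hG.inj (ball_subset_closedBall (hg.maps (mem_ball_self one_pos)))
        (mem_closedBall_self zero_le_one) ?_
      rw [hg.eq 0 (mem_ball_self one_pos), hφ.zero, hG.zero]
    have hk0 : k 0 = 0 := by
      have := hkl 0 (mem_ball_self one_pos)
      rwa [hg0] at this
    have h0 : (0 : ℂ) ∈ k '' X := ⟨0, hX0, hk0⟩
    have h0r : r < dist (0 : ℂ) ζ := by rw [dist_zero_left, hζ]; exact hr1
    obtain ⟨y, hy, hyr⟩ := hkX.intermediate_value hz h0 (f := fun y => dist y ζ)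
      (by fun_prop) ⟨hlt.le, h0r.le⟩
    exact hne y hy hyr
  refine ⟨r, hr.1, p, fun z hz hzr => ?_⟩
  have hgz := hg.maps hz
  have hnX : ‖q‖ - ρ < L (g z) := by
    by_contra hcon
    have := hfar z ⟨g z, ⟨hgz, not_lt.1 hcon⟩, hkl z hz⟩
    linarith
  have hsq : dist (g z) p ^ 2 < η ^ 2 := by
    rw [dist_eq_norm, ← Complex.normSq_eq_norm_sq, Complex.normSq_apply]
    have h1 : (g z).re * (g z).re + (g z).im * (g z).im < 1 := by
      rw [← Complex.normSq_apply, Complex.normSq_eq_norm_sq]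
      have := mem_ball_zero_iff.1 hgz
      nlinarith [norm_nonneg (g z)]
    rw [hL] at hnX
    simp only [Complex.sub_re, Complex.sub_im]
    nlinarith
  exact lt_of_pow_lt_pow_left₀ 2 hη.le hsq

end IsDiscFactor

end Caratheodory

section BoundaryCorrespondence

open Set Filter Topology Metric

/-- The boundary correspondence on the closed disc. -/
structure IsBoundaryFactor (G φ χ : ℂ → ℂ) : Prop where
  factor : IsDiscFactor G φ χ
  cont : ContinuousOn χ (closedBall 0 1)
  maps_sphere : MapsTo χ (sphere 0 1) (sphere 0 1)

variable {G φ χ : ℂ → ℂ} {a : ℝ}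

theorem closure_unitBall : closure (ball (0 : ℂ) 1) = closedBall 0 1 :=
  closure_ball 0 one_ne_zero

theorem neBot_nhdsWithin_unitBall {ζ : ℂ} (hζ : ζ ∈ closedBall (0 : ℂ) 1) :
    (𝓝[ball (0 : ℂ) 1] ζ).NeBot :=
  mem_closure_iff_nhdsWithin_neBot.1 (closure_unitBall ▸ hζ)

theorem exists_isBoundaryFactor (hG : IsDiscChart G) (hφ : IsRiemannMap (G '' ball 0 1) φ a) :
    ∃ χ, IsBoundaryFactor G φ χ := by
  obtain ⟨g, hg⟩ := exists_isDiscFactor hφ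
  have hgc := hg.continuousOn hG hφ
  have hlim : ∀ ζ ∈ closedBall (0 : ℂ) 1, ∃ y, Tendsto g (𝓝[ball 0 1] ζ) (𝓝 y) := by
    intro ζ hζ
    rcases (mem_closedBall_zero_iff.1 hζ).lt_or_eq with h | h
    · exact ⟨g ζ, hgc ζ (mem_ball_zero_iff.2 h)⟩
    · have hne := neBot_nhdsWithin_unitBall hζ
      refine CompleteSpace.complete (Metric.cauchy_iff.2 ⟨hne.map _, fun ε hε => ?_⟩)
      obtain ⟨r, hr, p, hp⟩ := hg.exists_small_image hG hφ h (half_pos hε)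
      refine ⟨g '' (ball 0 1 ∩ ball ζ r), image_mem_map (inter_mem self_mem_nhdsWithin
        (nhdsWithin_le_nhds (ball_mem_nhds ζ hr))), ?_⟩
      rintro _ ⟨z, hz, rfl⟩ _ ⟨w, hw, rfl⟩
      have h1 := hp z hz.1 hz.2
      have h2 := hp w hw.1 hw.2
      have h3 := dist_triangle_right (g z) (g w) p
      linarith
  have hext : ∀ z ∈ ball (0 : ℂ) 1, extendFrom (ball 0 1) g z = g z :=
    extendFrom_extends hgc
  have hcont : ContinuousOn (extendFrom (ball 0 1) g) (closedBall 0 1) :=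
    continuousOn_extendFrom closure_unitBall.ge hlim
  refine ⟨extendFrom (ball 0 1) g, ⟨fun z hz => ?_, fun z hz => ?_⟩, hcont, ?_⟩
  · rw [hext z hz]
    exact hg.maps hz
  · rw [hext z hz, hg.eq z hz]
  · intro ζ hζ
    have hζc := sphere_subset_closedBall hζ
    have hne := neBot_nhdsWithin_unitBall hζc
    obtain ⟨y, hy⟩ := hlim ζ hζc
    rw [extendFrom_eq (closure_unitBall ▸ hζc) hy, mem_sphere_zero_iff_norm]
    refine le_antisymm ?_ ?_
    · refine le_of_tendsto hy.norm ?_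
      filter_upwards [self_mem_nhdsWithin] with z hz
      exact (mem_ball_zero_iff.1 (hg.maps hz)).le
    · refine le_of_forall_lt_imp_le_of_dense fun s hs => ?_
      obtain ⟨δ, hδ, h⟩ := hg.exists_norm_gt hG hφ hs
      refine ge_of_tendsto hy.norm ?_
      have h1 : ∀ᶠ z in 𝓝[ball 0 1] ζ, 1 - δ < ‖z‖ := by
        refine nhdsWithin_le_nhds (continuous_norm.continuousAt.eventually_const_lt ?_)
        change 1 - δ < ‖ζ‖
        rw [mem_sphere_zero_iff_norm.1 hζ]
        linarith
      filter_upwards [self_mem_nhdsWithin, h1] with z hz hz1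
      exact (h z hz hz1).le

theorem isPreconnected_sphere_diff_singleton {p : ℂ} (hp : ‖p‖ = 1) :
    IsPreconnected (sphere (0 : ℂ) 1 \ {p}) := by
  have hp0 : p ≠ 0 := norm_ne_zero_iff.1 (by rw [hp]; exact one_ne_zero)
  have h : sphere (0 : ℂ) 1 \ {p} =
      (fun α : ℝ => -p * Complex.exp (α * Complex.I)) '' Ioo (-Real.pi) Real.pi := by
    ext q
    constructor
    · rintro ⟨hq, hqp⟩
      have hq1 : ‖-q / p‖ = 1 := by
        rw [norm_div, norm_neg, mem_sphere_zero_iff_norm.1 hq, hp, div_one]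
      have h1 := Complex.norm_mul_exp_arg_mul_I (-q / p)
      rw [hq1, Complex.ofReal_one, one_mul] at h1
      refine ⟨(-q / p).arg, ⟨Complex.neg_pi_lt_arg _, lt_of_le_of_ne (Complex.arg_le_pi _) ?_⟩, ?_⟩
      · intro hpi
        rw [hpi, Complex.exp_pi_mul_I] at h1
        apply hqp
        field_simp at h1
        simpa using h1.symm
      · simp only [h1]
        field_simp
    · rintro ⟨α, hα, rfl⟩
      refine ⟨?_, fun hc => ?_⟩
      · simp [hp]
      · have h1 : Complex.exp (α * Complex.I) = -1 := by
          have h2 : -p * Complex.exp (α * Complex.I) = -p * (-1) := by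
            have hc' : -p * Complex.exp (α * Complex.I) = p := hc
            rw [hc']; ring
          exact mul_left_cancel₀ (neg_ne_zero.2 hp0) h2
        have h3 := Complex.arg_exp_mul_I α
        rw [h1, Complex.arg_neg_one, toIocMod_eq_self (Real.two_pi_pos) |>.2
          ⟨hα.1, by linarith [hα.2]⟩] at h3
        exact hα.2.ne' h3
  rw [h]
  exact isPreconnected_Ioo.image _ (by fun_prop)

namespace IsBoundaryFactor

theorem maps_closedBall (h : IsBoundaryFactor G φ χ) :
    MapsTo χ (closedBall 0 1) (closedBall 0 1) := by
  intro z hz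
  rcases (mem_closedBall_zero_iff.1 hz).lt_or_eq with h1 | h1
  · exact ball_subset_closedBall (h.factor.maps (mem_ball_zero_iff.2 h1))
  · exact sphere_subset_closedBall (h.maps_sphere (mem_sphere_zero_iff_norm.2 h1))

/-- The boundary correspondence is not constant on an arc. -/
theorem exists_ne_on_arc (h : IsBoundaryFactor G φ χ) (hG : IsDiscChart G)
    (hφ : IsRiemannMap (G '' ball 0 1) φ a) {p ζ₀ : ℂ} (hp : p ∈ sphere (0 : ℂ) 1) {V : Set ℂ}
    (hV : IsOpen V) (hζV : ζ₀ ∈ V) (hζ₀ : ‖ζ₀‖ = 1) :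
    ∃ ζ ∈ sphere (0 : ℂ) 1, ζ ∈ V ∧ χ ζ ≠ p := by
  by_contra hcon
  push Not at hcon
  let F : ℂ → ℂ := fun z => G (χ z) - G p
  have hFc : ContinuousOn F (closedBall 0 1) :=
    (hG.cont.comp h.cont h.maps_closedBall).sub continuousOn_const
  have hFd : DifferentiableOn ℂ F (ball 0 1) :=
    (hφ.diff.sub_const (G p)).congr fun z hz => by simp only [F, h.factor.eq z hz]
  obtain ⟨t, ht, htc⟩ := (isCompact_sphere (0 : ℂ) 1).elim_nhds_subcover
    (fun ζ => {z | ζ₀ / ζ * z ∈ V}) (fun ζ hζ => by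
      have hζ0 : ζ ≠ 0 := ne_zero_of_mem_unit_sphere ⟨ζ, hζ⟩
      refine (hV.preimage (by fun_prop : Continuous fun z => ζ₀ / ζ * z)).mem_nhds ?_
      rwa [mem_preimage, div_mul_cancel₀ _ hζ0])
  have hrot : ∀ ζ ∈ t, ∀ z : ℂ, ‖ζ₀ / ζ * z‖ = ‖z‖ := by
    intro ζ hζ z
    rw [norm_mul, norm_div, hζ₀, mem_sphere_zero_iff_norm.1 (ht ζ hζ), div_one, one_mul]
  let H : ℂ → ℂ := fun z => ∏ ζ ∈ t, F (ζ₀ / ζ * z)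
  have hH : DiffContOnCl ℂ H (ball 0 1) := by
    refine ⟨DifferentiableOn.fun_finsetProd fun ζ hζ => hFd.comp (by fun_prop) fun z hz => ?_, ?_⟩
    · rw [mem_ball_zero_iff, hrot ζ hζ]
      exact mem_ball_zero_iff.1 hz
    · rw [closure_unitBall]
      refine continuousOn_finsetProd t fun ζ hζ => hFc.comp (by fun_prop) fun z hz => ?_
      rw [mem_closedBall_zero_iff, hrot ζ hζ]
      exact mem_closedBall_zero_iff.1 hz
  have hH0 : H 0 = 0 := by
    refine Complex.eqOn_closure_of_eqOn_frontier isBounded_ball hH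
      (diffContOnCl_const (c := (0 : ℂ))) (fun z hz => ?_) (subset_closure (mem_ball_self one_pos))
    rw [frontier_ball 0 one_ne_zero] at hz
    obtain ⟨ζ, hζ, hzV⟩ := mem_iUnion₂.1 (htc hz)
    refine Finset.prod_eq_zero hζ ?_
    have h1 := hcon (ζ₀ / ζ * z) (by
      rw [mem_sphere_zero_iff_norm, hrot ζ hζ]
      exact mem_sphere_zero_iff_norm.1 hz) hzV
    simp only [F, h1, sub_self]
  obtain ⟨ζ, -, hζ⟩ := Finset.prod_eq_zero_iff.1 hH0
  have h0 : G (χ 0) = G p := by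
    simpa [F, sub_eq_zero] using hζ
  have h1 := hG.inj (h.maps_closedBall (mem_closedBall_self zero_le_one))
    (sphere_subset_closedBall hp) h0
  have h2 := mem_ball_zero_iff.1 (h.factor.maps (mem_ball_self one_pos))
  rw [h1, mem_sphere_zero_iff_norm.1 hp] at h2
  exact lt_irrefl _ h2

theorem injOn_sphere (h : IsBoundaryFactor G φ χ) (hG : IsDiscChart G)
    (hφ : IsRiemannMap (G '' ball 0 1) φ a) : InjOn χ (sphere 0 1) := by
  intro ζ₁ h₁ ζ₂ h₂ h12
  by_contra hne
  set p := χ ζ₁ with hp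
  have hps : p ∈ sphere (0 : ℂ) 1 := h.maps_sphere h₁
  obtain ⟨k, hkc, hkm, hkl, hkr⟩ := h.factor.exists_inverse hG hφ
  let d := ζ₂ - ζ₁
  have hd : d ≠ 0 := sub_ne_zero.2 (Ne.symm hne)
  have hdn : 0 < Complex.normSq d := Complex.normSq_pos.2 hd
  let L : ℂ → ℝ := fun z => ((z - ζ₁) * (starRingEnd ℂ) d).im
  have hLc : Continuous L := Complex.continuous_im.comp (by fun_prop)
  have hn1 : ζ₁.re * ζ₁.re + ζ₁.im * ζ₁.im = 1 := by
    rw [← Complex.normSq_apply, Complex.normSq_eq_norm_sq, mem_sphere_zero_iff_norm.1 h₁, one_pow]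
  have hn2 : ζ₂.re * ζ₂.re + ζ₂.im * ζ₂.im = 1 := by
    rw [← Complex.normSq_apply, Complex.normSq_eq_norm_sq, mem_sphere_zero_iff_norm.1 h₂, one_pow]
  have hends : ∀ z ∈ sphere (0 : ℂ) 1, L z = 0 → z = ζ₁ ∨ z = ζ₂ := by
    intro z hz hLz
    let τ : ℝ := ((z - ζ₁) * (starRingEnd ℂ) d).re / Complex.normSq d
    have hzτ : z = ζ₁ + τ * d := by
      have h1 : (z - ζ₁) * (starRingEnd ℂ) d = ((τ * Complex.normSq d : ℝ) : ℂ) := by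
        apply Complex.ext
        · rw [Complex.ofReal_re, div_mul_cancel₀ _ hdn.ne']
        · rw [Complex.ofReal_im]; exact hLz
      have h2 : (starRingEnd ℂ) d ≠ 0 := (map_ne_zero _).2 hd
      have h3 : (z - ζ₁) * (starRingEnd ℂ) d = (τ * d) * (starRingEnd ℂ) d := by
        rw [h1, mul_assoc, Complex.mul_conj]; push_cast; ring
      have h4 := mul_right_cancel₀ h2 h3
      linear_combination h4
    have hnz : z.re * z.re + z.im * z.im = 1 := by
      rw [← Complex.normSq_apply, Complex.normSq_eq_norm_sq, mem_sphere_zero_iff_norm.1 hz, one_pow]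
    have hre : z.re = ζ₁.re + τ * (ζ₂.re - ζ₁.re) := by
      rw [hzτ]; simp [d]
    have him : z.im = ζ₁.im + τ * (ζ₂.im - ζ₁.im) := by
      rw [hzτ]; simp [d]
    have hquad : τ * (τ - 1) * Complex.normSq d = 0 := by
      rw [Complex.normSq_apply]
      simp only [d, Complex.sub_re, Complex.sub_im]
      rw [hre, him] at hnz
      linear_combination hnz - hn1 - τ * (hn2 - hn1)
    rcases mul_eq_zero.1 hquad with h5 | h5
    · rcases mul_eq_zero.1 h5 with h6 | h6
      · left; rw [hzτ, h6]; simp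
      · right; rw [hzτ, sub_eq_zero.1 h6]; simp [d]
    · exact absurd h5 hdn.ne'
  have hside : ∀ τ : ℝ, (τ = 1 ∨ τ = -1) → ∃ ζ₀ : ℂ, ‖ζ₀‖ = 1 ∧ 0 < τ * L ζ₀ := by
    intro τ hτ
    have hτ2 : τ * τ = 1 := by rcases hτ with rfl | rfl <;> norm_num
    have hτn : ‖(τ : ℂ)‖ = 1 := by rcases hτ with rfl | rfl <;> simp
    have hnd : 0 < ‖d‖ := norm_pos_iff.2 hd
    refine ⟨τ * Complex.I * (d / ‖d‖), ?_, ?_⟩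
    · rw [norm_mul, norm_mul, hτn, Complex.norm_I, norm_div, Complex.norm_real, norm_norm,
        div_self hnd.ne']; norm_num
    · have h1 : L (τ * Complex.I * (d / ‖d‖)) = τ * ‖d‖ - (ζ₁ * (starRingEnd ℂ) d).im := by
        have h2 : (τ * Complex.I * (d / ‖d‖) - ζ₁) * (starRingEnd ℂ) d =
            ((τ * ‖d‖ : ℝ) : ℂ) * Complex.I - ζ₁ * (starRingEnd ℂ) d := by
          have h3 : d * (starRingEnd ℂ) d = (‖d‖ : ℂ) * ‖d‖ := by
            rw [Complex.mul_conj, Complex.normSq_eq_norm_sq]; push_cast; ring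
          have h4 : (‖d‖ : ℂ) ≠ 0 := by exact_mod_cast hnd.ne'
          rw [sub_mul]
          congr 1
          calc τ * Complex.I * (d / ‖d‖) * (starRingEnd ℂ) d
              = τ * Complex.I * ((d * (starRingEnd ℂ) d) / ‖d‖) := by ring
            _ = ((τ * ‖d‖ : ℝ) : ℂ) * Complex.I := by
              rw [h3, mul_div_assoc, div_self h4]; push_cast; ring
        change Complex.im _ = _
        rw [h2]; simp
      have h5 : (ζ₁ * (starRingEnd ℂ) d).im ^ 2 < ‖d‖ ^ 2 := by
        have h6 : (ζ₁ * (starRingEnd ℂ) d).re ^ 2 + (ζ₁ * (starRingEnd ℂ) d).im ^ 2 = ‖d‖ ^ 2 := by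
          have h7 : ‖ζ₁ * (starRingEnd ℂ) d‖ ^ 2 = ‖d‖ ^ 2 := by
            rw [norm_mul, RCLike.norm_conj, mem_sphere_zero_iff_norm.1 h₁, one_mul]
          rw [← h7, ← Complex.normSq_eq_norm_sq (ζ₁ * _), Complex.normSq_apply]; ring
        have h8 : (ζ₁ * (starRingEnd ℂ) d).re = -(Complex.normSq d) / 2 := by
          rw [Complex.normSq_apply]
          simp only [d, Complex.mul_re, Complex.conj_re, Complex.conj_im, Complex.sub_re,
            Complex.sub_im]
          linear_combination (hn2 - hn1) / 2
        rw [h8] at h6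
        nlinarith
      have h9 := abs_lt_of_sq_lt_sq h5 hnd.le
      rw [h1, mul_sub, ← mul_assoc, hτ2, one_mul]
      rcases hτ with rfl | rfl <;> linarith [(abs_lt.1 h9).1, (abs_lt.1 h9).2]
  have hcontra : ∀ τ : ℝ, (τ = 1 ∨ τ = -1) → ¬ ∀ q ∈ sphere (0 : ℂ) 1 \ {p}, ∃ s > 0,
      ∀ z ∈ ball (0 : ℂ) 1, dist (χ z) q < s → τ * L z < 0 := by
    intro τ hτ hq
    obtain ⟨ζ₀, hζ₀, hζL⟩ := hside τ hτ
    obtain ⟨ζ, hζ, hζV, hζp⟩ := h.exists_ne_on_arc hG hφ hps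
      (isOpen_lt continuous_const (continuous_const.mul hLc) : IsOpen {z | 0 < τ * L z}) hζL hζ₀
    obtain ⟨s, hs, hsz⟩ := hq (χ ζ) ⟨h.maps_sphere hζ, hζp⟩
    have hζc := sphere_subset_closedBall hζ
    have := neBot_nhdsWithin_unitBall hζc
    have h1 : ∀ᶠ z in 𝓝[ball 0 1] ζ, dist (χ z) (χ ζ) < s :=
      (h.cont ζ hζc).mono ball_subset_closedBall (ball_mem_nhds _ hs)
    have h2 : ∀ᶠ z in 𝓝[ball 0 1] ζ, 0 < τ * L z :=
      nhdsWithin_le_nhds ((continuous_const.mul hLc).continuousAt.eventually_const_lt hζV)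
    obtain ⟨z, hz1, hz2, hz3⟩ := (h1.and (h2.and self_mem_nhdsWithin)).exists
    linarith [hsz z hz3 hz1]
  let Γ : Set ℂ := closedBall 0 1 ∩ {z | L z = 0}
  have hΓ : IsCompact (χ '' Γ) := ((isCompact_closedBall 0 1).inter_right
    (isClosed_eq hLc continuous_const)).image_of_continuousOn (h.cont.mono inter_subset_left)
  let O : ℝ → Set ℂ := fun τ => {q | ∃ s > 0, ∀ z ∈ ball (0 : ℂ) 1, dist (χ z) q < s → τ * L z < 0}
  have hO : ∀ τ, IsOpen (O τ) := by
    intro τ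
    rw [Metric.isOpen_iff]
    rintro q ⟨s, hs, hq⟩
    refine ⟨s / 2, half_pos hs, fun q' hq' => ⟨s / 2, half_pos hs, fun z hz hzq => hq z hz ?_⟩⟩
    have := dist_triangle (χ z) q' q
    rw [mem_ball] at hq'
    linarith
  have hcover : sphere (0 : ℂ) 1 \ {p} ⊆ O 1 ∪ O (-1) := by
    rintro q ⟨hq, hqp⟩
    have hqΓ : q ∉ χ '' Γ := by
      rintro ⟨z, ⟨hz, hLz⟩, rfl⟩
      have hzs : z ∈ sphere (0 : ℂ) 1 := by
        by_contra hzs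
        have h1 : z ∈ ball (0 : ℂ) 1 := by
          rw [mem_ball_zero_iff]
          exact lt_of_le_of_ne (mem_closedBall_zero_iff.1 hz)
            fun hc => hzs (mem_sphere_zero_iff_norm.2 hc)
        have h2 := mem_ball_zero_iff.1 (h.factor.maps h1)
        rw [mem_sphere_zero_iff_norm.1 hq] at h2
        exact lt_irrefl _ h2
      rcases hends z hzs hLz with rfl | rfl
      · exact hqp rfl
      · exact hqp h12.symm
    obtain ⟨s, hs, hsub⟩ := Metric.isOpen_iff.1 hΓ.isClosed.isOpen_compl q hqΓ
    have hconn : IsPreconnected (k '' (ball 0 1 ∩ ball q s)) :=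
      ((convex_ball _ _).inter (convex_ball _ _)).isPreconnected.image k
        (hkc.mono inter_subset_left)
    have hne0 : ∀ z ∈ k '' (ball 0 1 ∩ ball q s), L z ≠ 0 := by
      rintro _ ⟨z, hz, rfl⟩ hLz
      refine hsub hz.2 ⟨k z, ⟨ball_subset_closedBall (hkm hz.1), hLz⟩, hkr z hz.1⟩
    have hmemk : ∀ z ∈ ball (0 : ℂ) 1, dist (χ z) q < s → z ∈ k '' (ball 0 1 ∩ ball q s) :=
      fun z hz hzq => ⟨χ z, ⟨h.factor.maps hz, hzq⟩, hkl z hz⟩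
    by_cases hall : ∀ z ∈ k '' (ball 0 1 ∩ ball q s), L z < 0
    · exact Or.inl ⟨s, hs, fun z hz hzq => by linarith [hall z (hmemk z hz hzq)]⟩
    · push Not at hall
      obtain ⟨z₀, hz₀, hz₀L⟩ := hall
      refine Or.inr ⟨s, hs, fun z hz hzq => ?_⟩
      by_contra hc
      have hzm := hmemk z hz hzq
      obtain ⟨y, hy, hy0⟩ := hconn.intermediate_value hzm hz₀ hLc.continuousOn
        (show (0 : ℝ) ∈ Icc (L z) (L z₀) from ⟨by linarith, hz₀L⟩)
      exact hne0 y hy hy0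
  have hpre := isPreconnected_sphere_diff_singleton (mem_sphere_zero_iff_norm.1 hps)
  have hex : ∀ τ : ℝ, (τ = 1 ∨ τ = -1) → ((sphere (0 : ℂ) 1 \ {p}) ∩ O (-τ)).Nonempty := by
    intro τ hτ
    by_contra hcon
    rw [not_nonempty_iff_eq_empty] at hcon
    refine hcontra τ hτ fun q hq => ?_
    have h1 : q ∉ O (-τ) := fun hc => by
      have : q ∈ (sphere (0 : ℂ) 1 \ {p}) ∩ O (-τ) := ⟨hq, hc⟩
      rw [hcon] at this
      exact this
    rcases hτ with rfl | rfl
    · exact (hcover hq).resolve_right h1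
    · rw [neg_neg] at h1
      exact (hcover hq).resolve_left h1
  have e1 := hex (-1) (Or.inr rfl)
  rw [neg_neg] at e1
  obtain ⟨q, hq, ⟨s, hs, hqs⟩, ⟨s', hs', hqs'⟩⟩ := hpre _ _ (hO 1) (hO (-1)) hcover e1
    (hex 1 (Or.inl rfl))
  have hqc : q ∈ closure (ball (0 : ℂ) 1) := closure_unitBall ▸ sphere_subset_closedBall hq.1
  obtain ⟨z, hz, hzq⟩ := Metric.mem_closure_iff.1 hqc (min s s') (lt_min hs hs')
  rw [dist_comm] at hzq
  have h1 := hqs (k z) (hkm hz) (by rw [hkr z hz]; exact hzq.trans_le (min_le_left _ _))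
  have h2 := hqs' (k z) (hkm hz) (by rw [hkr z hz]; exact hzq.trans_le (min_le_right _ _))
  linarith

theorem injOn (h : IsBoundaryFactor G φ χ) (hG : IsDiscChart G)
    (hφ : IsRiemannMap (G '' ball 0 1) φ a) : InjOn χ (closedBall 0 1) := by
  intro z hz w hw hzw
  have key : ∀ y ∈ closedBall (0 : ℂ) 1, ‖y‖ = 1 ∨ y ∈ ball (0 : ℂ) 1 ∧ ‖χ y‖ < 1 := by
    intro y hy
    rcases (mem_closedBall_zero_iff.1 hy).lt_or_eq with h1 | h1
    · exact Or.inr ⟨mem_ball_zero_iff.2 h1,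
        mem_ball_zero_iff.1 (h.factor.maps (mem_ball_zero_iff.2 h1))⟩
    · exact Or.inl h1
  rcases key z hz with h1 | ⟨h1, h1'⟩ <;> rcases key w hw with h2 | ⟨h2, h2'⟩
  · exact h.injOn_sphere hG hφ (mem_sphere_zero_iff_norm.2 h1) (mem_sphere_zero_iff_norm.2 h2) hzw
  · have := mem_sphere_zero_iff_norm.1 (h.maps_sphere (mem_sphere_zero_iff_norm.2 h1))
    rw [hzw] at this
    linarith
  · have := mem_sphere_zero_iff_norm.1 (h.maps_sphere (mem_sphere_zero_iff_norm.2 h2))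
    rw [← hzw] at this
    linarith
  · exact h.factor.injOn hφ h1 h2 hzw

theorem surjOn (h : IsBoundaryFactor G φ χ) (hG : IsDiscChart G)
    (hφ : IsRiemannMap (G '' ball 0 1) φ a) : SurjOn χ (closedBall 0 1) (closedBall 0 1) := by
  obtain ⟨k, hkc, hkm, hkl, hkr⟩ := h.factor.exists_inverse hG hφ
  have h1 : IsClosed (χ '' closedBall 0 1) :=
    ((isCompact_closedBall 0 1).image_of_continuousOn h.cont).isClosed
  have h2 : ball (0 : ℂ) 1 ⊆ χ '' closedBall 0 1 :=
    fun z hz => ⟨k z, ball_subset_closedBall (hkm hz), hkr z hz⟩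
  have h3 := closure_minimal h2 h1
  rwa [closure_unitBall] at h3

end IsBoundaryFactor

end BoundaryCorrespondence

section Uniformization

open Set Filter Topology Metric

/-- A homeomorphism of the plane turning a disc chart into a Riemann map. -/
structure IsUniformization (G φ : ℂ → ℂ) (a : ℝ) (χ : ℂ ≃ₜ ℂ) : Prop where
  riemann : IsRiemannMap (G '' ball 0 1) φ a
  eq : ∀ z ∈ ball (0 : ℂ) 1, G (χ z) = φ z
  norm_lt : ∀ z : ℂ, ‖z‖ < 1 → ‖χ z‖ < 1
  norm_eq : ∀ z : ℂ, 1 ≤ ‖z‖ → ‖χ z‖ = ‖z‖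
  radial : ∀ z : ℂ, 1 ≤ ‖z‖ → χ z = ‖z‖ * χ (z / ‖z‖)
  zero : χ 0 = 0

theorem exists_isUniformization {G : ℂ → ℂ} (hG : IsDiscChart G) :
    ∃ φ a χ, IsUniformization G φ a χ := by
  obtain ⟨φ, a, hφ⟩ := exists_isRiemannMap hG.cont hG.inj hG.isOpen_image hG.zero
  obtain ⟨χ, h⟩ := exists_isBoundaryFactor hG hφ
  have hinj := h.injOn hG hφ
  have hsurj := h.surjOn hG hφ
  let X : ℂ → ℂ := fun z => if ‖z‖ ≤ 1 then χ z else ‖z‖ * χ (z / ‖z‖)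
  have hX1 : ∀ z : ℂ, ‖z‖ ≤ 1 → X z = χ z := fun z hz => if_pos hz
  have hsph : ∀ z : ℂ, 1 ≤ ‖z‖ → z / ‖z‖ ∈ sphere (0 : ℂ) 1 := by
    intro z hz
    rw [mem_sphere_zero_iff_norm, norm_div, Complex.norm_real, norm_norm, div_self (by linarith)]
  have hX2 : ∀ z : ℂ, 1 ≤ ‖z‖ → X z = ‖z‖ * χ (z / ‖z‖) := by
    intro z hz
    rcases hz.lt_or_eq with h1 | h1
    · exact if_neg (not_le.2 h1)
    · rw [hX1 z h1.ge, ← h1]; simp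
  have hXn : ∀ z : ℂ, 1 ≤ ‖z‖ → ‖X z‖ = ‖z‖ := by
    intro z hz
    rw [hX2 z hz, norm_mul, mem_sphere_zero_iff_norm.1 (h.maps_sphere (hsph z hz)), mul_one,
      Complex.norm_real, norm_norm]
  have hXl : ∀ z : ℂ, ‖z‖ < 1 → ‖X z‖ < 1 := by
    intro z hz
    rw [hX1 z hz.le]
    exact mem_ball_zero_iff.1 (h.factor.maps (mem_ball_zero_iff.2 hz))
  have hc : Continuous X := by
    rw [← continuousOn_univ]
    have hu : (univ : Set ℂ) = closedBall 0 1 ∪ {z | 1 ≤ ‖z‖} := by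
      ext z
      simp [le_total]
    rw [hu]
    refine ContinuousOn.union_of_isClosed ?_ ?_ isClosed_closedBall
      (isClosed_le continuous_const continuous_norm)
    · exact h.cont.congr fun z hz => hX1 z (mem_closedBall_zero_iff.1 hz)
    · refine ContinuousOn.congr (f := fun z : ℂ => ‖z‖ * χ (z / ‖z‖)) ?_ fun z hz => hX2 z hz
      refine (by fun_prop : Continuous fun z : ℂ => (‖z‖ : ℂ)).continuousOn.mul
        (h.cont.comp ?_ fun z hz => sphere_subset_closedBall (hsph z hz))
      refine continuousOn_id.div (by fun_prop) fun z hz => ?_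
      have : (1 : ℝ) ≤ ‖z‖ := hz
      exact_mod_cast (by linarith : ‖z‖ ≠ 0)
  have hXi : Function.Injective X := by
    intro z w hzw
    rcases lt_or_ge ‖z‖ 1 with hz | hz <;> rcases lt_or_ge ‖w‖ 1 with hw | hw
    · rw [hX1 z hz.le, hX1 w hw.le] at hzw
      exact hinj (mem_closedBall_zero_iff.2 hz.le) (mem_closedBall_zero_iff.2 hw.le) hzw
    · have h1 := hXl z hz
      rw [hzw, hXn w hw] at h1
      linarith
    · have h1 := hXl w hw
      rw [← hzw, hXn z hz] at h1
      linarith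
    · have h1 : ‖z‖ = ‖w‖ := by rw [← hXn z hz, ← hXn w hw, hzw]
      have h0 : (‖w‖ : ℂ) ≠ 0 := by exact_mod_cast (by linarith : ‖w‖ ≠ 0)
      rw [hX2 z hz, hX2 w hw, h1] at hzw
      have h2 := hinj (sphere_subset_closedBall (h1 ▸ hsph z hz))
        (sphere_subset_closedBall (hsph w hw)) (mul_left_cancel₀ h0 hzw)
      exact (div_left_inj' h0).1 h2
  have hXs : Function.Surjective X := by
    intro y
    rcases le_total ‖y‖ 1 with hy | hy
    · obtain ⟨z, hz, hzy⟩ := hsurj (mem_closedBall_zero_iff.2 hy)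
      exact ⟨z, by rw [hX1 z (mem_closedBall_zero_iff.1 hz), hzy]⟩
    · obtain ⟨z, hz, hzy⟩ := hsurj (sphere_subset_closedBall (hsph y hy))
      have h0 : (‖y‖ : ℂ) ≠ 0 := by exact_mod_cast (by linarith : ‖y‖ ≠ 0)
      have hz1 : ‖z‖ = 1 := by
        refine le_antisymm (mem_closedBall_zero_iff.1 hz) (not_lt.1 fun hlt => ?_)
        have h1 := mem_ball_zero_iff.1 (h.factor.maps (mem_ball_zero_iff.2 hlt))
        rw [hzy, mem_sphere_zero_iff_norm.1 (hsph y hy)] at h1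
        exact lt_irrefl _ h1
      have hn : ‖(‖y‖ : ℂ) * z‖ = ‖y‖ := by
        rw [norm_mul, hz1, mul_one, Complex.norm_real, norm_norm]
      refine ⟨‖y‖ * z, ?_⟩
      rw [hX2 _ (by rw [hn]; exact hy), hn, mul_div_cancel_left₀ _ h0, hzy, mul_div_cancel₀ _ h0]
  have hprop : IsProperMap X := by
    refine isProperMap_iff_tendsto_cocompact.2 ⟨hc, ?_⟩
    rw [← Metric.cobounded_eq_cocompact, ← tendsto_norm_atTop_iff_cobounded]
    refine (tendsto_norm_cobounded_atTop (E := ℂ)).congr' ?_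
    filter_upwards [tendsto_norm_cobounded_atTop.eventually_ge_atTop (1 : ℝ)] with z hz
    exact (hXn z hz).symm
  have hH : IsHomeomorph X :=
    isHomeomorph_iff_continuous_isClosedMap_bijective.2 ⟨hc, hprop.isClosedMap, hXi, hXs⟩
  refine ⟨φ, a, hH.homeomorph X, hφ, fun z hz => ?_, hXl, hXn, fun z hz => ?_, ?_⟩
  · change G (X z) = φ z
    rw [hX1 z (mem_ball_zero_iff.1 hz).le, h.factor.eq z hz]
  · change X z = ‖z‖ * X (z / ‖z‖)
    rw [hX2 z hz, hX1 _ (mem_sphere_zero_iff_norm.1 (hsph z hz)).le]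
  · change X 0 = 0
    have h0 : (0 : ℂ) ∈ ball (0 : ℂ) 1 := mem_ball_self one_pos
    rw [hX1 0 (by simp)]
    refine hG.inj (ball_subset_closedBall (h.factor.maps h0)) (ball_subset_closedBall h0) ?_
    rw [h.factor.eq 0 h0, hφ.zero, hG.zero]

end Uniformization

section ProjectivePlane

open Set Filter Topology Metric

/-- The unit sphere of three-dimensional Euclidean space. -/
abbrev UnitSphere3 : Type := Metric.sphere (0 : EuclideanSpace ℝ (Fin 3)) 1

/-- The quotient map from the sphere to the projective plane. -/
def toRP2 (x : UnitSphere3) : RP2 := Quotient.mk antipodalSetoid x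

theorem toRP2_eq_iff {x y : UnitSphere3} :
    toRP2 x = toRP2 y ↔ (x : EuclideanSpace ℝ (Fin 3)) = y ∨ (x : EuclideanSpace ℝ (Fin 3)) = -y :=
  Quotient.eq (r := antipodalSetoid)

theorem toRP2_surjective : Function.Surjective toRP2 := Quotient.mk_surjective

theorem toRP2_neg (x : UnitSphere3) : toRP2 (-x) = toRP2 x := toRP2_eq_iff.2 (Or.inr rfl)

theorem isQuotientMap_toRP2 : IsQuotientMap toRP2 := isQuotientMap_quot_mk

theorem UnitSphere3.coe_smul (g : Metric.sphere (0 : ℝ) 1) (y : UnitSphere3) :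
    ((g • y : UnitSphere3) : EuclideanSpace ℝ (Fin 3)) = (g : ℝ) • (y : EuclideanSpace ℝ (Fin 3)) :=
  rfl

theorem isQuotientCoveringMap_toRP2 :
    IsQuotientCoveringMap toRP2 (Metric.sphere (0 : ℝ) 1) where
  toIsQuotientMap := isQuotientMap_toRP2
  toContinuousConstSMul := inferInstance
  apply_eq_iff_mem_orbit := by
    intro x y
    rw [toRP2_eq_iff]
    constructor
    · rintro (h | h)
      · exact ⟨1, by rw [Subtype.ext_iff, h]; simp⟩
      · exact ⟨-1, by rw [Subtype.ext_iff, h, UnitSphere3.coe_smul]; simp⟩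
    · rintro ⟨g, rfl⟩
      have hg : |(g : ℝ)| = 1 := mem_sphere_zero_iff_norm.1 g.2
      rcases eq_or_eq_neg_of_abs_eq hg with h | h
      · left; simp [UnitSphere3.coe_smul, h]
      · right; simp [UnitSphere3.coe_smul, h]
  disjoint := by
    intro e
    refine ⟨ball e 1, ball_mem_nhds e one_pos, ?_⟩
    rintro g ⟨_, ⟨y, hy, rfl⟩, hgy⟩
    have hg : |(g : ℝ)| = 1 := mem_sphere_zero_iff_norm.1 g.2
    rcases eq_or_eq_neg_of_abs_eq hg with h | h
    · exact Subtype.ext h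
    · exfalso
      have h1 := dist_triangle_right (g • y) y e
      rw [mem_ball] at hy hgy
      have h2 : dist (g • y) y = 2 := by
        rw [Subtype.dist_eq, dist_eq_norm]
        have h3 : ((g • y : UnitSphere3) : EuclideanSpace ℝ (Fin 3)) - y
            = (-2 : ℝ) • (y : EuclideanSpace ℝ (Fin 3)) := by
          rw [UnitSphere3.coe_smul, h]
          module
        rw [h3, norm_smul, mem_sphere_zero_iff_norm.1 y.2]
        norm_num
      have h4 : dist (g • y) e < 1 := hgy
      linarith

theorem isOpenQuotientMap_toRP2 : IsOpenQuotientMap toRP2 :=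
  isQuotientCoveringMap_toRP2.isOpenQuotientMap

theorem isCoveringMap_toRP2 : IsCoveringMap toRP2 := isQuotientCoveringMap_toRP2.isCoveringMap

theorem continuous_toRP2 : Continuous toRP2 := isQuotientMap_toRP2.continuous

instance : CompactSpace RP2 := inferInstanceAs (CompactSpace (Quotient antipodalSetoid))

instance : T2Space RP2 := by
  rw [t2Space_iff_of_isOpenQuotientMap isOpenQuotientMap_toRP2]
  simp only [toRP2_eq_iff]
  exact (isClosed_eq (by fun_prop) (by fun_prop)).union (isClosed_eq (by fun_prop) (by fun_prop))

theorem norm_sq_coords (x y z : ℝ) : ‖(!₂[x, y, z] : EuclideanSpace ℝ (Fin 3))‖ ^ 2 =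
    x ^ 2 + y ^ 2 + z ^ 2 := by
  rw [EuclideanSpace.norm_sq_eq, Fin.sum_univ_three]
  simp

theorem UnitSphere3.sq_add_sq_add_sq (u : UnitSphere3) :
    u.1 0 ^ 2 + u.1 1 ^ 2 + u.1 2 ^ 2 = 1 := by
  have h := EuclideanSpace.norm_sq_eq u.1
  rw [mem_sphere_zero_iff_norm.1 u.2, Fin.sum_univ_three] at h
  simpa using h.symm

/-- Inverse stereographic projection, sending `0` to the north pole. -/
noncomputable def stereo (z : ℂ) : UnitSphere3 :=
  ⟨!₂[2 * z.re / (1 + Complex.normSq z), 2 * z.im / (1 + Complex.normSq z),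
    (1 - Complex.normSq z) / (1 + Complex.normSq z)], by
    have h : 0 < 1 + Complex.normSq z := by linarith [Complex.normSq_nonneg z]
    rw [mem_sphere_zero_iff_norm, ← sq_eq_sq₀ (norm_nonneg _) zero_le_one, norm_sq_coords]
    field_simp
    rw [Complex.normSq_apply]
    ring⟩

/-- Stereographic projection from the south pole. -/
noncomputable def stereoInv (u : UnitSphere3) : ℂ := ⟨u.1 0 / (1 + u.1 2), u.1 1 / (1 + u.1 2)⟩

theorem one_add_normSq_pos (z : ℂ) : 0 < 1 + Complex.normSq z := by
  linarith [Complex.normSq_nonneg z]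

theorem stereo_apply_zero (z : ℂ) : (stereo z).1 0 = 2 * z.re / (1 + Complex.normSq z) := rfl
theorem stereo_apply_one (z : ℂ) : (stereo z).1 1 = 2 * z.im / (1 + Complex.normSq z) := rfl
theorem stereo_apply_two (z : ℂ) :
    (stereo z).1 2 = (1 - Complex.normSq z) / (1 + Complex.normSq z) := rfl

theorem one_add_stereo_two (z : ℂ) : 1 + (stereo z).1 2 = 2 / (1 + Complex.normSq z) := by
  have h := one_add_normSq_pos z
  rw [stereo_apply_two]
  field_simp
  ring

theorem stereoInv_stereo (z : ℂ) : stereoInv (stereo z) = z := by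
  have h := one_add_normSq_pos z
  apply Complex.ext
  · simp only [stereoInv]
    rw [one_add_stereo_two, stereo_apply_zero]
    field_simp
  · simp only [stereoInv]
    rw [one_add_stereo_two, stereo_apply_one]
    field_simp

theorem UnitSphere3.ext_coords {u v : UnitSphere3} (h0 : u.1 0 = v.1 0) (h1 : u.1 1 = v.1 1)
    (h2 : u.1 2 = v.1 2) : u = v := by
  apply Subtype.ext
  ext i
  fin_cases i
  · exact h0
  · exact h1
  · exact h2

theorem stereo_stereoInv {u : UnitSphere3} (hu : u.1 2 ≠ -1) : stereo (stereoInv u) = u := by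
  have h : 1 + u.1 2 ≠ 0 := fun h => hu (by linarith)
  have hs := u.sq_add_sq_add_sq
  have hn : 1 + Complex.normSq (stereoInv u) = 2 / (1 + u.1 2) := by
    rw [Complex.normSq_apply]
    simp only [stereoInv]
    field_simp
    linear_combination hs
  have hn' : Complex.normSq (stereoInv u) = 2 / (1 + u.1 2) - 1 := by linarith
  refine UnitSphere3.ext_coords ?_ ?_ ?_
  · rw [stereo_apply_zero, hn]; simp only [stereoInv]; field_simp
  · rw [stereo_apply_one, hn]; simp only [stereoInv]; field_simp
  · rw [stereo_apply_two, hn, hn']; field_simp; ring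

theorem stereo_two_ne (z : ℂ) : (stereo z).1 2 ≠ -1 := by
  intro h
  have h1 := one_add_stereo_two z
  rw [h] at h1
  have : 0 < 2 / (1 + Complex.normSq z) := by have := one_add_normSq_pos z; positivity
  linarith

theorem continuous_stereo : Continuous stereo := by
  refine Continuous.subtype_mk ?_ _
  have hn : Continuous fun z : ℂ => 1 + Complex.normSq z := by fun_prop
  have h0 : ∀ z : ℂ, 1 + Complex.normSq z ≠ 0 := fun z => (one_add_normSq_pos z).ne'
  refine (PiLp.continuous_toLp 2 _).comp (continuous_pi fun i => ?_)
  fin_cases i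
  · exact ((continuous_const.mul Complex.continuous_re).div hn h0)
  · exact ((continuous_const.mul Complex.continuous_im).div hn h0)
  · exact ((continuous_const.sub Complex.continuous_normSq).div hn h0)

theorem continuous_coord (i : Fin 3) : Continuous fun u : UnitSphere3 => u.1 i := by
  fun_prop

theorem continuousOn_stereoInv : ContinuousOn stereoInv {u | u.1 2 ≠ -1} := by
  have h : ∀ i : Fin 3, ContinuousOn (fun u : UnitSphere3 => u.1 i / (1 + u.1 2))
      {u | u.1 2 ≠ -1} := fun i =>
    (continuous_coord i).continuousOn.div (continuous_const.add (continuous_coord 2)).continuousOn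
      fun u (hu : u.1 2 ≠ -1) h => hu (by linarith)
  have : stereoInv = fun u : UnitSphere3 =>
      ((u.1 0 / (1 + u.1 2) : ℝ) : ℂ) + ((u.1 1 / (1 + u.1 2) : ℝ) : ℂ) * Complex.I := by
    ext u
    apply Complex.ext
    · rw [Complex.add_re, Complex.re_ofReal_mul, Complex.ofReal_re, Complex.I_re, mul_zero, add_zero]
      rfl
    · rw [Complex.add_im, Complex.im_ofReal_mul, Complex.ofReal_im, Complex.I_im, mul_one, zero_add]
      rfl
  rw [this]
  exact (Complex.continuous_ofReal.comp_continuousOn (h 0)).add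
    ((Complex.continuous_ofReal.comp_continuousOn (h 1)).mul continuousOn_const)

theorem isOpenMap_stereo : IsOpenMap stereo := by
  intro V hV
  have h : stereo '' V = {u | u.1 2 ≠ -1} ∩ stereoInv ⁻¹' V := by
    ext u
    constructor
    · rintro ⟨z, hz, rfl⟩
      exact ⟨stereo_two_ne z, by rwa [mem_preimage, stereoInv_stereo]⟩
    · rintro ⟨hu, huV⟩
      exact ⟨stereoInv u, huV, stereo_stereoInv hu⟩
  rw [h]
  exact continuousOn_stereoInv.isOpen_inter_preimage
    (isOpen_ne_fun (continuous_coord 2) continuous_const) hV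

/-- The affine chart of the projective plane. -/
noncomputable def planeMap (z : ℂ) : RP2 := toRP2 (stereo z)

theorem continuous_planeMap : Continuous planeMap := continuous_toRP2.comp continuous_stereo

theorem isOpenMap_planeMap : IsOpenMap planeMap :=
  isOpenQuotientMap_toRP2.isOpenMap.comp isOpenMap_stereo

theorem planeMap_surjective : Function.Surjective planeMap := by
  intro x
  obtain ⟨u, rfl⟩ := toRP2_surjective x
  by_cases hu : u.1 2 = -1
  · refine ⟨stereoInv (-u), ?_⟩
    rw [planeMap, stereo_stereoInv, toRP2_neg]
    have : (-u).1 2 = -(u.1 2) := rfl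
    rw [this, hu]; norm_num
  · exact ⟨stereoInv u, by rw [planeMap, stereo_stereoInv hu]⟩

theorem planeMap_eq_iff {z w : ℂ} :
    planeMap z = planeMap w ↔ z = w ∨ z * (starRingEnd ℂ) w = -1 := by
  have hz := one_add_normSq_pos z
  have hw := one_add_normSq_pos w
  rw [planeMap, planeMap, toRP2_eq_iff]
  refine or_congr ⟨fun h => ?_, fun h => by rw [h]⟩ ⟨fun h => ?_, fun h => ?_⟩
  · rw [← stereoInv_stereo z, ← stereoInv_stereo w, Subtype.ext h]
  · have e0 : (stereo z).1 0 = -(stereo w).1 0 := by rw [h]; rfl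
    have e1 : (stereo z).1 1 = -(stereo w).1 1 := by rw [h]; rfl
    have e2 : (stereo z).1 2 = -(stereo w).1 2 := by rw [h]; rfl
    rw [stereo_apply_zero, stereo_apply_zero] at e0
    rw [stereo_apply_one, stereo_apply_one] at e1
    rw [stereo_apply_two, stereo_apply_two] at e2
    field_simp at e0 e1 e2
    have hn : Complex.normSq z * Complex.normSq w = 1 := by linarith
    have hw0 : Complex.normSq w ≠ 0 := fun h0 => by rw [h0] at hn; simp at hn
    have f0 : z.re * Complex.normSq w = -w.re := by
      have : (1 + Complex.normSq w) * (z.re * Complex.normSq w + w.re) = 0 := by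
        linear_combination Complex.normSq w * e0 - w.re * hn
      have := (mul_eq_zero.1 this).resolve_left hw.ne'
      linarith
    have f1 : z.im * Complex.normSq w = -w.im := by
      have : (1 + Complex.normSq w) * (z.im * Complex.normSq w + w.im) = 0 := by
        linear_combination Complex.normSq w * e1 - w.im * hn
      have := (mul_eq_zero.1 this).resolve_left hw.ne'
      linarith
    have f : z * Complex.normSq w = -w := by
      apply Complex.ext
      · simpa using f0
      · simpa using f1
    have hw' : w ≠ 0 := fun h0 => hw0 (by simp [h0])
    refine mul_right_cancel₀ hw' ?_
    rw [mul_assoc, mul_comm ((starRingEnd ℂ) w), Complex.mul_conj, f]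
    ring
  · have hn : Complex.normSq z * Complex.normSq w = 1 := by
      have := congrArg Complex.normSq h
      simpa using this
    have hw0 : Complex.normSq w ≠ 0 := fun h0 => by rw [h0] at hn; simp at hn
    have f : z * Complex.normSq w = -w := by
      rw [← Complex.mul_conj]
      linear_combination w * h
    have f0 : z.re * Complex.normSq w = -w.re := by simpa using congrArg Complex.re f
    have f1 : z.im * Complex.normSq w = -w.im := by simpa using congrArg Complex.im f
    have hz' : (1 + Complex.normSq w) = Complex.normSq w * (1 + Complex.normSq z) := by
      linear_combination -hn
    have key : stereo z = -stereo w := by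
      refine UnitSphere3.ext_coords ?_ ?_ ?_
      · change _ = -(stereo w).1 0
        rw [stereo_apply_zero, stereo_apply_zero, ← neg_div, div_eq_div_iff hz.ne' hw.ne', hz']
        linear_combination 2 * (1 + Complex.normSq z) * f0
      · change _ = -(stereo w).1 1
        rw [stereo_apply_one, stereo_apply_one, ← neg_div, div_eq_div_iff hz.ne' hw.ne', hz']
        linear_combination 2 * (1 + Complex.normSq z) * f1
      · change _ = -(stereo w).1 2
        rw [stereo_apply_two, stereo_apply_two, ← neg_div, div_eq_div_iff hz.ne' hw.ne']
        linear_combination -2 * hn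
    rw [key]; rfl

theorem planeMap_injOn : InjOn planeMap (ball 0 1) := by
  intro z hz w hw h
  refine (planeMap_eq_iff.1 h).resolve_right fun h1 => ?_
  have h2 := congrArg norm h1
  rw [norm_mul, RCLike.norm_conj, norm_neg, norm_one] at h2
  rw [mem_ball_zero_iff] at hz hw
  nlinarith [norm_nonneg z, norm_nonneg w]

end ProjectivePlane

section Rotations

open Set Filter Topology Metric

/-- A path of odd isometries of the sphere starting at the identity induces an isotopy. -/
theorem exists_isotopy_of_rotation {A : ℝ → EuclideanSpace ℝ (Fin 3) → EuclideanSpace ℝ (Fin 3)}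
    (hc : Continuous fun p : EuclideanSpace ℝ (Fin 3) × ℝ => A p.2 p.1) (h0 : ∀ x, A 0 x = x)
    (hinv : ∀ θ x, A (-θ) (A θ x) = x) (hneg : ∀ θ x, A θ (-x) = -A θ x)
    (hnorm : ∀ θ x, ‖A θ x‖ = ‖x‖) (θ : ℝ) :
    ∃ g ∈ isotopyGroup RP2, ∀ u v : UnitSphere3,
      (v : EuclideanSpace ℝ (Fin 3)) = A θ u → g (toRP2 u) = toRP2 v := by
  let S : ℝ → UnitSphere3 → UnitSphere3 := fun θ u =>
    ⟨A θ u.1, by rw [mem_sphere_zero_iff_norm, hnorm]; exact mem_sphere_zero_iff_norm.1 u.2⟩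
  have hS : ∀ θ u v, toRP2 u = toRP2 v → toRP2 (S θ u) = toRP2 (S θ v) := by
    intro θ u v h
    rw [toRP2_eq_iff] at h ⊢
    rcases h with h | h
    · left; simp only [S, h]
    · right; simp only [S, h, hneg]
  have hSinv : ∀ θ u, S (-θ) (S θ u) = u := fun θ u => Subtype.ext (hinv θ u.1)
  have hlift : ∀ θ, ∀ a b : UnitSphere3, antipodalSetoid a b → toRP2 (S θ a) = toRP2 (S θ b) :=
    fun θ a b h => hS θ a b (Quotient.sound h)
  let H : ℝ → RP2 → RP2 := fun θ => Quotient.lift (fun u => toRP2 (S θ u)) (hlift θ)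
  have hH : ∀ θ u, H θ (toRP2 u) = toRP2 (S θ u) := fun _ _ => rfl
  have hHinv : ∀ θ x, H (-θ) (H θ x) = x := by
    intro θ x
    obtain ⟨u, rfl⟩ := toRP2_surjective x
    rw [hH, hH, hSinv]
  have hHb : ∀ θ, Function.Bijective (H θ) := fun θ =>
    ⟨Function.LeftInverse.injective (hHinv θ), fun x => ⟨H (-θ) x, by simpa using hHinv (-θ) x⟩⟩
  have hHc : Continuous fun p : RP2 × ℝ => H p.2 p.1 := by
    rw [(isOpenQuotientMap_toRP2.prodMap (IsOpenQuotientMap.id (X := ℝ))).isQuotientMap.continuous_iff]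
    refine continuous_toRP2.comp (Continuous.subtype_mk ?_ _)
    exact hc.comp ((continuous_subtype_val.comp continuous_fst).prodMk continuous_snd)
  have hHcθ : ∀ θ, Continuous (H θ) := fun θ => hHc.comp (continuous_id.prodMk continuous_const)
  let g : RP2 ≃ₜ RP2 :=
    { toFun := H θ
      invFun := H (-θ)
      left_inv := hHinv θ
      right_inv := fun x => by simpa using hHinv (-θ) x
      continuous_toFun := hHcθ θ
      continuous_invFun := hHcθ (-θ) }
  refine ⟨g, isotopicToId_of_bijective (H := fun t => H (t * θ)) g ?_ (fun t => hHb _) ?_ ?_, ?_⟩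
  · exact hHc.comp (continuous_fst.prodMk (by fun_prop))
  · intro x
    obtain ⟨u, rfl⟩ := toRP2_surjective x
    rw [hH]
    congr 1
    exact Subtype.ext (by simp [S, h0])
  · intro x
    change H (((1 : unitInterval) : ℝ) * θ) x = H θ x
    simp
  · intro u v huv
    exact congrArg toRP2 (Subtype.ext huv.symm)

theorem continuous_euclidean_triple {Y : Type*} [TopologicalSpace Y] {f g h : Y → ℝ}
    (hf : Continuous f) (hg : Continuous g) (hh : Continuous h) :
    Continuous fun y => (!₂[f y, g y, h y] : EuclideanSpace ℝ (Fin 3)) := by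
  refine (PiLp.continuous_toLp 2 _).comp (continuous_pi fun i => ?_)
  fin_cases i
  · exact hf
  · exact hg
  · exact hh

theorem euclidean_triple_ext {x y : EuclideanSpace ℝ (Fin 3)} (h0 : x 0 = y 0) (h1 : x 1 = y 1)
    (h2 : x 2 = y 2) : x = y := by
  ext i
  fin_cases i
  · exact h0
  · exact h1
  · exact h2

theorem norm_eq_of_sq_coords {x y : EuclideanSpace ℝ (Fin 3)}
    (h : x 0 ^ 2 + x 1 ^ 2 + x 2 ^ 2 = y 0 ^ 2 + y 1 ^ 2 + y 2 ^ 2) : ‖x‖ = ‖y‖ := by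
  rw [← sq_eq_sq₀ (norm_nonneg _) (norm_nonneg _), EuclideanSpace.norm_sq_eq,
    EuclideanSpace.norm_sq_eq, Fin.sum_univ_three, Fin.sum_univ_three]
  simpa using h

theorem exists_isotopy_rotation_vertical (θ : ℝ) :
    ∃ g ∈ isotopyGroup RP2, ∀ u v : UnitSphere3,
      v.1 0 = Real.cos θ * u.1 0 - Real.sin θ * u.1 1 →
      v.1 1 = Real.sin θ * u.1 0 + Real.cos θ * u.1 1 → v.1 2 = u.1 2 →
      g (toRP2 u) = toRP2 v := by
  obtain ⟨g, hg, h⟩ := exists_isotopy_of_rotation (A := fun θ x =>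
    !₂[Real.cos θ * x 0 - Real.sin θ * x 1, Real.sin θ * x 0 + Real.cos θ * x 1, x 2])
    (continuous_euclidean_triple (by fun_prop) (by fun_prop) (by fun_prop))
    (fun x => euclidean_triple_ext (by simp) (by simp) (by simp))
    (fun θ x => by
      have := Real.sin_sq_add_cos_sq θ
      refine euclidean_triple_ext ?_ ?_ ?_ <;> simp
      · linear_combination x 0 * this
      · linear_combination x 1 * this)
    (fun θ x => by refine euclidean_triple_ext ?_ ?_ ?_ <;> simp <;> ring)
    (fun θ x => norm_eq_of_sq_coords (by
      have := Real.sin_sq_add_cos_sq θ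
      simp
      linear_combination (x 0 ^ 2 + x 1 ^ 2) * this)) θ
  exact ⟨g, hg, fun u v h0 h1 h2 => h u v (euclidean_triple_ext h0 h1 h2)⟩

theorem exists_isotopy_rotation_horizontal (θ : ℝ) :
    ∃ g ∈ isotopyGroup RP2, ∀ u v : UnitSphere3,
      v.1 0 = Real.cos θ * u.1 0 - Real.sin θ * u.1 2 → v.1 1 = u.1 1 →
      v.1 2 = Real.sin θ * u.1 0 + Real.cos θ * u.1 2 →
      g (toRP2 u) = toRP2 v := by
  obtain ⟨g, hg, h⟩ := exists_isotopy_of_rotation (A := fun θ x =>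
    !₂[Real.cos θ * x 0 - Real.sin θ * x 2, x 1, Real.sin θ * x 0 + Real.cos θ * x 2])
    (continuous_euclidean_triple (by fun_prop) (by fun_prop) (by fun_prop))
    (fun x => euclidean_triple_ext (by simp) (by simp) (by simp))
    (fun θ x => by
      have := Real.sin_sq_add_cos_sq θ
      refine euclidean_triple_ext ?_ ?_ ?_ <;> simp
      · linear_combination x 0 * this
      · linear_combination x 2 * this)
    (fun θ x => by refine euclidean_triple_ext ?_ ?_ ?_ <;> simp <;> ring)
    (fun θ x => norm_eq_of_sq_coords (by
      have := Real.sin_sq_add_cos_sq θ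
      simp
      linear_combination (x 0 ^ 2 + x 2 ^ 2) * this)) θ
  exact ⟨g, hg, fun u v h0 h1 h2 => h u v (euclidean_triple_ext h0 h1 h2)⟩

/-- Rotations of the affine chart are isotopic to the identity. -/
theorem exists_isotopy_rotation {c : ℂ} (hc : ‖c‖ = 1) :
    ∃ g ∈ isotopyGroup RP2, ∀ z, g (planeMap z) = planeMap (c * z) := by
  obtain ⟨g, hg, h⟩ := exists_isotopy_rotation_vertical c.arg
  have hc0 : c ≠ 0 := norm_ne_zero_iff.1 (by rw [hc]; exact one_ne_zero)
  refine ⟨g, hg, fun z => h _ _ ?_ ?_ ?_⟩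
  all_goals
    have h1 := one_add_normSq_pos z
    have h2 : Complex.normSq (c * z) = Complex.normSq z := by
      rw [Complex.normSq_mul, Complex.normSq_eq_norm_sq c, hc]; ring
    simp only [stereo_apply_zero, stereo_apply_one, stereo_apply_two, h2, Complex.cos_arg hc0,
      Complex.sin_arg, hc, div_one, Complex.mul_re, Complex.mul_im]
  · field_simp
  · field_simp
    ring

/-- Complex conjugation in the affine chart is isotopic to the identity. -/
theorem exists_isotopy_conj :
    ∃ g ∈ isotopyGroup RP2, ∀ z, g (planeMap z) = planeMap ((starRingEnd ℂ) z) := by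
  obtain ⟨g, hg, h⟩ := exists_isotopy_rotation_horizontal Real.pi
  refine ⟨g, hg, fun z => ?_⟩
  rw [planeMap, planeMap, ← toRP2_neg (stereo ((starRingEnd ℂ) z))]
  refine h _ _ ?_ ?_ ?_
  · change -(stereo _).1 0 = _
    simp [stereo_apply_zero]
  · change -(stereo _).1 1 = _
    simp [stereo_apply_one, neg_div]
  · change -(stereo _).1 2 = _
    simp [stereo_apply_two]

/-- The isotopy group acts transitively. -/
theorem exists_isotopy_to_zero (p : RP2) : ∃ g ∈ isotopyGroup RP2, g p = planeMap 0 := by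
  obtain ⟨z, rfl⟩ := planeMap_surjective p
  obtain ⟨c, hc, hcz⟩ : ∃ c : ℂ, ‖c‖ = 1 ∧ c * z = ‖z‖ := by
    refine ⟨Complex.exp (((-z.arg : ℝ) : ℂ) * Complex.I), Complex.norm_exp_ofReal_mul_I _, ?_⟩
    conv_lhs => rw [← Complex.norm_mul_exp_arg_mul_I z]
    rw [mul_left_comm, ← Complex.exp_add]
    simp
  obtain ⟨g, hg, h⟩ := exists_isotopy_rotation hc
  set u := stereo (‖z‖ : ℂ) with hu
  have hu1 : u.1 1 = 0 := by simp [hu, stereo_apply_one]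
  have hu2 := u.sq_add_sq_add_sq
  rw [hu1] at hu2
  let w : ℂ := ⟨u.1 2, u.1 0⟩
  have hw : ‖w‖ = 1 := by
    rw [← sq_eq_sq₀ (norm_nonneg _) zero_le_one, ← Complex.normSq_eq_norm_sq, Complex.normSq_apply]
    simp only [w]
    linear_combination hu2
  have hw0 : w ≠ 0 := norm_ne_zero_iff.1 (by rw [hw]; exact one_ne_zero)
  obtain ⟨k, hk, h'⟩ := exists_isotopy_rotation_horizontal w.arg
  refine ⟨k * g, mul_mem hk hg, ?_⟩
  rw [Homeomorph.mul_apply, h, hcz]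
  refine h' _ _ ?_ ?_ ?_
  · rw [Complex.cos_arg hw0, Complex.sin_arg, hw, ← hu, stereo_apply_zero]
    simp only [w, Complex.zero_re]
    ring
  · rw [← hu, hu1]; simp [stereo_apply_one]
  · rw [Complex.cos_arg hw0, Complex.sin_arg, hw, ← hu]
    simp [stereo_apply_two, w]
    linear_combination -hu2

end Rotations

section Twist

open Set Filter Topology Metric

/-- The extension by the identity of a map of an interval fixing its end points. -/
noncomputable def extendId (κ : ℝ → ℝ) (x₀ x₁ x : ℝ) : ℝ :=
  κ (max x₀ (min x x₁)) + (x - max x₀ (min x x₁))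

theorem clamp_mem {x₀ x₁ : ℝ} (h : x₀ ≤ x₁) (x : ℝ) : max x₀ (min x x₁) ∈ Icc x₀ x₁ :=
  ⟨le_max_left _ _, max_le h (min_le_right _ _)⟩

theorem clamp_of_mem {x₀ x₁ x : ℝ} (hx : x ∈ Icc x₀ x₁) : max x₀ (min x x₁) = x := by
  rw [min_eq_left hx.2, max_eq_right hx.1]

theorem extendId_of_mem {κ : ℝ → ℝ} {x₀ x₁ x : ℝ} (hx : x ∈ Icc x₀ x₁) :
    extendId κ x₀ x₁ x = κ x := by
  rw [extendId, clamp_of_mem hx]; ring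

theorem extendId_of_notMem {κ : ℝ → ℝ} {x₀ x₁ x : ℝ} (h : x₀ ≤ x₁) (h0 : κ x₀ = x₀)
    (h1 : κ x₁ = x₁) (hx : x ∉ Ioo x₀ x₁) : extendId κ x₀ x₁ x = x := by
  rw [extendId]
  rcases le_or_gt x x₀ with hx0 | hx0
  · rw [min_eq_left (hx0.trans h), max_eq_left hx0, h0]; ring
  · have : x₁ ≤ x := not_lt.1 fun h => hx ⟨hx0, h⟩
    rw [min_eq_right this, max_eq_right h, h1]; ring

theorem strictMono_extendId {κ : ℝ → ℝ} {x₀ x₁ : ℝ} (h : x₀ ≤ x₁)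
    (hκ : StrictMonoOn κ (Icc x₀ x₁)) : StrictMono (extendId κ x₀ x₁) := by
  intro x y hxy
  have h1 : max x₀ (min x x₁) ≤ max x₀ (min y x₁) :=
    max_le_max le_rfl (min_le_min hxy.le le_rfl)
  have h2 : x - max x₀ (min x x₁) ≤ y - max x₀ (min y x₁) := by
    rcases le_total x x₁ with a | a <;> rcases le_total y x₁ with b | b <;>
      simp only [min_eq_left, min_eq_right, a, b] <;>
      rcases max_cases x₀ x with c | c <;> rcases max_cases x₀ y with d | d <;>
      rcases max_cases x₀ x₁ with e | e <;> linarith [c.1, d.1, e.1]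
  simp only [extendId]
  rcases h1.lt_or_eq with h3 | h3
  · have := hκ (clamp_mem h x) (clamp_mem h y) h3
    linarith
  · rw [h3] at h2 ⊢
    linarith

theorem continuous_extendId {κ : ℝ → ℝ} {x₀ x₁ : ℝ} (h : x₀ ≤ x₁)
    (hκ : ContinuousOn κ (Icc x₀ x₁)) : Continuous (extendId κ x₀ x₁) := by
  have h1 : Continuous fun x : ℝ => max x₀ (min x x₁) := by fun_prop
  exact (hκ.comp_continuous h1 fun x => clamp_mem h x).add (continuous_id.sub h1)

variable {X : Type*} [TopologicalSpace X] [CompactSpace X] [T2Space X]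

/-- A reparametrization of an embedded arc extends to an isotopy supported in a band around it. -/
theorem exists_isotopy_twist {B : ℂ → X} {x₀ x₁ δ : ℝ} (h01 : x₀ ≤ x₁) (hδ : 0 < δ)
    (hB : ContinuousOn B (Icc x₀ x₁ ×ℂ Icc (-δ) δ))
    (hinj : InjOn B (Ioo x₀ x₁ ×ℂ Ioo (-δ) δ))
    (hopen : IsOpen (B '' (Ioo x₀ x₁ ×ℂ Ioo (-δ) δ)))
    (hdisj : ∀ x ∈ Ioo x₀ x₁ ×ℂ Ioo (-δ) δ, ∀ y ∈ Icc x₀ x₁ ×ℂ Icc (-δ) δ,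
      y ∉ Ioo x₀ x₁ ×ℂ Ioo (-δ) δ → B x ≠ B y)
    {κ : ℝ → ℝ} (hκ : ContinuousOn κ (Icc x₀ x₁)) (hκm : StrictMonoOn κ (Icc x₀ x₁))
    (hκ0 : κ x₀ = x₀) (hκ1 : κ x₁ = x₁) :
    ∃ g ∈ isotopyGroup X, (∀ x ∈ Icc x₀ x₁, g (B x) = B (κ x)) ∧
      (∀ z ∈ Icc x₀ x₁ ×ℂ Icc (-δ) δ, κ z.re = z.re → g (B z) = B z) ∧
      ∀ p ∉ B '' (Ioo x₀ x₁ ×ℂ Ioo (-δ) δ), g p = p := by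
  set e := extendId κ x₀ x₁ with he
  have hec : Continuous e := continuous_extendId h01 hκ
  have hem : StrictMono e := strictMono_extendId h01 hκm
  let b : ℝ → ℝ := fun y => max 0 (1 - |y| / δ)
  have hb0 : ∀ y, 0 ≤ b y := fun y => le_max_left _ _
  have hb1 : ∀ y, b y ≤ 1 := fun y => max_le zero_le_one (by
    have : 0 ≤ |y| / δ := by positivity
    linarith)
  have hbc : Continuous b := by fun_prop
  have hbout : ∀ y ∉ Ioo (-δ) δ, b y = 0 := by
    intro y hy
    have : δ ≤ |y| := not_lt.1 fun h => hy (abs_lt.1 h)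
    have : 1 ≤ |y| / δ := (one_le_div hδ).2 this
    exact max_eq_left (by linarith)
  let H : unitInterval → ℂ → ℂ := fun t z => ⟨z.re + t * b z.im * (e z.re - z.re), z.im⟩
  have hout : ∀ x ∉ Ioo x₀ x₁, e x = x := fun x hx => extendId_of_notMem h01 hκ0 hκ1 hx
  obtain ⟨g, hg, h1, h2⟩ := exists_isotopy_of_supported (H := H)
    (isCompact_Icc.reProdIm isCompact_Icc)
    (fun z hz => ⟨Ioo_subset_Icc_self hz.1, Ioo_subset_Icc_self hz.2⟩) hB hinj hopen hdisj
    (by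
      have : Continuous fun p : ℂ × unitInterval => Complex.equivRealProdCLM.symm
          (p.1.re + p.2 * b p.1.im * (e p.1.re - p.1.re), p.1.im) := by fun_prop
      exact this) (by
      intro t
      have key : ∀ y, Function.Bijective fun x : ℝ => x + t * b y * (e x - x) := by
        intro y
        have hc0 : 0 ≤ (t : ℝ) * b y := mul_nonneg t.2.1 (hb0 y)
        have hc1 : (t : ℝ) * b y ≤ 1 := mul_le_one₀ t.2.2 (hb0 y) (hb1 y)
        generalize (t : ℝ) * b y = c at hc0 hc1
        constructor
        · refine StrictMono.injective fun x x' hxx' => ?_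
          have := hem hxx'
          change x + c * (e x - x) < x' + c * (e x' - x')
          rcases hc0.lt_or_eq with h | h
          · nlinarith
          · rw [← h]; linarith
        · intro w
          by_cases hw : w ∈ Icc x₀ x₁
          · have hcont : ContinuousOn (fun x : ℝ => x + c * (e x - x)) (Icc x₀ x₁) := by fun_prop
            have := intermediate_value_Icc h01 hcont
            simp only [hout x₀ (fun h => lt_irrefl _ h.1), hout x₁ (fun h => lt_irrefl _ h.2),
              sub_self, mul_zero, add_zero] at this
            obtain ⟨x, -, hx⟩ := this hw
            exact ⟨x, hx⟩
          · refine ⟨w, ?_⟩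
            simp [hout w fun h => hw (Ioo_subset_Icc_self h)]
      constructor
      · intro z w hzw
        have him : z.im = w.im := by simpa [H] using congrArg Complex.im hzw
        have hre := congrArg Complex.re hzw
        simp only [H, ← him] at hre
        exact Complex.ext ((key z.im).1 hre) him
      · intro w
        obtain ⟨x, hx⟩ := (key w.im).2 w.re
        exact ⟨⟨x, w.im⟩, Complex.ext hx rfl⟩)
    (by
      intro t z hz
      refine Complex.ext ?_ rfl
      by_cases hr : z.re ∈ Ioo x₀ x₁
      · simp [H, hbout z.im fun h => hz ⟨hr, h⟩]
      · simp [H, hout _ hr])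
    (fun z => Complex.ext (by simp [H]) rfl)
  refine ⟨g, hg, fun x hx => ?_, fun z hz hzk => ?_, h2⟩
  · rw [h1 _ ⟨by simpa using hx, by simpa using hδ.le⟩]
    congr 1
    refine Complex.ext ?_ (by simp [H])
    simp [H, b, he, extendId_of_mem hx]
  · rw [h1 z hz]
    congr 1
    refine Complex.ext ?_ (by simp [H])
    simp [H, he, extendId_of_mem hz.1, hzk]

end Twist

section CircleMaps

open Set Filter Topology Metric

theorem exists_strictMono_lift_circle {ψ : ℂ → ℂ} (hc : ContinuousOn ψ (sphere 0 1))
    (hinj : InjOn ψ (sphere 0 1)) (hmaps : ∀ j ∈ sphere (0 : ℂ) 1, ψ j ∈ sphere (0 : ℂ) 1)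
    (h1 : ψ 1 = 1) :
    ∃ κ : ℝ → ℝ, Continuous κ ∧ StrictMonoOn κ (Icc 0 (2 * Real.pi)) ∧ κ 0 = 0 ∧
      κ (2 * Real.pi) = 2 * Real.pi ∧
      ((∀ x : ℝ, ψ (Complex.exp (x * Complex.I)) = Complex.exp (κ x * Complex.I)) ∨
        ∀ x : ℝ, ψ (Complex.exp (x * Complex.I)) =
          (starRingEnd ℂ) (Complex.exp (κ x * Complex.I))) := by
  have hpi := Real.pi_pos
  have hsph : ∀ x : ℝ, Complex.exp (x * Complex.I) ∈ sphere (0 : ℂ) 1 := fun x => by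
    simp [Complex.norm_exp_ofReal_mul_I]
  let f : C(ℝ, Circle) := ⟨fun x => ⟨ψ (Complex.exp (x * Complex.I)), hmaps _ (hsph x)⟩, by
    refine Continuous.subtype_mk (hc.comp_continuous (by fun_prop) hsph) _⟩
  obtain ⟨κ, ⟨hκ0, hκ⟩, -⟩ := Circle.isCoveringMap_exp.existsUnique_continuousMap_lifts f 0 0 (by
    ext
    change ((Circle.exp 0 : Circle) : ℂ) = ψ (Complex.exp ((0 : ℝ) * Complex.I))
    simp [h1])
  have hκe : ∀ x : ℝ, ψ (Complex.exp (x * Complex.I)) = Complex.exp (κ x * Complex.I) := by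
    intro x
    have h := congrArg (fun u : Circle => (u : ℂ)) (congrFun hκ x)
    change ((Circle.exp (κ x) : Circle) : ℂ) = ψ (Complex.exp (x * Complex.I)) at h
    rw [← h, Circle.coe_exp]
  have hsep : ∀ x ∈ Ico 0 (2 * Real.pi), ∀ y ∈ Ico 0 (2 * Real.pi),
      (∃ n : ℤ, κ x = κ y + n * (2 * Real.pi)) → x = y := by
    rintro x hx y hy ⟨n, hn⟩
    have h2 : Complex.exp (κ x * Complex.I) = Complex.exp (κ y * Complex.I) := by
      rw [Complex.exp_eq_exp_iff_exists_int]
      exact ⟨n, by rw [hn]; push_cast; ring⟩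
    rw [← hκe, ← hκe] at h2
    have h3 := hinj (hsph x) (hsph y) h2
    rw [Complex.exp_eq_exp_iff_exists_int] at h3
    obtain ⟨m, hm⟩ := h3
    have h4 : x = y + m * (2 * Real.pi) := by
      have := congrArg Complex.im hm
      simpa using this
    have h5 : (m : ℝ) < 1 := by
      by_contra! h
      nlinarith [hx.2, hy.1]
    have h6 : -1 < (m : ℝ) := by
      by_contra! h
      nlinarith [hx.1, hy.2]
    have h7 : m = 0 := by
      have a : m < 1 := by exact_mod_cast h5
      have b : -1 < m := by exact_mod_cast h6
      omega
    simpa [h7] using h4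
  have main : ∀ κ : ℝ → ℝ, Continuous κ → κ 0 = 0 → 0 < κ Real.pi →
      (∀ x ∈ Ico 0 (2 * Real.pi), ∀ y ∈ Ico 0 (2 * Real.pi),
        (∃ n : ℤ, κ x = κ y + n * (2 * Real.pi)) → x = y) →
      (∃ n : ℤ, κ (2 * Real.pi) = n * (2 * Real.pi)) →
      StrictMonoOn κ (Icc 0 (2 * Real.pi)) ∧ κ (2 * Real.pi) = 2 * Real.pi := by
    intro κ hκ hκ0 hκπ hsep hper
    have hm1 : ∀ b ∈ Ico Real.pi (2 * Real.pi), StrictMonoOn κ (Icc 0 b) := by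
      intro b hb
      have hinjb : InjOn κ (Icc 0 b) := fun x hx y hy hxy =>
        hsep x ⟨hx.1, hx.2.trans_lt hb.2⟩ y ⟨hy.1, hy.2.trans_lt hb.2⟩ ⟨0, by simpa using hxy⟩
      rcases ContinuousOn.strictMonoOn_of_injOn_Icc' (hpi.le.trans hb.1) hκ.continuousOn hinjb with
        h | h
      · exact h
      · have := h (left_mem_Icc.2 (hpi.le.trans hb.1)) ⟨hpi.le, hb.1⟩ hpi
        linarith
    have hm2 : StrictMonoOn κ (Ico 0 (2 * Real.pi)) := by
      intro x hx y hy hxy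
      exact hm1 (max Real.pi y) ⟨le_max_left _ _, max_lt (by linarith) hy.2⟩
        ⟨hx.1, hxy.le.trans (le_max_right _ _)⟩ ⟨hy.1, le_max_right _ _⟩ hxy
    have hlim : Tendsto κ (𝓝[<] (2 * Real.pi)) (𝓝 (κ (2 * Real.pi))) :=
      hκ.continuousAt.tendsto.mono_left nhdsWithin_le_nhds
    have hm3 : ∀ x ∈ Ico 0 (2 * Real.pi), κ x < κ (2 * Real.pi) := by
      intro x hx
      have hmid : (x + 2 * Real.pi) / 2 ∈ Ico 0 (2 * Real.pi) :=
        ⟨by linarith [hx.1], by linarith [hx.2]⟩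
      refine (hm2 hx hmid (by linarith [hx.2])).trans_le (ge_of_tendsto hlim ?_)
      filter_upwards [Ioo_mem_nhdsLT hmid.2] with y hy
      exact (hm2 hmid ⟨hmid.1.trans hy.1.le, hy.2⟩ hy.1).le
    have hlt : ∀ x ∈ Ico 0 (2 * Real.pi), κ x < 2 * Real.pi := by
      intro x hx
      by_contra! h
      obtain ⟨y, hy, hy'⟩ := intermediate_value_Icc hx.1 hκ.continuousOn
        (⟨by rw [hκ0]; positivity, h⟩ : 2 * Real.pi ∈ Icc (κ 0) (κ x))
      have := hsep y ⟨hy.1, hy.2.trans_lt hx.2⟩ 0 ⟨le_rfl, by positivity⟩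
        ⟨1, by rw [hy', hκ0]; simp⟩
      rw [this, hκ0] at hy'
      linarith
    have hle : κ (2 * Real.pi) ≤ 2 * Real.pi := by
      refine le_of_tendsto hlim ?_
      filter_upwards [Ioo_mem_nhdsLT (show (0 : ℝ) < 2 * Real.pi by positivity)] with y hy
      exact (hlt y ⟨hy.1.le, hy.2⟩).le
    have hpos : 0 < κ (2 * Real.pi) := by
      have := hm3 0 ⟨le_rfl, by positivity⟩
      rwa [hκ0] at this
    refine ⟨fun x hx y hy hxy => ?_, ?_⟩
    · rcases hy.2.lt_or_eq with h | h
      · exact hm2 ⟨hx.1, hxy.trans h⟩ ⟨hy.1, h⟩ hxy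
      · rw [h] at hxy ⊢
        exact hm3 x ⟨hx.1, hxy⟩
    · obtain ⟨n, hn⟩ := hper
      rw [hn] at hle hpos ⊢
      have a : 0 < n := by
        have : (0 : ℝ) < n := pos_of_mul_pos_left hpos (by positivity)
        exact_mod_cast this
      have b : n ≤ 1 := by
        have : (n : ℝ) ≤ 1 := by
          by_contra! h
          nlinarith
        exact_mod_cast this
      rw [show n = 1 by omega]; simp
  have hper : ∃ n : ℤ, κ (2 * Real.pi) = n * (2 * Real.pi) := by
    have := hκe (2 * Real.pi)
    have h2 : Complex.exp ((2 * Real.pi : ℝ) * Complex.I) = 1 := by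
      push_cast; exact Complex.exp_two_pi_mul_I
    rw [h2, h1] at this
    obtain ⟨n, hn⟩ := Complex.exp_eq_one_iff.1 this.symm
    exact ⟨n, by simpa using congrArg Complex.im hn⟩
  have hκπ : κ Real.pi ≠ 0 := by
    intro h
    have := hsep Real.pi ⟨hpi.le, by linarith⟩ 0 ⟨le_rfl, by positivity⟩ ⟨0, by simp [h, hκ0]⟩
    exact hpi.ne' this
  rcases hκπ.lt_or_gt with h | h
  · obtain ⟨a, b⟩ := main (fun x => -κ x) (by fun_prop) (by simp [hκ0]) (by linarith)
      (fun x hx y hy ⟨n, hn⟩ => hsep x hx y hy ⟨-n, by push_cast; linarith⟩)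
      (by
        obtain ⟨n, hn⟩ := hper
        exact ⟨-n, by push_cast; linarith⟩)
    refine ⟨fun x => -κ x, by fun_prop, a, by simp [hκ0], b, Or.inr fun x => ?_⟩
    rw [hκe, ← Complex.exp_conj]
    simp
  · obtain ⟨a, b⟩ := main κ κ.continuous hκ0 h hsep hper
    exact ⟨κ, κ.continuous, a, hκ0, b, Or.inl hκe⟩

theorem norm_real_mul_exp_mul_I {r : ℝ} (hr : 0 < r) (z : ℂ) :
    ‖(r : ℂ) * Complex.exp (z * Complex.I)‖ = r * Real.exp (-z.im) := by
  rw [norm_mul, Complex.norm_exp, Complex.norm_of_nonneg hr.le]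
  simp

/-- A homeomorphism of the circle of radius `r < 1` extends to a homeomorphism isotopic to the
identity. -/
theorem exists_isotopy_circle {r : ℝ} (hr : 0 < r) (hr1 : r < 1) {χ : ℂ → ℂ}
    (hc : ContinuousOn χ (sphere 0 1)) (hinj : InjOn χ (sphere 0 1))
    (hmaps : ∀ j ∈ sphere (0 : ℂ) 1, χ j ∈ sphere (0 : ℂ) 1) :
    ∃ k ∈ isotopyGroup RP2, (∀ j ∈ sphere (0 : ℂ) 1, k (planeMap (r * j)) = planeMap (r * χ j)) ∧
      k (planeMap 0) = planeMap 0 ∧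
      (χ 1 = 1 → χ (-1) = -1 → ∀ t : ℝ, k (planeMap t) = planeMap t) := by
  have hpi := Real.pi_pos
  have hone : (1 : ℂ) ∈ sphere (0 : ℂ) 1 := by simp
  have hn1 : ‖χ 1‖ = 1 := by simpa using hmaps 1 hone
  have hne : χ 1 ≠ 0 := norm_ne_zero_iff.1 (by rw [hn1]; exact one_ne_zero)
  obtain ⟨κ, hκc, hκm, hκ0, hκ1, hκ⟩ := exists_strictMono_lift_circle (ψ := fun j => (χ 1)⁻¹ * χ j)
    (continuousOn_const.mul hc)
    (fun x hx y hy hxy => hinj hx hy (mul_left_cancel₀ (inv_ne_zero hne) hxy))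
    (fun j hj => by
      have := hmaps j hj
      simp only [mem_sphere_zero_iff_norm] at this ⊢
      rw [norm_mul, norm_inv, hn1, this]; simp) (inv_mul_cancel₀ hne)
  set δ : ℝ := -Real.log r / 2 with hδ
  have hlog : Real.log r < 0 := Real.log_neg hr hr1
  have hδ0 : 0 < δ := by rw [hδ]; linarith
  have hlt : ∀ z : ℂ, -δ ≤ z.im → ‖(r : ℂ) * Complex.exp (z * Complex.I)‖ < 1 := by
    intro z hz
    rw [norm_real_mul_exp_mul_I hr]
    calc r * Real.exp (-z.im) = Real.exp (Real.log r + -z.im) := by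
          rw [Real.exp_add, Real.exp_log hr]
      _ < 1 := by rw [Real.exp_lt_one_iff]; linarith
  let B : ℂ → RP2 := fun z => planeMap (r * Complex.exp (z * Complex.I))
  have hBc : Continuous B := continuous_planeMap.comp (by fun_prop)
  have hBo : IsOpenMap B := by
    refine isOpenMap_planeMap.comp (IsOpenMap.comp (g := fun z : ℂ => (r : ℂ) * z) ?_
      (Complex.isOpenMap_exp.comp ?_))
    · exact (Homeomorph.mulLeft₀ (r : ℂ) (by exact_mod_cast hr.ne')).isOpenMap
    · exact (Homeomorph.mulRight₀ Complex.I Complex.I_ne_zero).isOpenMap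
  have hBinj : ∀ x ∈ Ioo 0 (2 * Real.pi) ×ℂ Ioo (-δ) δ,
      ∀ y ∈ Icc 0 (2 * Real.pi) ×ℂ Icc (-δ) δ, B x = B y → x = y := by
    intro x hx y hy hxy
    have h := planeMap_injOn (by simpa using hlt x hx.2.1.le) (by simpa using hlt y hy.2.1) hxy
    have h := mul_left_cancel₀ (by exact_mod_cast hr.ne') h
    rw [Complex.exp_eq_exp_iff_exists_int] at h
    obtain ⟨m, hm⟩ := h
    have h4 : x.re = y.re + m * (2 * Real.pi) := by
      have := congrArg Complex.im hm
      simpa using this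
    have h4' : x.im = y.im := by
      have := congrArg Complex.re hm
      simpa using this
    have h5 : (m : ℝ) < 1 := by
      by_contra! h
      nlinarith [hx.1.2, hy.1.1]
    have h6 : -1 < (m : ℝ) := by
      by_contra! h
      nlinarith [hx.1.1, hy.1.2]
    have h7 : m = 0 := by
      have a : m < 1 := by exact_mod_cast h5
      have b : -1 < m := by exact_mod_cast h6
      omega
    exact Complex.ext (by simpa [h7] using h4) h4'
  have hsub : Ioo 0 (2 * Real.pi) ×ℂ Ioo (-δ) δ ⊆ Icc 0 (2 * Real.pi) ×ℂ Icc (-δ) δ :=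
    fun z hz => ⟨Ioo_subset_Icc_self hz.1, Ioo_subset_Icc_self hz.2⟩
  obtain ⟨g, hg, hg1, hg2, hg3⟩ := exists_isotopy_twist (B := B) (x₀ := 0) (x₁ := 2 * Real.pi)
    (by positivity) hδ0 hBc.continuousOn (fun x hx y hy h => hBinj x hx y (hsub hy) h)
    (hBo _ (isOpen_Ioo.reProdIm isOpen_Ioo))
    (fun x hx y hy hyU h => hyU (hBinj x hx y hy h ▸ hx)) hκc.continuousOn hκm hκ0 hκ1
  have hg0 : g (planeMap 0) = planeMap 0 := by
    refine hg3 _ ?_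
    rintro ⟨z, hz, h⟩
    rcases planeMap_eq_iff.1 h with h | h
    · have := Complex.exp_ne_zero (z * Complex.I)
      simp [hr.ne'] at h
    · simp at h
  have harg : ∀ j ∈ sphere (0 : ℂ) 1, ∃ x ∈ Icc 0 (2 * Real.pi),
      Complex.exp ((x : ℝ) * Complex.I) = j := by
    intro j hj
    have hj1 : ‖j‖ = 1 := by simpa using hj
    have hexp : Complex.exp (j.arg * Complex.I) = j := by
      conv_rhs => rw [← Complex.norm_mul_exp_arg_mul_I j, hj1]
      simp
    rcases le_or_gt 0 j.arg with h | h
    · exact ⟨j.arg, ⟨h, by linarith [Complex.arg_le_pi j]⟩, hexp⟩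
    · refine ⟨j.arg + 2 * Real.pi, ⟨by linarith [Complex.neg_pi_lt_arg j], by linarith⟩, ?_⟩
      rw [← hexp, Complex.exp_eq_exp_iff_exists_int]
      refine ⟨1, ?_⟩
      rw [hexp]
      push_cast; ring
  have hgs : ∀ x ∈ Icc 0 (2 * Real.pi), g (planeMap (r * Complex.exp ((x : ℝ) * Complex.I))) =
      planeMap (r * Complex.exp ((κ x : ℝ) * Complex.I)) := hg1
  have hgt : χ 1 = 1 → χ (-1) = -1 → ∀ t : ℝ, g (planeMap t) = planeMap t := by
    intro hχ1 hχ2 t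
    by_cases ht : planeMap t ∈ B '' (Ioo 0 (2 * Real.pi) ×ℂ Ioo (-δ) δ)
    swap
    · exact hg3 _ ht
    obtain ⟨z, hz, h⟩ := ht
    rw [← h]
    have hsinx : ∀ x ∈ Ioo 0 (2 * Real.pi), Real.sin x = 0 → x = Real.pi := by
      intro x hx h
      have : x - Real.pi = 0 := (Real.sin_eq_zero_iff_of_lt_of_lt (by linarith [hx.1])
        (by linarith [hx.2])).1 (by rw [Real.sin_sub_pi, h, neg_zero])
      linarith
    have hzre : z.re = Real.pi := by
      apply hsinx _ hz.1
      have him : (r * Complex.exp (z * Complex.I)).im = 0 := by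
        rcases planeMap_eq_iff.1 h with h | h
        · rw [h]; simp
        · have := congrArg Complex.im h
          have h' := congrArg Complex.re h
          simp only [Complex.conj_ofReal, Complex.re_mul_ofReal, Complex.im_mul_ofReal] at this h'
          rcases mul_eq_zero.1 (this.trans (by simp)) with h | h
          · exact h
          · simp [h] at h'
      rw [Complex.im_ofReal_mul, Complex.exp_im] at him
      have := (mul_eq_zero.1 him).resolve_left hr.ne'
      have := (mul_eq_zero.1 this).resolve_left (Real.exp_pos _).ne'
      simpa using this
    refine hg2 z (hsub hz) ?_
    rw [hzre]
    have hmem : Real.pi ∈ Icc 0 (2 * Real.pi) := ⟨hpi.le, by linarith⟩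
    have hκmem : κ Real.pi ∈ Ioo 0 (2 * Real.pi) := by
      constructor
      · conv_lhs => rw [← hκ0]
        exact hκm ⟨le_rfl, by positivity⟩ hmem hpi
      · conv_rhs => rw [← hκ1]
        exact hκm hmem ⟨by positivity, le_rfl⟩ (by linarith)
    apply hsinx _ hκmem
    rcases hκ with h | h
    · have := congrArg Complex.im (h Real.pi)
      simp only [Complex.exp_pi_mul_I, hχ1, hχ2, Complex.exp_ofReal_mul_I_im] at this
      simpa using this.symm
    · have := congrArg Complex.im (h Real.pi)
      simp only [Complex.exp_pi_mul_I, hχ1, hχ2, Complex.conj_im, Complex.exp_ofReal_mul_I_im]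
        at this
      simpa using this.symm
  obtain ⟨R, hR, hR'⟩ := exists_isotopy_rotation hn1
  rcases hκ with h | h
  · refine ⟨R * g, mul_mem hR hg, fun j hj => ?_, ?_, fun h1 h2 t => ?_⟩
    · obtain ⟨x, hx, rfl⟩ := harg j hj
      rw [Homeomorph.mul_apply, hgs x hx, hR', ← h]
      congr 1
      field_simp
    · rw [Homeomorph.mul_apply, hg0, hR', mul_zero]
    · rw [Homeomorph.mul_apply, hgt h1 h2, hR', h1, one_mul]
  · obtain ⟨C, hC, hC'⟩ := exists_isotopy_conj
    refine ⟨R * (C * g), mul_mem hR (mul_mem hC hg), fun j hj => ?_, ?_, fun h1 h2 t => ?_⟩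
    · obtain ⟨x, hx, rfl⟩ := harg j hj
      rw [Homeomorph.mul_apply, Homeomorph.mul_apply, hgs x hx, hC', hR', map_mul, ← h,
        Complex.conj_ofReal]
      congr 1
      field_simp
    · rw [Homeomorph.mul_apply, Homeomorph.mul_apply, hg0, hC', map_zero, hR', mul_zero]
    · rw [Homeomorph.mul_apply, Homeomorph.mul_apply, hgt h1 h2, hC', Complex.conj_ofReal, hR', h1,
        one_mul]

end CircleMaps

section DiskAlexander

open Set Filter Topology Metric

/-- The inverse of the affine chart, defined on the image of the unit disc. -/
noncomputable def planeInv : RP2 → ℂ := Function.invFunOn planeMap (ball 0 1)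

theorem planeInv_planeMap {z : ℂ} (hz : z ∈ ball (0 : ℂ) 1) : planeInv (planeMap z) = z :=
  planeMap_injOn.leftInvOn_invFunOn hz

theorem continuousOn_planeInv : ContinuousOn planeInv (planeMap '' ball 0 1) := by
  rw [continuousOn_open_iff (isOpenMap_planeMap _ isOpen_ball)]
  intro V hV
  convert isOpenMap_planeMap _ (isOpen_ball.inter hV) using 1
  ext x
  constructor
  · rintro ⟨⟨z, hz, rfl⟩, h⟩
    rw [mem_preimage, planeInv_planeMap hz] at h
    exact ⟨z, ⟨hz, h⟩, rfl⟩
  · rintro ⟨z, ⟨hz, h⟩, rfl⟩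
    exact ⟨⟨z, hz, rfl⟩, by rwa [mem_preimage, planeInv_planeMap hz]⟩

theorem mapsTo_disc_of_fix {f : RP2 ≃ₜ RP2} {r : ℝ} (hr : 0 < r) (hr1 : r < 1)
    (hf : ∀ j ∈ sphere (0 : ℂ) 1, f (planeMap (r * j)) = planeMap (r * j))
    (hf0 : f (planeMap 0) = planeMap 0) {z : ℂ} (hz : ‖z‖ ≤ r) :
    ∃ w, ‖w‖ ≤ r ∧ f (planeMap z) = planeMap w := by
  have hsph : ∀ w : ℂ, ‖w‖ = r → f (planeMap w) = planeMap w := by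
    intro w hw
    have hr' : (r : ℂ) ≠ 0 := by exact_mod_cast hr.ne'
    have := hf (w / r) (by simp [hw, abs_of_pos hr, hr.ne'])
    rwa [mul_div_cancel₀ _ hr'] at this
  rcases hz.lt_or_eq with hz | hz
  swap
  · exact ⟨z, hz.le, hsph z hz⟩
  have hsub : closedBall (0 : ℂ) r ⊆ ball 0 1 := closedBall_subset_ball hr1
  have h1 : IsPreconnected ((fun z => f (planeMap z)) '' ball 0 r) :=
    (convex_ball (0 : ℂ) r).isPreconnected.image _
      (f.continuous.comp continuous_planeMap).continuousOn
  have h2 : (fun z => f (planeMap z)) '' ball 0 r ⊆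
      planeMap '' ball 0 r ∪ (planeMap '' closedBall 0 r)ᶜ := by
    rintro - ⟨z, hz, rfl⟩
    by_contra h
    simp only [mem_union, mem_compl_iff, not_or, not_not] at h
    obtain ⟨h, w, hw, h'⟩ := h
    have hwr : ‖w‖ = r := by
      refine le_antisymm (by simpa using hw) (not_lt.1 fun hlt => h ⟨w, by simpa using hlt, h'⟩)
    rw [← hsph w hwr] at h'
    have := planeMap_injOn (hsub hw) (hsub (ball_subset_closedBall hz)) (f.injective h')
    rw [this] at hwr
    simp [hwr] at hz
  have h3 := h1.subset_left_of_subset_union (isOpenMap_planeMap _ isOpen_ball)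
    ((isCompact_closedBall (0 : ℂ) r).image continuous_planeMap).isClosed.isOpen_compl
    (disjoint_compl_right.mono_left (image_mono ball_subset_closedBall)) h2
    ⟨planeMap 0, ⟨0, by simpa using hr, hf0⟩, ⟨0, by simpa using hr, rfl⟩⟩
  obtain ⟨w, hw, h⟩ := h3 ⟨z, by simpa using hz, rfl⟩
  exact ⟨w, by simpa using (ball_subset_closedBall hw), h.symm⟩

theorem exists_isotopy_of_fix_circle {f : RP2 ≃ₜ RP2} {r : ℝ} (hr : 0 < r) (hr1 : r < 1)
    (hf : ∀ j ∈ sphere (0 : ℂ) 1, f (planeMap (r * j)) = planeMap (r * j))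
    (hf0 : f (planeMap 0) = planeMap 0) :
    ∃ g ∈ isotopyGroup RP2, (∀ z : ℂ, ‖z‖ ≤ r → g (planeMap z) = f (planeMap z)) ∧
      ∀ x ∉ planeMap '' ball 0 r, g x = x := by
  have hsub : closedBall (0 : ℂ) r ⊆ ball 0 1 := closedBall_subset_ball hr1
  have hlt : ∀ {w : ℂ}, ‖w‖ ≤ r → w ∈ ball (0 : ℂ) 1 := fun h => hsub (by simpa using h)
  let F : (RP2 ≃ₜ RP2) → ℂ → ℂ := fun f z => if ‖z‖ ≤ r then planeInv (f (planeMap z)) else z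
  have hF1 : ∀ f : RP2 ≃ₜ RP2, (∀ j ∈ sphere (0 : ℂ) 1, f (planeMap (r * j)) = planeMap (r * j)) →
      f (planeMap 0) = planeMap 0 → ∀ z, ‖z‖ ≤ r → ‖F f z‖ ≤ r ∧ planeMap (F f z) = f (planeMap z) := by
    intro f hf hf0 z hz
    obtain ⟨w, hw, h⟩ := mapsTo_disc_of_fix hr hr1 hf hf0 hz
    simp only [F, if_pos hz, h]
    rw [planeInv_planeMap (hlt hw)]
    exact ⟨hw, rfl⟩
  have hF2 : ∀ f : RP2 ≃ₜ RP2, ∀ z, ¬ ‖z‖ ≤ r → F f z = z := fun f z hz => if_neg hz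
  have hs : ∀ j ∈ sphere (0 : ℂ) 1, f.symm (planeMap (r * j)) = planeMap (r * j) := fun j hj => by
    rw [Homeomorph.symm_apply_eq, hf j hj]
  have hs0 : f.symm (planeMap 0) = planeMap 0 := by rw [Homeomorph.symm_apply_eq, hf0]
  have hinv : ∀ f : RP2 ≃ₜ RP2, (∀ j ∈ sphere (0 : ℂ) 1, f (planeMap (r * j)) = planeMap (r * j)) →
      f (planeMap 0) = planeMap 0 →
      (∀ j ∈ sphere (0 : ℂ) 1, f.symm (planeMap (r * j)) = planeMap (r * j)) →
      f.symm (planeMap 0) = planeMap 0 → Function.LeftInverse (F f.symm) (F f) := by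
    intro f hf hf0 hs hs0 z
    by_cases hz : ‖z‖ ≤ r
    · obtain ⟨h1, h2⟩ := hF1 f hf hf0 z hz
      obtain ⟨h3, h4⟩ := hF1 f.symm hs hs0 _ h1
      rw [h2, Homeomorph.symm_apply_apply] at h4
      exact planeMap_injOn (hlt h3) (hlt hz) h4
    · rw [hF2 f z hz, hF2 _ z hz]
  have hsphF : ∀ z, ‖z‖ = r → F f z = z := by
    intro z hz
    obtain ⟨h1, h2⟩ := hF1 f hf hf0 z hz.le
    refine planeMap_injOn (hlt h1) (hlt hz.le) ?_
    have hr' : (r : ℂ) ≠ 0 := by exact_mod_cast hr.ne'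
    have := hf (z / r) (by simp [hz, abs_of_pos hr, hr.ne'])
    rw [mul_div_cancel₀ _ hr'] at this
    rw [h2, this]
  have hFc : Continuous (F f) := by
    refine continuous_if_le continuous_norm continuous_const ?_ continuousOn_id ?_
    · refine continuousOn_planeInv.comp (f.continuous.comp continuous_planeMap).continuousOn ?_
      intro z hz
      obtain ⟨w, hw, h⟩ := mapsTo_disc_of_fix hr hr1 hf hf0 hz
      exact ⟨w, hlt hw, h.symm⟩
    · intro z hz
      have := hsphF z hz
      simpa only [F, if_pos hz.le] using this
  have hFU : ∀ z ∉ ball (0 : ℂ) r, F f z = z := by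
    intro z hz
    have hz : r ≤ ‖z‖ := by simpa using hz
    rcases hz.lt_or_eq with h | h
    · exact hF2 f z (not_le.2 h)
    · exact hsphF z h.symm
  have hri := hinv f.symm hs hs0 (by simpa using hf) (by simpa using hf0)
  rw [Homeomorph.symm_symm] at hri
  obtain ⟨g, hg, h1, h2⟩ := exists_isotopy_alexander (B := planeMap) (F := F f)
    (isCompact_closedBall (0 : ℂ) r) ball_subset_closedBall continuous_planeMap.continuousOn
    (planeMap_injOn.mono (ball_subset_closedBall.trans hsub)) (isOpenMap_planeMap _ isOpen_ball)
    (fun x hx y hy hyU h => hyU (planeMap_injOn (hsub (ball_subset_closedBall hx)) (hsub hy) h ▸ hx))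
    (convex_ball (0 : ℂ) r |>.starConvex (mem_ball_self hr)) hFc
    ⟨(hinv f hf hf0 hs hs0).injective, hri.surjective⟩ hFU
  exact ⟨g, hg, fun z hz => by rw [h1 z (by simpa using hz), (hF1 f hf hf0 z hz).2], h2⟩

end DiskAlexander

section NormalizeDisc

open Set Filter Topology Metric

theorem planeMap_eq_zero_iff {z : ℂ} : planeMap z = planeMap 0 ↔ z = 0 := by
  rw [planeMap_eq_iff]; simp

theorem isOpen_image_planeMap (V : Set ℂ) (hV : IsOpen V) : IsOpen (planeMap '' V) :=
  isOpenMap_planeMap V hV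

theorem planeMap_planeInv {x : RP2} (hx : x ∈ planeMap '' ball 0 1) :
    planeMap (planeInv x) = x := by
  obtain ⟨z, hz, rfl⟩ := hx
  rw [planeInv_planeMap hz]

/-- Radial slide between the concentric circles of radii `r₁` and `r₀`. -/
theorem exists_isotopy_slide_circle {r₀ r₁ : ℝ} (h0 : 0 < r₀) (h01 : r₀ ≤ r₁) (h1 : r₁ < 1) :
    ∃ g ∈ isotopyGroup RP2, (∀ j ∈ sphere (0 : ℂ) 1, g (planeMap (r₁ * j)) = planeMap (r₀ * j)) ∧
      g (planeMap 0) = planeMap 0 := by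
  have hinj : InjOn planeMap (ball 0 1 \ {0}) := planeMap_injOn.mono sdiff_subset
  obtain ⟨g, hg, hg1, hg2⟩ := exists_isotopy_slide (B := planeMap) (W := ball 0 1 \ {0})
    (J := sphere 0 1) (isOpen_ball.sdiff isClosed_singleton) continuous_planeMap.continuousOn
    (fun V _ hV => isOpen_image_planeMap V hV)
    (fun z hz => ⟨_, (isOpen_ball.sdiff isClosed_singleton).mem_nhds hz, hinj⟩)
    (isCompact_sphere 0 1) h0 h01
    (by
      intro r hr j hj
      have hj : ‖j‖ = 1 := by simpa using hj
      have hr0 : 0 < r := h0.trans_le hr.1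
      have hr' : (r : ℂ) ≠ 0 := by exact_mod_cast hr0.ne'
      have hj' : j ≠ 0 := norm_ne_zero_iff.1 (by rw [hj]; exact one_ne_zero)
      refine ⟨?_, by simp [hr', hj']⟩
      rw [mem_ball_zero_iff, norm_mul, Complex.norm_of_nonneg hr0.le, hj, mul_one]
      exact hr.2.trans_lt h1)
    (by
      intro r hr i hi j hj hij
      have hr0 : 0 < r := h0.trans_le hr.1
      have hr' : (r : ℂ) ≠ 0 := by exact_mod_cast hr0.ne'
      have hmem : ∀ j ∈ sphere (0 : ℂ) 1, (r : ℂ) * j ∈ ball (0 : ℂ) 1 := by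
        intro j hj
        have hj : ‖j‖ = 1 := by simpa using hj
        rw [mem_ball_zero_iff, norm_mul, Complex.norm_of_nonneg hr0.le, hj, mul_one]
        exact hr.2.trans_lt h1
      exact mul_left_cancel₀ hr' (planeMap_injOn (hmem i hi) (hmem j hj) hij))
  refine ⟨g, hg, hg1, (hg2 {planeMap 0} ?_ _).2 rfl⟩
  intro w hw s _ _ h
  exact absurd (planeMap_eq_zero_iff.1 h) hw.2

theorem exists_isDiscChart_planeInv {f : RP2 ≃ₜ RP2} (hf : f (planeMap 0) = planeMap 0) {r : ℝ}
    (hr : 0 < r) (hr1 : r < 1) :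
    ∃ ε : ℝ, 0 < ε ∧ 2 * ε < 1 ∧ ε ≤ r ∧
      (∀ z : ℂ, ‖z‖ ≤ 1 → f (planeMap (ε * z)) ∈ planeMap '' ball 0 1) ∧
      IsDiscChart fun z => planeInv (f (planeMap (ε * z))) := by
  have hc : Continuous fun z => f (planeMap z) := f.continuous.comp continuous_planeMap
  have ho : IsOpen ((fun z => f (planeMap z)) ⁻¹' (planeMap '' ball 0 1)) :=
    (isOpen_image_planeMap _ isOpen_ball).preimage hc
  obtain ⟨η, hη, hηs⟩ := Metric.isOpen_iff.1 ho 0 ⟨0, mem_ball_self one_pos, hf.symm⟩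
  set ε := min (η / 2) (r / 2) with hε
  have hε0 : 0 < ε := by positivity
  have hεη : ε < η := (min_le_left _ _).trans_lt (by linarith)
  have hεr : ε ≤ r / 2 := min_le_right _ _
  have hε' : (ε : ℂ) ≠ 0 := by exact_mod_cast hε0.ne'
  have hmem : ∀ z : ℂ, ‖z‖ ≤ 1 → f (planeMap (ε * z)) ∈ planeMap '' ball 0 1 := by
    intro z hz
    refine hηs ?_
    rw [mem_ball_zero_iff, norm_mul, Complex.norm_of_nonneg hε0.le]
    nlinarith
  have hball : ∀ z : ℂ, ‖z‖ ≤ 1 → (ε : ℂ) * z ∈ ball (0 : ℂ) 1 := by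
    intro z hz
    rw [mem_ball_zero_iff, norm_mul, Complex.norm_of_nonneg hε0.le]
    nlinarith
  refine ⟨ε, hε0, by linarith, by linarith, hmem, ?_, ?_, ?_, ?_⟩
  · refine continuousOn_planeInv.comp (hc.comp (by fun_prop)).continuousOn ?_
    intro z hz
    exact hmem z (by simpa using hz)
  · intro z hz w hw hzw
    have hz : ‖z‖ ≤ 1 := by simpa using hz
    have hw : ‖w‖ ≤ 1 := by simpa using hw
    have := congrArg planeMap hzw
    simp only at this
    rw [planeMap_planeInv (hmem z hz), planeMap_planeInv (hmem w hw)] at this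
    exact mul_left_cancel₀ hε' (planeMap_injOn (hball z hz) (hball w hw) (f.injective this))
  · intro V hV hVo
    have h1 : IsOpen ((fun z => f (planeMap (ε * z))) '' V) := by
      have : IsOpenMap fun z => f (planeMap (ε * z)) :=
        f.isOpenMap.comp (isOpenMap_planeMap.comp (Homeomorph.mulLeft₀ (ε : ℂ) hε').isOpenMap)
      exact this V hVo
    convert (h1.preimage continuous_planeMap).inter (isOpen_ball (x := (0 : ℂ)) (ε := 1)) using 1
    ext w
    constructor
    · rintro ⟨z, hz, rfl⟩
      have := hmem z (by simpa using (ball_subset_closedBall (hV hz)))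
      obtain ⟨u, hu, hu'⟩ := this
      simp only
      rw [← hu', planeInv_planeMap hu]
      exact ⟨⟨z, hz, hu'.symm⟩, hu⟩
    · rintro ⟨⟨z, hz, h⟩, hw⟩
      refine ⟨z, hz, ?_⟩
      simp only at h ⊢
      rw [h, planeInv_planeMap hw]
  · simp only [mul_zero, hf]
    exact planeInv_planeMap (mem_ball_self one_pos)

/-- A homeomorphism fixing the origin can be corrected by isotopies on both sides so that it fixes a
given circle. -/
theorem exists_isotopy_fix_circle {f : RP2 ≃ₜ RP2} (hf : f (planeMap 0) = planeMap 0) {r : ℝ}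
    (hr : 0 < r) (hr1 : r < 1) :
    ∃ g ∈ isotopyGroup RP2, ∃ k ∈ isotopyGroup RP2,
      (∀ j ∈ sphere (0 : ℂ) 1, (g * f * k) (planeMap (r * j)) = planeMap (r * j)) ∧
      (g * f * k) (planeMap 0) = planeMap 0 := by
  obtain ⟨ε, hε0, hε1, hεr, hmem, hG⟩ := exists_isDiscChart_planeInv hf hr hr1
  have hε' : (ε : ℂ) ≠ 0 := by exact_mod_cast hε0.ne'
  obtain ⟨φ, a, χ, hU⟩ := exists_isUniformization hG
  obtain ⟨k₁, hk₁, hk₁s, hk₁0⟩ := exists_isotopy_slide_circle hε0 hεr hr1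
  have hsph : ∀ j ∈ sphere (0 : ℂ) 1, ‖j‖ = 1 := fun j hj => by simpa using hj
  obtain ⟨k₂, hk₂, hk₂s, hk₂0, -⟩ := exists_isotopy_circle hε0 (by linarith) (χ := χ)
    χ.continuous.continuousOn χ.injective.injOn
    (fun j hj => by
      have := hsph j hj
      rw [mem_sphere_zero_iff_norm, hU.norm_eq j this.ge, this])
  have hχlt : ∀ z : ℂ, ‖z‖ < 2 → ‖(ε : ℂ) * χ z‖ < 1 := by
    intro z hz
    have : ‖χ z‖ < 2 := by
      rcases lt_or_ge ‖z‖ 1 with h | h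
      · linarith [hU.norm_lt z h]
      · rwa [hU.norm_eq z h]
    rw [norm_mul, Complex.norm_of_nonneg hε0.le]
    nlinarith
  have hχ0 : ∀ z : ℂ, z ≠ 0 → (ε : ℂ) * χ z ≠ 0 := by
    intro z hz
    refine mul_ne_zero hε' fun h => hz (χ.injective (h.trans hU.zero.symm))
  -- linearization near the origin
  obtain ⟨r₂, hr₂, hlin⟩ := exists_isotopy_linearize (B := planeMap) (W := ball 0 1 \ {0})
    (J := sphere (0 : ℂ) 1) (O := {w : ℂ | 1 / 2 < ‖w‖ ∧ ‖w‖ < 2}) (φ := φ) (a := a) (ρ := 1)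
    (r₁ := 1 / 2) continuous_planeMap.continuousOn (fun V _ hV => isOpen_image_planeMap V hV)
    (isCompact_sphere 0 1)
    ((isOpen_lt continuous_const continuous_norm).inter (isOpen_lt continuous_norm continuous_const))
    (fun j hj => by
      have := hsph j hj
      simp only [mem_ofPred_eq, this]; norm_num)
    hU.riemann.pos one_pos hU.riemann.diff hU.riemann.zero hU.riemann.deriv_zero (by norm_num)
    (by
      intro r hr z hz w hw hzw
      have hr' : (r : ℂ) ≠ 0 := by exact_mod_cast hr.1.ne'
      have : ∀ z : ℂ, ‖z‖ < 2 → (r : ℂ) * z ∈ ball (0 : ℂ) 1 := by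
        intro z hz
        rw [mem_ball_zero_iff, norm_mul, Complex.norm_of_nonneg hr.1.le]
        nlinarith [hr.1, hr.2]
      exact mul_left_cancel₀ hr' (planeMap_injOn (this z hz.2) (this w hw.2) hzw))
    (by
      intro r hr z hz
      have hr' : (r : ℂ) ≠ 0 := by exact_mod_cast hr.1.ne'
      have hz0 : z ≠ 0 := norm_pos_iff.1 (lt_trans (by norm_num) hz.1)
      refine ⟨?_, by simp [hr', hz0]⟩
      rw [mem_ball_zero_iff, norm_mul, Complex.norm_of_nonneg hr.1.le]
      nlinarith [hr.1, hr.2, hz.2])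
  have ha := hU.riemann.pos
  set r₀ := min r₂ (min (1 / 2) (r / a)) with hr₀
  have hr₀0 : 0 < r₀ := by positivity
  have hr₀2 : r₀ ≤ r₂ := min_le_left _ _
  have hr₀1 : r₀ ≤ 1 / 2 := (min_le_right _ _).trans (min_le_left _ _)
  have hr₀a : r₀ * a ≤ r := by
    have : r₀ ≤ r / a := (min_le_right _ _).trans (min_le_right _ _)
    rwa [le_div_iff₀ ha] at this
  obtain ⟨g₂, hg₂, hg₂s, hg₂T⟩ := hlin r₀ ⟨hr₀0, hr₀2⟩
  have hg₂0 : g₂ (planeMap 0) = planeMap 0 := by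
    refine hg₂T {planeMap 0} ⊥ ?_ ?_ _ rfl
    · intro w _
      rw [mem_singleton_iff, planeMap_eq_zero_iff, Submodule.mem_bot]
    · intro w hw _
      rw [Submodule.mem_bot] at hw ⊢
      rw [hw, hU.riemann.zero]
  obtain ⟨g₃, hg₃, hg₃s, hg₃0⟩ := exists_isotopy_slide_circle (mul_pos hr₀0 ha) hr₀a hr1
  -- the slide along the images of radii
  have hWo : IsOpen (ball (0 : ℂ) 2 \ {0}) := isOpen_ball.sdiff isClosed_singleton
  have hBinj : InjOn (fun z => f (planeMap (ε * χ z))) (ball 0 2 \ {0}) := by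
    intro z hz w hw hzw
    have := planeMap_injOn (by simpa using hχlt z (by simpa using hz.1))
      (by simpa using hχlt w (by simpa using hw.1)) (f.injective hzw)
    exact χ.injective (mul_left_cancel₀ hε' this)
  have hsub : ∀ s ∈ Icc r₀ 1, ∀ j ∈ sphere (0 : ℂ) 1, (s : ℂ) * j ∈ ball (0 : ℂ) 2 \ {0} := by
    intro s hs j hj
    have hj := hsph j hj
    have hs0 : 0 < s := hr₀0.trans_le hs.1
    have hs' : (s : ℂ) ≠ 0 := by exact_mod_cast hs0.ne'
    have hj' : j ≠ 0 := norm_ne_zero_iff.1 (by rw [hj]; exact one_ne_zero)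
    refine ⟨?_, by simp [hs', hj']⟩
    rw [mem_ball_zero_iff, norm_mul, Complex.norm_of_nonneg hs0.le, hj]
    linarith [hs.2]
  obtain ⟨g₁, hg₁, hg₁s, hg₁T⟩ := exists_isotopy_slide (B := fun z => f (planeMap (ε * χ z)))
    (W := ball 0 2 \ {0}) (J := sphere 0 1) hWo
    ((f.continuous.comp (continuous_planeMap.comp
      (continuous_const.mul χ.continuous))).continuousOn)
    (fun V _ hV => (f.isOpenMap.comp (isOpenMap_planeMap.comp
      ((Homeomorph.mulLeft₀ (ε : ℂ) hε').isOpenMap.comp χ.isOpenMap))) V hV)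
    (fun z hz => ⟨_, hWo.mem_nhds hz, hBinj⟩) (isCompact_sphere 0 1) hr₀0
    (by linarith) hsub
    (by
      intro s hs i hi j hj hij
      have hs0 : 0 < s := hr₀0.trans_le hs.1
      have hs' : (s : ℂ) ≠ 0 := by exact_mod_cast hs0.ne'
      exact mul_left_cancel₀ hs' (hBinj (hsub s hs i hi) (hsub s hs j hj) hij))
  have hg₁0 : g₁ (planeMap 0) = planeMap 0 := by
    refine (hg₁T {planeMap 0} ?_ _).2 rfl
    intro w hw s _ _ h
    have h : f (planeMap (ε * χ w)) = planeMap 0 := h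
    rw [← hf] at h
    exact absurd (planeMap_eq_zero_iff.1 (f.injective h)) (hχ0 w hw.2)
  refine ⟨g₃⁻¹ * (g₂⁻¹ * g₁), mul_mem (inv_mem hg₃) (mul_mem (inv_mem hg₂) hg₁), k₂ * k₁,
    mul_mem hk₂ hk₁, fun j hj => ?_, ?_⟩
  · have e1 : g₁ (f (planeMap (ε * χ j))) = planeMap (φ (r₀ * j)) := by
      have h1 := hg₁s j hj
      simp only [Complex.ofReal_one, one_mul] at h1
      have hlt : ‖(r₀ : ℂ) * j‖ < 1 := by
        rw [norm_mul, Complex.norm_of_nonneg hr₀0.le, hsph j hj]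
        linarith
      rw [h1, ← hU.eq _ (by simpa using hlt), planeMap_planeInv (hmem _ (hU.norm_lt _ hlt).le)]
    have e2 : g₂⁻¹ (planeMap (φ (r₀ * j))) = planeMap ((r₀ * a : ℝ) * j) :=
      (Homeomorph.symm_apply_eq g₂).2 (hg₂s j hj).symm
    have e3 : g₃⁻¹ (planeMap ((r₀ * a : ℝ) * j)) = planeMap (r * j) :=
      (Homeomorph.symm_apply_eq g₃).2 (hg₃s j hj).symm
    simp only [Homeomorph.mul_apply]
    rw [hk₁s j hj, hk₂s j hj, e1, e2, e3]
  · have e2 : g₂⁻¹ (planeMap 0) = planeMap 0 := (Homeomorph.symm_apply_eq g₂).2 hg₂0.symm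
    have e3 : g₃⁻¹ (planeMap 0) = planeMap 0 := (Homeomorph.symm_apply_eq g₃).2 hg₃0.symm
    simp only [Homeomorph.mul_apply]
    rw [hk₁0, hk₂0, hf, hg₁0, e2, e3]

/-- It suffices to treat homeomorphisms which are the identity on a disc. -/
theorem mem_isotopyGroup_of_forall_eqOn_disc {r : ℝ} (hr : 0 < r) (hr1 : r < 1)
    (H : ∀ f : RP2 ≃ₜ RP2, (∀ z : ℂ, ‖z‖ ≤ r → f (planeMap z) = planeMap z) →
      f ∈ isotopyGroup RP2) (f : RP2 ≃ₜ RP2) : f ∈ isotopyGroup RP2 := by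
  obtain ⟨g₀, hg₀, hg₀f⟩ := exists_isotopy_to_zero (f (planeMap 0))
  obtain ⟨g, hg, k, hk, h1, h2⟩ := exists_isotopy_fix_circle (f := g₀ * f) hg₀f hr hr1
  obtain ⟨u, hu, hu1, -⟩ := exists_isotopy_of_fix_circle hr hr1 h1 h2
  have h3 := H (u⁻¹ * (g * (g₀ * f) * k)) fun z hz =>
    (Homeomorph.symm_apply_eq u).2 (hu1 z hz).symm
  rwa [Subgroup.mul_mem_cancel_left _ (inv_mem hu), Subgroup.mul_mem_cancel_right _ hk,
    Subgroup.mul_mem_cancel_left _ hg, Subgroup.mul_mem_cancel_left _ hg₀] at h3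

end NormalizeDisc

section ExpCover

open Set Filter Topology Metric

/-- The covering of the projective plane minus a point by the plane. -/
noncomputable def expMap (ζ : ℂ) : RP2 := planeMap (Complex.exp ζ)

theorem continuous_expMap : Continuous expMap := continuous_planeMap.comp Complex.continuous_exp

theorem isOpenMap_expMap : IsOpenMap expMap := isOpenMap_planeMap.comp Complex.isOpenMap_exp

theorem expMap_eq_iff {ζ η : ℂ} : expMap ζ = expMap η ↔ ∃ k : ℤ,
    η = ζ + k * (2 * Real.pi * Complex.I) ∨
      η = -(starRingEnd ℂ) ζ + (2 * k + 1) * (Real.pi * Complex.I) := by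
  rw [expMap, expMap, planeMap_eq_iff, exists_or]
  refine or_congr ?_ ?_
  · rw [eq_comm, Complex.exp_eq_exp_iff_exists_int]
  · rw [← Complex.exp_conj, ← Complex.exp_add, ← Complex.exp_pi_mul_I,
      Complex.exp_eq_exp_iff_exists_int]
    constructor
    · rintro ⟨k, hk⟩
      refine ⟨-k - 1, ?_⟩
      have := congrArg (starRingEnd ℂ) hk
      simp only [map_add, map_mul, Complex.conj_conj, Complex.conj_ofReal, Complex.conj_I,
        Complex.conj_ofNat, map_intCast] at this
      push_cast
      linear_combination this
    · rintro ⟨k, hk⟩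
      refine ⟨-k - 1, ?_⟩
      rw [hk]
      simp only [map_add, map_mul, map_neg, map_one, Complex.conj_conj, Complex.conj_ofReal,
        Complex.conj_I, Complex.conj_ofNat, map_intCast]
      push_cast
      ring

theorem eq_of_expMap_eq {ζ η : ℂ} (h : expMap ζ = expMap η) (hd : |η.im - ζ.im| < Real.pi) :
    ζ = η := by
  have hpi := Real.pi_pos
  rw [abs_lt] at hd
  obtain ⟨k, hk | hk⟩ := expMap_eq_iff.1 h
  · have him : η.im = ζ.im + k * (2 * Real.pi) := by rw [hk]; simp
    have h1 : (k : ℝ) < 1 := by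
      by_contra! h
      nlinarith
    have h2 : -1 < (k : ℝ) := by
      by_contra! h
      nlinarith
    have : k = 0 := by
      have a : k < 1 := by exact_mod_cast h1
      have b : -1 < k := by exact_mod_cast h2
      omega
    simpa [this] using hk.symm
  · have him : η.im = ζ.im + (2 * k + 1) * Real.pi := by rw [hk]; simp
    have h1 : (2 * k + 1 : ℝ) < 1 := by
      by_contra! h
      nlinarith
    have h2 : -1 < (2 * k + 1 : ℝ) := by
      by_contra! h
      nlinarith
    have a : 2 * k + 1 < 1 := by exact_mod_cast h1
    have b : -1 < 2 * k + 1 := by exact_mod_cast h2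
    omega

theorem isLocallyInjective_expMap : IsLocallyInjective expMap := by
  intro x
  refine ⟨ball x 1, isOpen_ball, mem_ball_self one_pos, fun ζ hζ η hη h => eq_of_expMap_eq h ?_⟩
  have h1 := Complex.abs_im_le_norm (η - x)
  have h2 := Complex.abs_im_le_norm (ζ - x)
  rw [mem_ball_iff_norm] at hζ hη
  have := abs_sub_le η.im x.im ζ.im
  rw [Complex.sub_im] at h1 h2
  rw [abs_sub_comm x.im] at this
  linarith [Real.pi_gt_three]

theorem abs_re_eq_of_expMap_eq {ζ η : ℂ} (h : expMap ζ = expMap η) : |ζ.re| = |η.re| := by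
  obtain ⟨k, hk | hk⟩ := expMap_eq_iff.1 h
  · rw [hk]; simp
  · rw [hk]; simp

theorem eqOn_of_expMap_comp_eqOn {s : Set ℂ} {g₁ g₂ : ℂ → ℂ} (hs : IsPreconnected s)
    (h₁ : ContinuousOn g₁ s) (h₂ : ContinuousOn g₂ s)
    (h : ∀ z ∈ s, expMap (g₁ z) = expMap (g₂ z)) {a : ℂ} (ha : a ∈ s) (hga : g₁ a = g₂ a) :
    EqOn g₁ g₂ s :=
  (T2Space.isSeparatedMap expMap).eqOn_of_comp_eqOn isLocallyInjective_expMap hs h₁ h₂ h ha hga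

theorem eq_of_expMap_comp_eq {g₁ g₂ : ℂ → ℂ} (h₁ : Continuous g₁) (h₂ : Continuous g₂)
    (h : ∀ z, expMap (g₁ z) = expMap (g₂ z)) {a : ℂ} (hga : g₁ a = g₂ a) : g₁ = g₂ :=
  (T2Space.isSeparatedMap expMap).eq_of_comp_eq isLocallyInjective_expMap h₁ h₂ (funext h) a hga

/-- A generator of the deck transformations of `expMap`. -/
noncomputable def glide (ζ : ℂ) : ℂ := -(starRingEnd ℂ) ζ + Real.pi * Complex.I

theorem continuous_glide : Continuous glide := by unfold glide; fun_prop

theorem expMap_glide (ζ : ℂ) : expMap (glide ζ) = expMap ζ :=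
  (expMap_eq_iff.2 ⟨0, Or.inr (by simp [glide])⟩).symm

theorem glide_re (ζ : ℂ) : (glide ζ).re = -ζ.re := by simp [glide]

theorem glide_im (ζ : ℂ) : (glide ζ).im = ζ.im + Real.pi := by simp [glide]

/-- `F` is the lift of `f`, which is the identity on a disc, normalized by the condition of being the
identity over this disc. -/
structure IsExpLift (f : RP2 ≃ₜ RP2) (F : ℂ → ℂ) : Prop where
  cont : Continuous F
  lift : ∀ ζ, expMap (F ζ) = f (expMap ζ)
  eq_left : ∀ ζ : ℂ, ζ.re ≤ -(Real.pi / 2) → F ζ = ζ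

theorem ne_planeMap_zero_iff {u : UnitSphere3} (hu : toRP2 u ≠ planeMap 0) :
    u.1 2 ≠ -1 ∧ stereoInv u ≠ 0 := by
  have h0 : stereo 0 ≠ u := fun h => hu (by rw [← h]; rfl)
  have h1 : -stereo 0 ≠ u := fun h => hu (by rw [← h, toRP2_neg]; rfl)
  have h2 : u.1 2 ≠ -1 := by
    intro h
    have hs := u.sq_add_sq_add_sq
    rw [h] at hs
    refine h1 (UnitSphere3.ext_coords ?_ ?_ ?_)
    · have : u.1 0 = 0 := by nlinarith [sq_nonneg (u.1 0), sq_nonneg (u.1 1)]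
      change -(stereo 0).1 0 = _
      simp [stereo_apply_zero, this]
    · have : u.1 1 = 0 := by nlinarith [sq_nonneg (u.1 0), sq_nonneg (u.1 1)]
      change -(stereo 0).1 1 = _
      simp [stereo_apply_one, this]
    · change -(stereo 0).1 2 = _
      simp [stereo_apply_two, h]
  exact ⟨h2, fun h => h0 (by rw [← h, stereo_stereoInv h2])⟩

theorem expMap_ne (ζ : ℂ) : expMap ζ ≠ planeMap 0 := fun h =>
  Complex.exp_ne_zero ζ (planeMap_eq_zero_iff.1 h)

theorem isPreconnected_left_half : IsPreconnected {ζ : ℂ | ζ.re ≤ -(Real.pi / 2)} :=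
  (convex_halfSpace_re_le _).isPreconnected

theorem exists_isExpLift {f : RP2 ≃ₜ RP2}
    (hf : ∀ z : ℂ, ‖z‖ ≤ Real.exp (-(Real.pi / 2)) → f (planeMap z) = planeMap z) :
    ∃ F, IsExpLift f F := by
  have hf0 : f (planeMap 0) = planeMap 0 := hf 0 (by simp [Real.exp_nonneg])
  have hfl : ∀ ζ : ℂ, ζ.re ≤ -(Real.pi / 2) → f (expMap ζ) = expMap ζ := fun ζ hζ =>
    hf _ (by rw [Complex.norm_exp]; exact Real.exp_le_exp.2 hζ)
  set a : ℂ := ((-(Real.pi / 2) : ℝ) : ℂ) with ha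
  have hare : a.re ≤ -(Real.pi / 2) := by simp [ha]
  obtain ⟨S, ⟨hSa, hS⟩, -⟩ := isCoveringMap_toRP2.existsUnique_continuousMap_lifts
    (⟨fun ζ => f (expMap ζ), f.continuous.comp continuous_expMap⟩ : C(ℂ, RP2)) a
    (stereo (Complex.exp a)) (hfl a hare).symm
  have hS : ∀ ζ, toRP2 (S ζ) = f (expMap ζ) := fun ζ => congrFun hS ζ
  have hne : ∀ ζ, toRP2 (S ζ) ≠ planeMap 0 := by
    intro ζ h
    rw [hS, ← hf0] at h
    exact expMap_ne ζ (f.injective h)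
  have hu : Continuous fun ζ => stereoInv (S ζ) :=
    continuousOn_stereoInv.comp_continuous S.continuous fun ζ => (ne_planeMap_zero_iff (hne ζ)).1
  have hSl : EqOn S (fun ζ => stereo (Complex.exp ζ)) {ζ : ℂ | ζ.re ≤ -(Real.pi / 2)} :=
    isCoveringMap_toRP2.eqOn_of_comp_eqOn isPreconnected_left_half S.continuous.continuousOn
      (continuous_stereo.comp Complex.continuous_exp).continuousOn
      (fun ζ hζ => (hS ζ).trans (hfl ζ hζ)) hare hSa
  have hsc : IsSimplyConnected (univ : Set ℂ) := by
    have : ContractibleSpace (univ : Set ℂ) := convex_univ.contractibleSpace ⟨0, trivial⟩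
    exact inferInstanceAs (SimplyConnectedSpace (univ : Set ℂ))
  obtain ⟨L, hLc, hL⟩ := Complex.exists_continuousOn_eqOn_exp_comp hsc isOpen_univ
    hu.continuousOn (by
      rintro ⟨ζ, -, h⟩
      exact (ne_planeMap_zero_iff (hne ζ)).2 h)
  have hLc : Continuous L := continuousOn_univ.1 hLc
  have hL : ∀ ζ, Complex.exp (L ζ) = stereoInv (S ζ) := fun ζ => hL trivial
  have hLa : Complex.exp (L a) = Complex.exp a := by rw [hL, hSa, stereoInv_stereo]
  obtain ⟨n, hn⟩ := Complex.exp_eq_exp_iff_exists_int.1 hLa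
  have hF : ∀ ζ, Complex.exp (L ζ - n * (2 * Real.pi * Complex.I)) = stereoInv (S ζ) := fun ζ => by
    rw [← hL, Complex.exp_eq_exp_iff_exists_int]
    exact ⟨-n, by push_cast; ring⟩
  have hlift : ∀ ζ, expMap (L ζ - n * (2 * Real.pi * Complex.I)) = f (expMap ζ) := fun ζ => by
    rw [expMap, hF, planeMap, stereo_stereoInv (ne_planeMap_zero_iff (hne ζ)).1, hS]
  have hc : Continuous fun ζ => L ζ - n * (2 * Real.pi * Complex.I) := hLc.sub continuous_const
  refine ⟨_, hc, hlift, fun ζ hζ => ?_⟩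
  refine eqOn_of_expMap_comp_eqOn (g₂ := fun ζ => ζ) isPreconnected_left_half hc.continuousOn
    continuousOn_id (fun ζ hζ => ?_) hare ?_ hζ
  · simp only [hlift]
    exact hfl ζ hζ
  · simp [hn]

theorem IsExpLift.eq_id_of_comp {f g : RP2 ≃ₜ RP2} {F G : ℂ → ℂ} (hF : IsExpLift f F)
    (hG : IsExpLift g G) (h : ∀ x, g (f x) = x) (ζ : ℂ) : G (F ζ) = ζ := by
  have hre : (((-(Real.pi / 2) : ℝ) : ℂ)).re ≤ -(Real.pi / 2) := by simp
  exact congrFun (eq_of_expMap_comp_eq (g₂ := fun ζ => ζ) (hG.cont.comp hF.cont) continuous_id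
    (fun ζ => by simp only [Function.comp_apply]; rw [hG.lift, hF.lift, h])
    (a := ((-(Real.pi / 2) : ℝ) : ℂ)) (by simp only [Function.comp_apply];
                                          rw [hF.eq_left _ hre, hG.eq_left _ hre])) ζ

theorem IsExpLift.glide {f : RP2 ≃ₜ RP2} {F : ℂ → ℂ} (hF : IsExpLift f F) (ζ : ℂ) :
    F (glide ζ) = glide (F ζ) := by
  have hpi := Real.pi_pos
  have hlift : ∀ ζ, expMap (F ζ) = expMap (F (_root_.glide ζ)) := fun ζ => by
    rw [hF.lift, hF.lift, expMap_glide]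
  have hFg : Continuous fun ζ => F (_root_.glide ζ) := hF.cont.comp continuous_glide
  set a : ℂ := ((-(Real.pi / 2) : ℝ) : ℂ) with ha
  have hare : a.re ≤ -(Real.pi / 2) := by simp [ha]
  have hgg : ∀ ζ, _root_.glide (_root_.glide ζ) = ζ + 2 * (Real.pi * Complex.I) := by
    intro ζ
    simp only [_root_.glide, map_add, map_neg, map_mul, Complex.conj_conj, Complex.conj_ofReal,
      Complex.conj_I]
    ring
  have hggre : (_root_.glide (_root_.glide a)).re ≤ -(Real.pi / 2) := by
    rw [glide_re, glide_re, neg_neg]; exact hare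
  have e2 : F (_root_.glide (_root_.glide a)) = a + 2 * (Real.pi * Complex.I) := by
    rw [hF.eq_left _ hggre, hgg]
  have hFa : F a = a := hF.eq_left _ hare
  obtain ⟨k, hk | hk⟩ := expMap_eq_iff.1 (hlift 0)
  · exfalso
    have h := eq_of_expMap_comp_eq hFg
      (g₂ := fun ζ => F ζ + k * (2 * Real.pi * Complex.I)) (hF.cont.add continuous_const)
      (fun ζ => by rw [← hlift]; exact expMap_eq_iff.2 ⟨k, Or.inl rfl⟩) hk
    have h1 := congrFun h (_root_.glide a)
    have h2 := congrFun h a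

    rw [e2, h2, hFa] at h1
    have him := congrArg Complex.im h1
    simp [ha] at him
    have : (1 : ℝ) = 2 * k := by nlinarith
    have : (1 : ℤ) = 2 * k := by exact_mod_cast this
    omega
  · have h := eq_of_expMap_comp_eq hFg
      (g₂ := fun ζ => -(starRingEnd ℂ) (F ζ) + (2 * k + 1) * (Real.pi * Complex.I))
      ((Complex.continuous_conj.comp hF.cont).neg.add continuous_const)
      (fun ζ => by rw [← hlift]; exact expMap_eq_iff.2 ⟨k, Or.inr rfl⟩) hk
    have h1 := congrFun h (_root_.glide a)
    have h2 := congrFun h a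

    rw [e2, h2, hFa] at h1
    have him := congrArg Complex.im h1
    simp [ha] at him
    have : (0 : ℝ) = k := by nlinarith
    have : k = 0 := by exact_mod_cast this.symm
    have := congrFun h ζ
    simp only [‹k = 0›] at this
    rw [this, _root_.glide]
    push_cast; ring

theorem IsExpLift.eq_right {f : RP2 ≃ₜ RP2} {F : ℂ → ℂ} (hF : IsExpLift f F) {ζ : ℂ}
    (hζ : Real.pi / 2 ≤ ζ.re) : F ζ = ζ := by
  obtain ⟨η, rfl⟩ : ∃ η, _root_.glide η = ζ :=
    ⟨⟨-ζ.re, ζ.im - Real.pi⟩, Complex.ext (by simp [glide_re]) (by simp [glide_im])⟩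
  rw [hF.glide, hF.eq_left _ (by rw [glide_re] at hζ; linarith)]

theorem IsExpLift.eq_of_le_abs {f : RP2 ≃ₜ RP2} {F : ℂ → ℂ} (hF : IsExpLift f F) {ζ : ℂ}
    (hζ : Real.pi / 2 ≤ |ζ.re|) : F ζ = ζ := by
  rcases le_abs'.1 hζ with h | h
  · exact hF.eq_left _ h
  · exact hF.eq_right h

theorem exists_homeomorph_isExpLift {f : RP2 ≃ₜ RP2}
    (hf : ∀ z : ℂ, ‖z‖ ≤ Real.exp (-(Real.pi / 2)) → f (planeMap z) = planeMap z) :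
    ∃ F : ℂ ≃ₜ ℂ, IsExpLift f F ∧ IsExpLift f.symm F.symm := by
  obtain ⟨F, hF⟩ := exists_isExpLift hf
  obtain ⟨G, hG⟩ := exists_isExpLift (f := f.symm) fun z hz =>
    (Homeomorph.symm_apply_eq f).2 (hf z hz).symm
  exact ⟨⟨⟨F, G, hF.eq_id_of_comp hG f.symm_apply_apply, hG.eq_id_of_comp hF f.apply_symm_apply⟩,
    hF.cont, hG.cont⟩, hF, hG⟩

theorem IsExpLift.abs_re_le {f : RP2 ≃ₜ RP2} {F : ℂ ≃ₜ ℂ} (hF : IsExpLift f F) {ζ : ℂ}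
    (hζ : |ζ.re| ≤ Real.pi / 2) : |(F ζ).re| ≤ Real.pi / 2 := by
  by_contra! h
  have := F.injective (hF.eq_of_le_abs h.le)
  rw [this] at h
  linarith

end ExpCover

section LogChart

open Set Filter Topology Metric

/-- The coordinate change `w = exp (i ζ)`. -/
noncomputable def stripLog (w : ℂ) : ℂ := -Complex.I * Complex.log w

theorem stripLog_re (w : ℂ) : (stripLog w).re = w.arg := by simp [stripLog, Complex.log_im]

theorem stripLog_im (w : ℂ) : (stripLog w).im = -Real.log ‖w‖ := by
  simp [stripLog, Complex.log_re]

theorem exp_I_mul_stripLog {w : ℂ} (hw : w ≠ 0) : Complex.exp (Complex.I * stripLog w) = w := by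
  rw [stripLog, ← mul_assoc, mul_neg, Complex.I_mul_I, neg_neg, one_mul, Complex.exp_log hw]

theorem stripLog_exp_I_mul {ζ : ℂ} (h1 : -Real.pi < ζ.re) (h2 : ζ.re ≤ Real.pi) :
    stripLog (Complex.exp (Complex.I * ζ)) = ζ := by
  rw [stripLog, Complex.log_exp (by simpa using h1) (by simpa using h2), ← mul_assoc, neg_mul,
    Complex.I_mul_I, neg_neg, one_mul]

theorem continuousOn_stripLog : ContinuousOn stripLog Complex.slitPlane :=
  continuousOn_const.mul (continuousOn_id.clog fun _ h => h)

theorem stripLog_injOn : InjOn stripLog Complex.slitPlane := fun z hz w hw h => by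
  rw [← exp_I_mul_stripLog (Complex.slitPlane_ne_zero hz), h,
    exp_I_mul_stripLog (Complex.slitPlane_ne_zero hw)]

/-- The glide reflection `glide` in the coordinate `w = exp (i ζ)`. -/
noncomputable def shrink (w : ℂ) : ℂ := (Real.exp (-Real.pi) : ℝ) * (starRingEnd ℂ) w

theorem continuous_shrink : Continuous shrink := by unfold shrink; fun_prop

theorem shrink_re (w : ℂ) : (shrink w).re = Real.exp (-Real.pi) * w.re := by
  rw [shrink, Complex.re_ofReal_mul, Complex.conj_re]

theorem norm_shrink (w : ℂ) : ‖shrink w‖ = Real.exp (-Real.pi) * ‖w‖ := by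
  rw [shrink, norm_mul, RCLike.norm_conj, Complex.norm_of_nonneg (Real.exp_nonneg _)]

theorem exp_I_mul_glide (ζ : ℂ) :
    Complex.exp (Complex.I * glide ζ) = shrink (Complex.exp (Complex.I * ζ)) := by
  rw [shrink, ← Complex.exp_conj, Complex.ofReal_exp, ← Complex.exp_add]
  congr 1
  simp only [glide, map_mul, Complex.conj_I]
  push_cast
  linear_combination (Real.pi : ℂ) * Complex.I_mul_I

theorem mem_slitPlane_of_re_nonneg {w : ℂ} (h : 0 ≤ w.re) (hw : w ≠ 0) : w ∈ Complex.slitPlane := by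
  rcases h.lt_or_eq with h | h
  · exact Or.inl h
  · exact Or.inr fun him => hw (Complex.ext h.symm him)

theorem stripLog_shrink {w : ℂ} (hw : w ∈ Complex.slitPlane) :
    stripLog (shrink w) = glide (stripLog w) := by
  have hw0 := Complex.slitPlane_ne_zero hw
  have harg : w.arg ≠ Real.pi := (Complex.mem_slitPlane_iff_arg.1 hw).1
  rw [stripLog, shrink, Complex.log_ofReal_mul (Real.exp_pos _) (by simpa using hw0),
    Complex.log_conj _ harg, Real.log_exp, glide, stripLog]
  simp only [map_mul, map_neg, Complex.conj_I]
  push_cast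
  ring

/-- The chart of the projective plane in the coordinate `w = exp (i ζ)`. -/
noncomputable def logMap (w : ℂ) : RP2 := expMap (stripLog w)

theorem continuousOn_logMap : ContinuousOn logMap Complex.slitPlane :=
  continuous_expMap.comp_continuousOn continuousOn_stripLog

theorem isOpen_image_logMap (V : Set ℂ) (hV : V ⊆ Complex.slitPlane) (hVo : IsOpen V) :
    IsOpen (logMap '' V) := by
  have h : logMap '' V = expMap '' ({ζ | -Real.pi < ζ.re} ∩ {ζ | ζ.re < Real.pi} ∩
      (fun ζ => Complex.exp (Complex.I * ζ)) ⁻¹' V) := by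
    ext x
    constructor
    · rintro ⟨w, hw, rfl⟩
      refine ⟨stripLog w, ⟨⟨?_, ?_⟩, ?_⟩, rfl⟩
      · rw [mem_ofPred_eq, stripLog_re]; exact Complex.neg_pi_lt_arg w
      · rw [mem_ofPred_eq, stripLog_re]
        exact (Complex.arg_le_pi w).lt_of_ne (Complex.mem_slitPlane_iff_arg.1 (hV hw)).1
      · rw [mem_preimage, exp_I_mul_stripLog (Complex.slitPlane_ne_zero (hV hw))]
        exact hw
    · rintro ⟨ζ, ⟨⟨h1, h2⟩, h3⟩, rfl⟩
      exact ⟨_, h3, by rw [logMap, stripLog_exp_I_mul h1 (le_of_lt h2)]⟩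
  rw [h]
  refine isOpenMap_expMap _ (IsOpen.inter (IsOpen.inter ?_ ?_) (hVo.preimage (by fun_prop)))
  · exact isOpen_lt continuous_const Complex.continuous_re
  · exact isOpen_lt Complex.continuous_re continuous_const

theorem exists_nhds_injOn_logMap {w : ℂ} (hw : w ∈ Complex.slitPlane) :
    ∃ V ∈ 𝓝 w, V ⊆ Complex.slitPlane ∧ InjOn logMap V := by
  obtain ⟨U, hUo, hwU, hU⟩ := isLocallyInjective_expMap (stripLog w)
  refine ⟨Complex.slitPlane ∩ stripLog ⁻¹' U, ?_, inter_subset_left, ?_⟩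
  · exact (continuousOn_stripLog.isOpen_inter_preimage Complex.isOpen_slitPlane hUo).mem_nhds
      ⟨hw, hwU⟩
  · intro z hz z' hz' h
    exact stripLog_injOn hz.1 hz'.1 (hU hz.2 hz'.2 h)

theorem logMap_ne (w : ℂ) : logMap w ≠ planeMap 0 := expMap_ne _

theorem eq_of_logMap_eq {z w : ℂ} (hz : z ∈ Complex.slitPlane) (hw : w ∈ Complex.slitPlane)
    (h : logMap z = logMap w) (hd : |Real.log ‖z‖ - Real.log ‖w‖| < Real.pi) : z = w := by
  refine stripLog_injOn hz hw (eq_of_expMap_eq h ?_)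
  rw [stripLog_im, stripLog_im]
  convert hd using 2
  ring

theorem shrink_shrink (w : ℂ) : shrink (shrink w) = (Real.exp (-(2 * Real.pi)) : ℝ) * w := by
  rw [shrink, shrink, map_mul, Complex.conj_ofReal, Complex.conj_conj, ← mul_assoc,
    ← Complex.ofReal_mul, ← Real.exp_add]
  congr 3
  ring

theorem shrink_iterate_two_mul (n : ℕ) (w : ℂ) :
    shrink^[2 * n] w = (Real.exp (-(2 * Real.pi) * n) : ℝ) * w := by
  induction n with
  | zero => simp
  | succ n ih =>
    rw [mul_add, mul_one, Nat.add_comm, Function.iterate_add_apply, ih]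
    change shrink (shrink _) = _
    rw [shrink_shrink, ← mul_assoc, ← Complex.ofReal_mul, ← Real.exp_add]
    congr 3
    push_cast; ring

theorem shrink_iterate_two_mul_add_one (n : ℕ) (w : ℂ) :
    shrink^[2 * n + 1] w = (Real.exp (-Real.pi * (2 * n + 1)) : ℝ) * (starRingEnd ℂ) w := by
  rw [Function.iterate_succ_apply, shrink_iterate_two_mul, shrink, ← mul_assoc,
    ← Complex.ofReal_mul, ← Real.exp_add]
  congr 3
  ring

theorem exists_iterate_of_logMap_eq {z w : ℂ} (hz : z ≠ 0) (hw : w ≠ 0)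
    (h : logMap z = logMap w) : ∃ n : ℕ, w = shrink^[n] z ∨ z = shrink^[n] w := by
  have key : ∀ z w : ℂ, ∀ k : ℤ, 0 ≤ k → z ≠ 0 → w ≠ 0 →
      stripLog w = stripLog z + k * (2 * Real.pi * Complex.I) ∨
      stripLog w = -(starRingEnd ℂ) (stripLog z) + (2 * k + 1) * (Real.pi * Complex.I) →
      ∃ n : ℕ, w = shrink^[n] z := by
    intro z w k hk hz hw h
    lift k to ℕ using hk
    rw [← exp_I_mul_stripLog hw]
    rcases h with h | h
    · refine ⟨2 * k, ?_⟩
      rw [shrink_iterate_two_mul, h, mul_add, Complex.exp_add, exp_I_mul_stripLog hz, mul_comm]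
      congr 1
      rw [Complex.ofReal_exp]
      congr 1
      push_cast
      linear_combination (2 * Real.pi * k : ℂ) * Complex.I_mul_I
    · refine ⟨2 * k + 1, ?_⟩
      have hz' : (starRingEnd ℂ) z =
          Complex.exp ((starRingEnd ℂ) (Complex.I * stripLog z)) := by
        rw [Complex.exp_conj, exp_I_mul_stripLog hz]
      rw [shrink_iterate_two_mul_add_one, h, hz', Complex.ofReal_exp, ← Complex.exp_add]
      congr 1
      simp only [map_mul, Complex.conj_I]
      push_cast
      linear_combination ((2 * k + 1) * Real.pi : ℂ) * Complex.I_mul_I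
  obtain ⟨k, hk⟩ := expMap_eq_iff.1 h
  rcases lt_or_ge k 0 with hk0 | hk0
  · rcases hk with hk | hk
    · obtain ⟨n, hn⟩ := key w z (-k) (by omega) hw hz
        (Or.inl (by rw [hk]; push_cast; ring))
      exact ⟨n, Or.inr hn⟩
    · obtain ⟨n, hn⟩ := key w z (-k - 1) (by omega) hw hz (Or.inr (by
        rw [hk]
        simp only [map_add, map_neg, map_mul, Complex.conj_conj, Complex.conj_ofReal,
          Complex.conj_I, map_one, Complex.conj_ofNat, map_intCast]
        push_cast; ring))
      exact ⟨n, Or.inr hn⟩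
  · obtain ⟨n, hn⟩ := key z w k hk0 hz hw hk
    exact ⟨n, Or.inl hn⟩

/-- The circle bounding the standard disc. -/
def rimCircle : Set RP2 := {x | ∃ ζ : ℂ, |ζ.re| = Real.pi / 2 ∧ expMap ζ = x}

theorem expMap_mem_rimCircle {ζ : ℂ} : expMap ζ ∈ rimCircle ↔ |ζ.re| = Real.pi / 2 :=
  ⟨fun ⟨_, hη, h⟩ => (abs_re_eq_of_expMap_eq h).symm.trans hη, fun h => ⟨ζ, h, rfl⟩⟩

theorem logMap_mem_rimCircle {w : ℂ} (hw : w ≠ 0) : logMap w ∈ rimCircle ↔ w.re = 0 := by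
  rw [logMap, expMap_mem_rimCircle, stripLog_re]
  have h1 := Complex.abs_arg_le_pi_div_two_iff (z := w)
  have h2 := Complex.abs_arg_lt_pi_div_two_iff (z := w)
  constructor
  · intro h
    have h3 : 0 ≤ w.re := h1.1 h.le
    by_contra h4
    exact absurd (h2.2 (Or.inl (lt_of_le_of_ne h3 (Ne.symm h4)))) (by rw [h]; exact lt_irrefl _)
  · intro h
    refine le_antisymm (h1.2 h.ge) (not_lt.1 fun h3 => ?_)
    rcases h2.1 h3 with h4 | h4
    · exact absurd h h4.ne'
    · exact hw h4

end LogChart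

section HalfLift

open Set Filter Topology Metric

theorem IsExpLift.add_two_pi {f : RP2 ≃ₜ RP2} {F : ℂ → ℂ} (hF : IsExpLift f F) (ζ : ℂ) :
    F (ζ + 2 * Real.pi * Complex.I) = F ζ + 2 * Real.pi * Complex.I := by
  have h : ∀ z, _root_.glide (_root_.glide z) = z + 2 * Real.pi * Complex.I := fun z => by
    simp only [_root_.glide, map_add, map_neg, map_mul, Complex.conj_conj, Complex.conj_ofReal,
      Complex.conj_I]
    ring
  rw [← h, hF.glide, hF.glide, h]

theorem IsExpLift.exists_norm_sub_le {f : RP2 ≃ₜ RP2} {F : ℂ → ℂ} (hF : IsExpLift f F) :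
    ∃ C, ∀ ζ, ‖F ζ - ζ‖ ≤ C := by
  have hK : IsCompact (Icc (-(Real.pi / 2)) (Real.pi / 2) ×ℂ Icc 0 (2 * Real.pi)) :=
    isCompact_Icc.reProdIm isCompact_Icc
  obtain ⟨C, hC⟩ := hK.exists_bound_of_continuousOn (f := fun ζ => F ζ - ζ)
    (hF.cont.sub continuous_id).continuousOn
  have hper : Function.Periodic (fun ζ => F ζ - ζ) (2 * Real.pi * Complex.I) := fun ζ => by
    simp only [hF.add_two_pi]; ring
  have hC0 : 0 ≤ C := (norm_nonneg _).trans (hC 0 ⟨⟨by simp; positivity, by simp; positivity⟩,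
    ⟨by simp, by simp; positivity⟩⟩)
  refine ⟨C, fun ζ => ?_⟩
  rcases le_or_gt (Real.pi / 2) |ζ.re| with h | h
  · rwa [hF.eq_of_le_abs h, sub_self, norm_zero]
  set n : ℤ := ⌊ζ.im / (2 * Real.pi)⌋
  have h1 := hper.sub_int_mul_eq (x := ζ) n
  have hre : (ζ - n * (2 * Real.pi * Complex.I)).re = ζ.re := by simp
  have him : (ζ - n * (2 * Real.pi * Complex.I)).im = ζ.im - n * (2 * Real.pi) := by simp
  have h2 := hC (ζ - n * (2 * Real.pi * Complex.I)) ?_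
  · have h3 : F ζ - ζ = _ := h1.symm
    rwa [h3]
  · have hp : (0:ℝ) < 2 * Real.pi := by positivity
    have h3 := Int.floor_le (ζ.im / (2 * Real.pi))
    have h4 := Int.lt_floor_add_one (ζ.im / (2 * Real.pi))
    rw [le_div_iff₀ hp] at h3
    rw [div_lt_iff₀ hp] at h4
    refine ⟨?_, ?_⟩
    · rw [mem_preimage, hre]; exact abs_le.1 h.le
    · rw [mem_preimage, him]; constructor <;> linarith

open Classical in
/-- A lift of a homeomorphism, in the coordinate `w = exp (i ζ)`. -/
noncomputable def halfLift (F : ℂ → ℂ) (w : ℂ) : ℂ :=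
  if w = 0 then 0 else Complex.exp (Complex.I * F (stripLog w))

theorem halfLift_zero (F : ℂ → ℂ) : halfLift F 0 = 0 := if_pos rfl

theorem halfLift_of_ne (F : ℂ → ℂ) {w : ℂ} (hw : w ≠ 0) :
    halfLift F w = Complex.exp (Complex.I * F (stripLog w)) := if_neg hw

theorem abs_stripLog_re_le {w : ℂ} (hw : 0 ≤ w.re) : |(stripLog w).re| ≤ Real.pi / 2 := by
  rw [stripLog_re]; exact Complex.abs_arg_le_pi_div_two_iff.2 hw

theorem IsExpLift.continuousOn_halfLift {f : RP2 ≃ₜ RP2} {F : ℂ → ℂ} (hF : IsExpLift f F) :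
    ContinuousOn (halfLift F) {w | 0 ≤ w.re} := by
  intro w hw
  refine ContinuousAt.continuousWithinAt ?_
  by_cases hw0 : w = 0
  · subst hw0
    obtain ⟨C, hC⟩ := hF.exists_norm_sub_le
    rw [ContinuousAt, halfLift_zero]
    refine squeeze_zero_norm (a := fun w => Real.exp C * ‖w‖) (fun w => ?_) ?_
    · by_cases h0 : w = 0
      · rw [h0, halfLift_zero]; simp
      rw [halfLift_of_ne F h0, Complex.norm_exp]
      have h1 := (Complex.abs_im_le_norm _).trans (hC (stripLog w))
      rw [Complex.sub_im, stripLog_im] at h1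
      have h2 := (abs_le.1 h1).1
      have h3 : ‖w‖ = Real.exp (Real.log ‖w‖) := (Real.exp_log (norm_pos_iff.2 h0)).symm
      rw [h3, ← Real.exp_add, Real.exp_le_exp]
      simp only [Complex.mul_re, Complex.I_re, Complex.I_im]
      linarith
    · have : Continuous fun w : ℂ => Real.exp C * ‖w‖ := by fun_prop
      simpa using this.tendsto 0
  · have hs := mem_slitPlane_of_re_nonneg hw hw0
    have h1 : ContinuousAt (fun w => Complex.exp (Complex.I * F (stripLog w))) w := by
      have h2 : ContinuousAt stripLog w :=
        continuousOn_stripLog.continuousAt (Complex.isOpen_slitPlane.mem_nhds hs)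
      exact Complex.continuous_exp.continuousAt.comp (continuousAt_const.mul
        (hF.cont.continuousAt.comp h2))
    refine h1.congr ?_
    filter_upwards [isOpen_ne.mem_nhds hw0] with v hv
    exact (halfLift_of_ne F hv).symm

theorem halfLift_re_nonneg {f : RP2 ≃ₜ RP2} {F : ℂ ≃ₜ ℂ} (hF : IsExpLift f F) {w : ℂ}
    (hw : 0 ≤ w.re) : 0 ≤ (halfLift F w).re := by
  by_cases h0 : w = 0
  · rw [h0, halfLift_zero, Complex.zero_re]
  rw [halfLift_of_ne F h0, Complex.exp_re]
  have h := abs_le.1 (hF.abs_re_le (abs_stripLog_re_le hw))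
  refine mul_nonneg (Real.exp_nonneg _) (Real.cos_nonneg_of_mem_Icc ?_)
  simpa using h

theorem IsExpLift.halfLift_of_re_eq_zero {f : RP2 ≃ₜ RP2} {F : ℂ → ℂ} (hF : IsExpLift f F) {w : ℂ}
    (hw : w.re = 0) : halfLift F w = w := by
  by_cases h0 : w = 0
  · rw [h0, halfLift_zero]
  rw [halfLift_of_ne F h0, hF.eq_of_le_abs, exp_I_mul_stripLog h0]
  have := (logMap_mem_rimCircle h0).2 hw
  rw [logMap, expMap_mem_rimCircle] at this
  exact this.ge

theorem stripLog_halfLift {f : RP2 ≃ₜ RP2} {F : ℂ ≃ₜ ℂ} (hF : IsExpLift f F) {w : ℂ}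
    (hw : 0 ≤ w.re) (h0 : w ≠ 0) : stripLog (halfLift F w) = F (stripLog w) := by
  have h := abs_le.1 (hF.abs_re_le (abs_stripLog_re_le hw))
  have hp := Real.pi_pos
  rw [halfLift_of_ne F h0, stripLog_exp_I_mul (by linarith) (by linarith)]

theorem halfLift_halfLift {f : RP2 ≃ₜ RP2} {F : ℂ ≃ₜ ℂ} {H : ℂ → ℂ} (hF : IsExpLift f F)
    (hFH : ∀ ζ, H (F ζ) = ζ) {w : ℂ} (hw : 0 ≤ w.re) :
    halfLift H (halfLift F w) = w := by
  by_cases h0 : w = 0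
  · rw [h0, halfLift_zero, halfLift_zero]
  have h1 : halfLift F w ≠ 0 := by
    rw [halfLift_of_ne F h0]; exact Complex.exp_ne_zero _
  rw [halfLift_of_ne H h1, stripLog_halfLift hF hw h0, hFH, exp_I_mul_stripLog h0]

theorem halfLift_shrink {f : RP2 ≃ₜ RP2} {F : ℂ → ℂ} (hF : IsExpLift f F) {w : ℂ}
    (hw : 0 ≤ w.re) : halfLift F (shrink w) = shrink (halfLift F w) := by
  by_cases h0 : w = 0
  · rw [h0, halfLift_zero, shrink, map_zero, mul_zero, halfLift_zero]
  have h1 : shrink w ≠ 0 := by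
    rw [← norm_pos_iff, norm_shrink]
    have := norm_pos_iff.2 h0
    positivity
  rw [halfLift_of_ne F h1, halfLift_of_ne F h0,
    stripLog_shrink (mem_slitPlane_of_re_nonneg hw h0), hF.glide, exp_I_mul_glide]

/-- Reflection in the imaginary axis. -/
noncomputable def axisRefl (w : ℂ) : ℂ := -(starRingEnd ℂ) w

theorem continuous_axisRefl : Continuous axisRefl := by unfold axisRefl; fun_prop

theorem axisRefl_axisRefl (w : ℂ) : axisRefl (axisRefl w) = w := by simp [axisRefl]

theorem axisRefl_re (w : ℂ) : (axisRefl w).re = -w.re := by simp [axisRefl]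

theorem axisRefl_im (w : ℂ) : (axisRefl w).im = w.im := by simp [axisRefl]

theorem norm_axisRefl (w : ℂ) : ‖axisRefl w‖ = ‖w‖ := by simp [axisRefl]

theorem axisRefl_eq_self_iff {w : ℂ} : axisRefl w = w ↔ w.re = 0 := by
  rw [Complex.ext_iff, axisRefl_re, axisRefl_im]
  constructor
  · rintro ⟨h, -⟩; linarith
  · intro h; simp [h]

theorem shrink_axisRefl (w : ℂ) : shrink (axisRefl w) = axisRefl (shrink w) := by
  simp only [shrink, axisRefl, map_neg, mul_neg, map_mul, Complex.conj_ofReal]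

/-- `G` expresses `f` in the coordinate of `logMap` on the right half plane, and is extended to the
left half plane by reflection. -/
structure IsHalfLift (f : RP2 ≃ₜ RP2) (G : ℂ ≃ₜ ℂ) : Prop where
  refl : ∀ w, G (axisRefl w) = axisRefl (G w)
  eq_self : ∀ w : ℂ, w.re = 0 → G w = w
  re_nonneg : ∀ w : ℂ, 0 ≤ w.re → 0 ≤ (G w).re
  shrink : ∀ w, G (shrink w) = shrink (G w)
  lift : ∀ w : ℂ, 0 ≤ w.re → w ≠ 0 → logMap (G w) = f (logMap w)

/-- The extension by reflection of a self-map of the right half plane. -/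
noncomputable def extendRefl (g : ℂ → ℂ) (w : ℂ) : ℂ :=
  if 0 ≤ w.re then g w else axisRefl (g (axisRefl w))

theorem extendRefl_of_nonneg {g : ℂ → ℂ} {w : ℂ} (hw : 0 ≤ w.re) : extendRefl g w = g w :=
  if_pos hw

theorem extendRefl_of_nonpos {g : ℂ → ℂ} (hg : ∀ w : ℂ, w.re = 0 → g w = w) {w : ℂ}
    (hw : w.re ≤ 0) : extendRefl g w = axisRefl (g (axisRefl w)) := by
  rcases hw.lt_or_eq with h | h
  · exact if_neg h.not_ge
  · rw [extendRefl_of_nonneg h.ge, axisRefl_eq_self_iff.2 h, hg w h, axisRefl_eq_self_iff.2 h]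

theorem continuous_extendRefl {g : ℂ → ℂ} (hg : ∀ w : ℂ, w.re = 0 → g w = w)
    (hc : ContinuousOn g {w | 0 ≤ w.re}) : Continuous (extendRefl g) := by
  refine continuous_if_le continuous_const Complex.continuous_re hc ?_ ?_
  · refine continuous_axisRefl.comp_continuousOn (hc.comp continuous_axisRefl.continuousOn ?_)
    intro w hw
    have : w.re ≤ 0 := hw
    rw [mem_ofPred_eq, axisRefl_re]
    linarith
  · intro w hw
    rw [axisRefl_eq_self_iff.2 hw.symm, hg w hw.symm, axisRefl_eq_self_iff.2 hw.symm]

theorem extendRefl_axisRefl {g : ℂ → ℂ} (hg : ∀ w : ℂ, w.re = 0 → g w = w) (w : ℂ) :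
    extendRefl g (axisRefl w) = axisRefl (extendRefl g w) := by
  rcases le_total 0 w.re with h | h
  · rw [extendRefl_of_nonneg h, extendRefl_of_nonpos hg (by rw [axisRefl_re]; linarith),
      axisRefl_axisRefl]
  · rw [extendRefl_of_nonpos hg h, extendRefl_of_nonneg (by rw [axisRefl_re]; linarith),
      axisRefl_axisRefl]

theorem extendRefl_extendRefl {g h : ℂ → ℂ} (hg : ∀ w : ℂ, w.re = 0 → g w = w)
    (hh : ∀ w : ℂ, w.re = 0 → h w = w) (hmaps : ∀ w : ℂ, 0 ≤ w.re → 0 ≤ (g w).re)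
    (hhg : ∀ w : ℂ, 0 ≤ w.re → h (g w) = w) (w : ℂ) : extendRefl h (extendRefl g w) = w := by
  have key : ∀ w : ℂ, 0 ≤ w.re → extendRefl h (extendRefl g w) = w := fun w hw => by
    rw [extendRefl_of_nonneg hw, extendRefl_of_nonneg (hmaps w hw), hhg w hw]
  rcases le_total 0 w.re with hw | hw
  · exact key w hw
  · rw [← axisRefl_axisRefl w, extendRefl_axisRefl hg, extendRefl_axisRefl hh,
      key _ (by rw [axisRefl_re]; linarith)]

theorem exists_isHalfLift {f : RP2 ≃ₜ RP2} {F : ℂ ≃ₜ ℂ} (hF : IsExpLift f F)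
    (hF' : IsExpLift f.symm F.symm) : ∃ G : ℂ ≃ₜ ℂ, IsHalfLift f G := by
  have h0 : ∀ w : ℂ, w.re = 0 → halfLift F w = w := fun w => hF.halfLift_of_re_eq_zero
  have h0' : ∀ w : ℂ, w.re = 0 → halfLift F.symm w = w := fun w => hF'.halfLift_of_re_eq_zero
  refine ⟨⟨⟨extendRefl (halfLift F), extendRefl (halfLift F.symm), ?_, ?_⟩,
    continuous_extendRefl h0 hF.continuousOn_halfLift,
    continuous_extendRefl h0' hF'.continuousOn_halfLift⟩, ?_⟩
  · exact extendRefl_extendRefl h0 h0' (fun w => halfLift_re_nonneg hF)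
      fun w hw => halfLift_halfLift hF F.symm_apply_apply hw
  · exact extendRefl_extendRefl h0' h0 (fun w => halfLift_re_nonneg hF')
      fun w hw => halfLift_halfLift hF' F.apply_symm_apply hw
  · have hs : ∀ w : ℂ, 0 ≤ w.re →
        extendRefl (halfLift F) (_root_.shrink w) = _root_.shrink (extendRefl (halfLift F) w) :=
      fun w hw => by
        rw [extendRefl_of_nonneg hw, extendRefl_of_nonneg, halfLift_shrink hF hw]
        rw [shrink_re]; positivity
    refine ⟨extendRefl_axisRefl h0, fun w hw => ?_, fun w hw => ?_, fun w => ?_, fun w hw hw0 => ?_⟩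
    · exact (extendRefl_of_nonneg hw.ge).trans (h0 w hw)
    · change 0 ≤ (extendRefl (halfLift F) w).re
      rw [extendRefl_of_nonneg hw]
      exact halfLift_re_nonneg hF hw
    · change extendRefl (halfLift F) (_root_.shrink w) = _root_.shrink (extendRefl (halfLift F) w)
      rcases le_total 0 w.re with hw | hw
      · exact hs w hw
      · rw [← axisRefl_axisRefl w, shrink_axisRefl, extendRefl_axisRefl h0, extendRefl_axisRefl h0,
          hs _ (by rw [axisRefl_re]; linarith), shrink_axisRefl]
    · change logMap (extendRefl (halfLift F) w) = f (logMap w)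
      rw [extendRefl_of_nonneg hw, logMap, stripLog_halfLift hF hw hw0, hF.lift, logMap]

end HalfLift

section Symmetry

open Set Filter Topology Metric

theorem IsHalfLift.zero {f : RP2 ≃ₜ RP2} {G : ℂ ≃ₜ ℂ} (hG : IsHalfLift f G) : G 0 = 0 :=
  hG.eq_self 0 Complex.zero_re

theorem IsHalfLift.isDiscChart {f : RP2 ≃ₜ RP2} {G : ℂ ≃ₜ ℂ} (hG : IsHalfLift f G) :
    IsDiscChart G where
  cont := G.continuous.continuousOn
  inj := G.injective.injOn
  isOpen_image := fun _ _ hV => G.isOpenMap _ hV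
  zero := hG.zero

theorem IsHalfLift.re_pos_of_image {f : RP2 ≃ₜ RP2} {G : ℂ ≃ₜ ℂ} (hG : IsHalfLift f G) {w : ℂ}
    (hw : 0 < (G w).re) : 0 < w.re := by
  by_contra! h
  have h1 := hG.re_nonneg (axisRefl w) (by rw [axisRefl_re]; linarith)
  rw [hG.refl, axisRefl_re] at h1
  linarith

theorem isRiemannMap_axisRefl {U : Set ℂ} (hU : ∀ w, axisRefl w ∈ U ↔ w ∈ U) {φ : ℂ → ℂ} {a : ℝ}
    (hφ : IsRiemannMap U φ a) : IsRiemannMap U (fun z => axisRefl (φ (axisRefl z))) a := by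
  have hb : ∀ z ∈ ball (0 : ℂ) 1, axisRefl z ∈ ball (0 : ℂ) 1 := fun z hz => by
    rwa [mem_ball_zero_iff, norm_axisRefl, ← mem_ball_zero_iff]
  have hd : ∀ z ∈ ball (0 : ℂ) 1,
      HasDerivAt (fun z => axisRefl (φ (axisRefl z))) ((starRingEnd ℂ) (deriv φ (axisRefl z))) z := by
    intro z hz
    have h1 : HasDerivAt φ (deriv φ (axisRefl z)) (-((starRingEnd ℂ) z)) :=
      (hφ.diff.differentiableAt (isOpen_ball.mem_nhds (hb z hz))).hasDerivAt
    have h2 : HasDerivAt (fun w => φ (-w)) (-(deriv φ (axisRefl z))) ((starRingEnd ℂ) z) := by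
      have := h1.comp ((starRingEnd ℂ) z) (hasDerivAt_neg ((starRingEnd ℂ) z))
      simpa [Function.comp_def] using this
    have h3 := h2.conj_conj.neg
    simp only [map_neg, neg_neg, Complex.conj_conj] at h3
    exact h3
  refine ⟨hφ.pos, fun z hz => (hd z hz).differentiableAt.differentiableWithinAt, ?_, ?_, ?_, ?_⟩
  · intro z hz w hw h
    have h1 := congrArg axisRefl h
    simp only [axisRefl_axisRefl] at h1
    have h2 := congrArg axisRefl (hφ.inj (hb z hz) (hb w hw) h1)
    rwa [axisRefl_axisRefl, axisRefl_axisRefl] at h2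
  · ext w
    constructor
    · rintro ⟨z, hz, rfl⟩
      exact (hU _).2 (hφ.image ▸ ⟨_, hb z hz, rfl⟩)
    · intro hw
      have h1 := (hU w).2 hw
      rw [← hφ.image] at h1
      obtain ⟨z, hz, h⟩ := h1
      exact ⟨axisRefl z, hb z hz, by
        change axisRefl (φ (axisRefl (axisRefl z))) = w
        rw [axisRefl_axisRefl, h, axisRefl_axisRefl]⟩
  · simp [axisRefl, hφ.zero]
  · rw [(hd 0 (mem_ball_self one_pos)).deriv]
    simp [axisRefl, hφ.deriv_zero]

variable {f : RP2 ≃ₜ RP2} {G : ℂ ≃ₜ ℂ} {φ : ℂ → ℂ} {a : ℝ} {χ : ℂ ≃ₜ ℂ}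

theorem IsUniformization.conformal_axisRefl (hG : IsHalfLift f G) (hχ : IsUniformization G φ a χ)
    {z : ℂ} (hz : z ∈ ball (0 : ℂ) 1) : φ (axisRefl z) = axisRefl (φ z) := by
  have hb : ∀ z ∈ ball (0 : ℂ) 1, axisRefl z ∈ ball (0 : ℂ) 1 := fun z hz => by
    rwa [mem_ball_zero_iff, norm_axisRefl, ← mem_ball_zero_iff]
  have hU : ∀ w, axisRefl w ∈ G '' ball 0 1 → w ∈ G '' ball 0 1 := by
    rintro w ⟨v, hv, h⟩
    exact ⟨axisRefl v, hb v hv, by rw [hG.refl, h, axisRefl_axisRefl]⟩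
  have h := hχ.riemann.eqOn (isRiemannMap_axisRefl
    (fun w => ⟨hU w, fun h => hU _ (by rwa [axisRefl_axisRefl])⟩) hχ.riemann) hz
  rw [h, axisRefl_axisRefl]

theorem IsUniformization.axisRefl (hG : IsHalfLift f G) (hχ : IsUniformization G φ a χ) (z : ℂ) :
    χ (axisRefl z) = axisRefl (χ z) := by
  have h1 : EqOn (fun z => χ (_root_.axisRefl z)) (fun z => _root_.axisRefl (χ z))
      (closedBall 0 1) := by
    rw [← closure_ball (0 : ℂ) one_ne_zero]
    refine EqOn.closure (fun z hz => ?_) (χ.continuous.comp continuous_axisRefl)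
      (continuous_axisRefl.comp χ.continuous)
    apply G.injective
    rw [hχ.eq _ (by rwa [mem_ball_zero_iff, norm_axisRefl, ← mem_ball_zero_iff]), hG.refl,
      hχ.eq z hz, hχ.conformal_axisRefl hG hz]
  rcases le_total ‖z‖ 1 with h | h
  · exact h1 (mem_closedBall_zero_iff.2 h)
  · have h2 : ∀ (r : ℝ) (w : ℂ), _root_.axisRefl (r * w) = r * _root_.axisRefl w := fun r w => by
      simp [_root_.axisRefl]
    have h3 : (_root_.axisRefl z) / (‖z‖ : ℂ) = _root_.axisRefl (z / ‖z‖) := by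
      simp [_root_.axisRefl, neg_div]
    rw [hχ.radial _ (by rwa [norm_axisRefl]), hχ.radial z h, norm_axisRefl, h2, h3]
    congr 1
    refine h1 (mem_closedBall_zero_iff.2 ?_)
    rw [norm_div, Complex.norm_real, norm_norm, div_self (by linarith)]

theorem IsUniformization.re_eq_zero_iff (hG : IsHalfLift f G) (hχ : IsUniformization G φ a χ)
    {z : ℂ} : (χ z).re = 0 ↔ z.re = 0 := by
  rw [← axisRefl_eq_self_iff, ← hχ.axisRefl hG, χ.injective.eq_iff, axisRefl_eq_self_iff]

theorem IsRiemannMap.exists_norm_sub_le {U : Set ℂ} (hφ : IsRiemannMap U φ a) :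
    ∃ δ > 0, ∀ z : ℂ, ‖z‖ < δ → ‖φ z - a * z‖ ≤ a / 2 * ‖z‖ := by
  have h1 : HasDerivAt φ a 0 := by
    rw [← hφ.deriv_zero]
    exact (hφ.diff.differentiableAt (ball_mem_nhds _ one_pos)).hasDerivAt
  have h2 := (hasDerivAt_iff_isLittleO.1 h1).def (half_pos hφ.pos)
  obtain ⟨δ, hδ, h⟩ := Metric.eventually_nhds_iff.1 h2
  refine ⟨δ, hδ, fun z hz => ?_⟩
  have := h (y := z) (by rwa [dist_zero_right])
  simpa [hφ.zero, mul_comm] using this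

theorem IsUniformization.re_pos (hG : IsHalfLift f G) (hχ : IsUniformization G φ a χ)
    {z : ℂ} (hz : 0 < z.re) : 0 < (χ z).re := by
  obtain ⟨δ, hδ, h⟩ := hχ.riemann.exists_norm_sub_le
  have ha := hχ.riemann.pos
  obtain ⟨t, ht0, ht⟩ := exists_between (lt_min hδ one_pos)
  have hn : ‖(t : ℂ)‖ = t := Complex.norm_of_nonneg ht0.le
  have h1 := h t (by rw [hn]; exact ht.trans_le (min_le_left _ _))
  rw [hn] at h1
  have h2 := (abs_le.1 ((Complex.abs_re_le_norm _).trans h1)).1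
  simp only [Complex.sub_re, Complex.mul_re, Complex.ofReal_re, Complex.ofReal_im] at h2
  have h3 : 0 < (φ t).re := by nlinarith
  rw [← hχ.eq t (by rw [mem_ball_zero_iff, hn]; exact ht.trans_le (min_le_right _ _))] at h3
  have h4 := hG.re_pos_of_image h3
  have hpre : IsPreconnected (χ '' {z : ℂ | 0 < z.re}) :=
    (convex_halfSpace_re_gt 0).isPreconnected.image _ χ.continuous.continuousOn
  by_contra! h5
  have h6 := hpre.image _ Complex.continuous_re.continuousOn
  obtain ⟨_, ⟨w, hw, rfl⟩, hw0⟩ := h6.ordConnected.out ⟨_, ⟨z, hz, rfl⟩, rfl⟩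
    ⟨_, ⟨(t : ℂ), by simpa using ht0, rfl⟩, rfl⟩ ⟨h5, h4.le⟩
  exact (ne_of_gt hw) ((hχ.re_eq_zero_iff hG).1 hw0)

theorem IsUniformization.re_nonneg (hG : IsHalfLift f G) (hχ : IsUniformization G φ a χ)
    {z : ℂ} (hz : 0 ≤ z.re) : 0 ≤ (χ z).re := by
  rcases hz.lt_or_eq with h | h
  · exact (hχ.re_pos hG h).le
  · exact ((hχ.re_eq_zero_iff hG).2 h.symm).ge

theorem IsUniformization.im_pos (hG : IsHalfLift f G) (hχ : IsUniformization G φ a χ)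
    {τ : ℝ} (hτ : |τ| = 1) {t : ℝ} (ht : 0 < t) : 0 < τ * (χ (τ * t * Complex.I)).im := by
  obtain ⟨δ, hδ, h⟩ := hχ.riemann.exists_norm_sub_le
  have ha := hχ.riemann.pos
  have hτ2 : τ * τ = 1 := by rw [← abs_mul_abs_self, hτ, one_mul]
  have hre : ∀ s : ℝ, ((τ : ℂ) * s * Complex.I).re = 0 := fun s => by simp
  obtain ⟨s, hs0, hs⟩ := exists_between (lt_min hδ one_pos)
  have hn : ‖(τ : ℂ) * s * Complex.I‖ = s := by
    rw [norm_mul, norm_mul, Complex.norm_real, Real.norm_eq_abs, hτ, Complex.norm_I, one_mul,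
      mul_one, Complex.norm_of_nonneg hs0.le]
  have h1 := h _ (by rw [hn]; exact hs.trans_le (min_le_left _ _))
  rw [hn] at h1
  have h2 : |τ * (φ (τ * s * Complex.I)).im - a * s| ≤ a / 2 * s := by
    refine le_trans (le_of_eq ?_) ((Complex.abs_im_le_norm _).trans h1)
    have : (φ (τ * s * Complex.I) - a * (τ * s * Complex.I)).im =
      τ * (τ * (φ (τ * s * Complex.I)).im - a * s) := by
      have h3 : (φ (τ * s * Complex.I) - a * (τ * s * Complex.I)).im =
          (φ (τ * s * Complex.I)).im - a * (τ * s) := by simp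
      rw [h3]
      linear_combination -(φ (τ * s * Complex.I)).im * hτ2
    rw [this, abs_mul, hτ, one_mul]
  have h3 : 0 < τ * (φ (τ * s * Complex.I)).im := by
    have := (abs_le.1 h2).1
    nlinarith
  rw [← hχ.eq _ (by rw [mem_ball_zero_iff, hn]; exact hs.trans_le (min_le_right _ _)),
    hG.eq_self _ ((hχ.re_eq_zero_iff hG).2 (hre s))] at h3
  by_contra! h5
  have hc : Continuous fun x : ℝ => τ * (χ (τ * x * Complex.I)).im :=
    continuous_const.mul (Complex.continuous_im.comp (χ.continuous.comp (by fun_prop)))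
  have hpre := isPreconnected_Ioi (a := (0 : ℝ)).image _ hc.continuousOn
  obtain ⟨x, hx, hx0⟩ := hpre.ordConnected.out ⟨t, ht, rfl⟩ ⟨s, hs0, rfl⟩ ⟨h5, h3.le⟩
  have hτ0 : τ ≠ 0 := fun h => by rw [h] at hτ2; simp at hτ2
  have h6 : χ (τ * x * Complex.I) = χ 0 := by
    rw [hχ.zero]
    exact Complex.ext ((hχ.re_eq_zero_iff hG).2 (hre x)) ((mul_eq_zero.1 hx0).resolve_left hτ0)
  have h7 := congrArg Complex.im (χ.injective h6)
  have hx' : (0 : ℝ) < x := hx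
  simp [hτ0, hx'.ne'] at h7

theorem IsUniformization.apply_I (hG : IsHalfLift f G) (hχ : IsUniformization G φ a χ)
    {τ : ℝ} (hτ : |τ| = 1) : χ (τ * Complex.I) = τ * Complex.I := by
  have h1 := hχ.im_pos hG hτ one_pos
  rw [Complex.ofReal_one, mul_one] at h1
  have hn : ‖(τ : ℂ) * Complex.I‖ = 1 := by
    rw [norm_mul, Complex.norm_real, Real.norm_eq_abs, hτ, Complex.norm_I, one_mul]
  have h2 := hχ.norm_eq (τ * Complex.I) hn.ge
  have h3 : (χ (τ * Complex.I)).re = 0 := (hχ.re_eq_zero_iff hG).2 (by simp)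
  rw [hn] at h2
  set y := χ (τ * Complex.I)
  have h4 : y = y.im * Complex.I := Complex.ext (by simp [h3]) (by simp)
  have h5 : |y.im| = 1 := by
    rw [h4, norm_mul, Complex.norm_real, Real.norm_eq_abs, Complex.norm_I, mul_one] at h2
    exact h2
  have h6 : τ * y.im = 1 := by rw [← abs_of_pos h1, abs_mul, hτ, h5, one_mul]
  have hτ2 : τ * τ = 1 := by rw [← abs_mul_abs_self, hτ, one_mul]
  have h7 : y.im = τ := by
    calc y.im = τ * τ * y.im := by rw [hτ2, one_mul]
      _ = τ := by rw [mul_assoc, h6, mul_one]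
  rw [h4, h7]

theorem IsUniformization.norm_symm_lt (hχ : IsUniformization G φ a χ) {z : ℂ} (hz : ‖z‖ < 1) :
    ‖χ.symm z‖ < 1 := by
  by_contra! h
  have := hχ.norm_eq _ h
  rw [χ.apply_symm_apply] at this
  linarith

theorem IsUniformization.norm_le (hχ : IsUniformization G φ a χ) {z : ℂ} (hz : ‖z‖ ≤ 1) :
    ‖χ z‖ ≤ 1 := by
  rcases hz.lt_or_eq with h | h
  · exact (hχ.norm_lt z h).le
  · exact (hχ.norm_eq z h.ge).le.trans h.le

theorem norm_shrink_lt {w : ℂ} (hw : ‖w‖ ≤ 1) : ‖shrink w‖ < 1 := by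
  rw [norm_shrink]
  have h1 : Real.exp (-Real.pi) < 1 := Real.exp_lt_one_iff.2 (by linarith [Real.pi_pos])
  have h2 := Real.exp_pos (-Real.pi)
  nlinarith [norm_nonneg w]

theorem IsUniformization.norm_conj_shrink_lt (hG : IsHalfLift f G)
    (hχ : IsUniformization G φ a χ) {z : ℂ} (hz : ‖z‖ ≤ 1) (hz0 : z ≠ 0) :
    ‖χ.symm (shrink (χ z))‖ < ‖z‖ := by
  have hlt : ∀ z : ℂ, ‖z‖ ≤ 1 → ‖χ.symm (shrink (χ z))‖ < 1 := fun z hz =>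
    hχ.norm_symm_lt (norm_shrink_lt (hχ.norm_le hz))
  rcases hz.lt_or_eq with hz1 | hz1
  swap
  · rw [hz1]; exact hlt z hz
  obtain ⟨x, hx, hmax⟩ := (isCompact_closedBall (0 : ℂ) 1).exists_isMaxOn
    ⟨0, mem_closedBall_self zero_le_one⟩
    (f := fun z => ‖χ.symm (shrink (χ z))‖)
    (continuous_norm.comp (χ.symm.continuous.comp
      (continuous_shrink.comp χ.continuous))).continuousOn
  set R := ‖χ.symm (shrink (χ x))‖
  have hR : R < 1 := hlt x (mem_closedBall_zero_iff.1 hx)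
  obtain ⟨ψ, hψd, hψm, hψl, hψr, hψ0⟩ := hχ.riemann.exists_inverse
  have hconj : ∀ w ∈ ball (0 : ℂ) 1, (starRingEnd ℂ) w ∈ ball (0 : ℂ) 1 := fun w hw => by
    rwa [mem_ball_zero_iff, RCLike.norm_conj, ← mem_ball_zero_iff]
  have hform : ∀ w ∈ ball (0 : ℂ) 1, shrink (φ w) ∈ G '' ball 0 1 ∧
      χ.symm (shrink (χ w)) = ψ (shrink (φ w)) := by
    intro w hw
    have h1 : shrink (φ w) = G (shrink (χ w)) := by rw [hG.shrink, hχ.eq w hw]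
    have h2 := norm_shrink_lt (hχ.norm_le (mem_ball_zero_iff.1 hw).le)
    have h3 := mem_ball_zero_iff.2 (hχ.norm_symm_lt h2)
    refine ⟨h1 ▸ ⟨_, mem_ball_zero_iff.2 h2, rfl⟩, ?_⟩
    rw [← hψl _ h3, ← hχ.eq _ h3, χ.apply_symm_apply, h1]
  let H : ℂ → ℂ := fun w => ψ (shrink (φ ((starRingEnd ℂ) w)))
  have hHd : DifferentiableOn ℂ H (ball 0 1) := by
    refine hψd.comp (f := fun w => shrink (φ ((starRingEnd ℂ) w))) ?_
      fun w hw => (hform _ (hconj w hw)).1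
    intro w hw
    have h1 : DifferentiableAt ℂ φ ((starRingEnd ℂ) w) :=
      hχ.riemann.diff.differentiableAt (isOpen_ball.mem_nhds (hconj w hw))
    have h2 := h1.conj_conj
    rw [Complex.conj_conj] at h2
    exact (h2.const_mul _).differentiableWithinAt
  have hHn : ∀ w ∈ ball (0 : ℂ) 1, ‖H w‖ ≤ R := fun w hw => by
    have h1 := hconj w hw
    change ‖ψ _‖ ≤ R
    rw [← (hform _ h1).2]
    exact hmax (ball_subset_closedBall h1)
  have hH0 : H 0 = 0 := by
    change ψ (shrink (φ ((starRingEnd ℂ) 0))) = 0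
    rw [map_zero, hχ.riemann.zero, shrink, map_zero, mul_zero, hψ0]
  have hzb : z ∈ ball (0 : ℂ) 1 := mem_ball_zero_iff.2 hz1
  have h1 := Complex.dist_le_div_mul_dist_of_mapsTo_ball hHd (R₂ := R)
    (fun w hw => by rw [hH0]; exact mem_closedBall_zero_iff.2 (hHn w hw)) (hconj z hzb)
  rw [hH0, dist_zero_right, dist_zero_right, div_one, RCLike.norm_conj] at h1
  have h2 : H ((starRingEnd ℂ) z) = χ.symm (shrink (χ z)) := by
    rw [(hform z hzb).2]
    change ψ (shrink (φ ((starRingEnd ℂ) ((starRingEnd ℂ) z)))) = _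
    rw [Complex.conj_conj]
  rw [← h2]
  have h3 := norm_pos_iff.2 hz0
  nlinarith

theorem IsUniformization.eq_of_logMap_eq (hG : IsHalfLift f G) (hχ : IsUniformization G φ a χ)
    {z w : ℂ} (hz0 : z ≠ 0) (hz : ‖z‖ ≤ 1) (hzw : ‖z‖ = ‖w‖)
    (h : logMap (χ z) = logMap (χ w)) : z = w := by
  have key : ∀ z w : ℂ, z ≠ 0 → ‖z‖ ≤ 1 → ‖z‖ = ‖w‖ →
      ∀ n : ℕ, χ w = shrink^[n] (χ z) → z = w := by
    intro z w hz0 hz hzw n hn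
    rcases Nat.eq_zero_or_pos n with h0 | h0
    · rw [h0] at hn; exact (χ.injective hn).symm
    · have h1 : ∀ n : ℕ, χ.symm (shrink^[n] (χ z)) ≠ 0 ∧ ‖χ.symm (shrink^[n] (χ z))‖ ≤ ‖z‖ ∧
          (0 < n → ‖χ.symm (shrink^[n] (χ z))‖ < ‖z‖) := by
        intro n
        induction n with
        | zero => simpa using hz0
        | succ n ih =>
          obtain ⟨ih0, ih1, -⟩ := ih
          have h2 := hχ.norm_conj_shrink_lt hG (ih1.trans hz) ih0
          rw [χ.apply_symm_apply] at h2
          rw [Function.iterate_succ_apply']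
          refine ⟨fun h3 => ?_, (h2.trans_le ih1).le, fun _ => h2.trans_le ih1⟩
          have h4 := congrArg χ h3
          rw [χ.apply_symm_apply, hχ.zero] at h4
          have h5 : ‖shrink (shrink^[n] (χ z))‖ = 0 := by rw [h4, norm_zero]
          rw [norm_shrink, mul_eq_zero] at h5
          have h6 := norm_eq_zero.1 (h5.resolve_left (Real.exp_pos _).ne')
          apply ih0
          rw [h6, Homeomorph.symm_apply_eq, hχ.zero]
      have h2 := (h1 n).2.2 h0
      rw [← hn, χ.symm_apply_apply] at h2
      linarith
  have hne : ∀ v : ℂ, v ≠ 0 → χ v ≠ 0 := fun v hv h => hv (χ.injective (h.trans hχ.zero.symm))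
  have hw0 : w ≠ 0 := by rw [← norm_pos_iff, ← hzw]; exact norm_pos_iff.2 hz0
  obtain ⟨n, hn | hn⟩ := exists_iterate_of_logMap_eq (hne z hz0) (hne w hw0) h
  · exact key z w hz0 hz hzw n hn
  · exact (key w z hw0 (hzw ▸ hz) hzw.symm n hn).symm

end Symmetry

section FixChord

open Set Filter Topology Metric

theorem apply_eq_of_mem_rimCircle {f : RP2 ≃ₜ RP2}
    (hf : ∀ z : ℂ, ‖z‖ ≤ Real.exp (-(Real.pi / 2)) → f (planeMap z) = planeMap z) {x : RP2}
    (hx : x ∈ rimCircle) : f x = x := by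
  have key : ∀ ζ : ℂ, ζ.re = -(Real.pi / 2) → f (expMap ζ) = expMap ζ := fun ζ h =>
    hf _ (by rw [Complex.norm_exp, h])
  obtain ⟨ζ, h, rfl⟩ := hx
  rcases (abs_eq (by positivity)).1 h with h | h
  · rw [← expMap_glide]
    exact key _ (by rw [glide_re, h])
  · exact key _ h

/-- The right half of the unit circle. -/
def halfCircle : Set ℂ := sphere 0 1 ∩ {w | 0 ≤ w.re}

theorem isCompact_halfCircle : IsCompact halfCircle :=
  (isCompact_sphere 0 1).inter_right (isClosed_le continuous_const Complex.continuous_re)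

theorem norm_of_mem_halfCircle {j : ℂ} (hj : j ∈ halfCircle) : ‖j‖ = 1 :=
  mem_sphere_zero_iff_norm.1 hj.1

theorem ne_zero_of_mem_halfCircle {j : ℂ} (hj : j ∈ halfCircle) : j ≠ 0 := fun h => by
  have := norm_of_mem_halfCircle hj
  rw [h, norm_zero] at this
  exact zero_ne_one this

theorem norm_ofReal_mul_halfCircle {r : ℝ} (hr : 0 < r) {j : ℂ} (hj : j ∈ halfCircle) :
    ‖(r : ℂ) * j‖ = r := by
  rw [norm_mul, Complex.norm_of_nonneg hr.le, norm_of_mem_halfCircle hj, mul_one]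

theorem mul_re_nonneg_of_mem_halfCircle {r : ℝ} (hr : 0 < r) {j : ℂ} (hj : j ∈ halfCircle) :
    0 ≤ ((r : ℂ) * j).re := by
  rw [Complex.re_ofReal_mul]; exact mul_nonneg hr.le hj.2

theorem mul_ne_zero_of_mem_halfCircle {r : ℝ} (hr : 0 < r) {j : ℂ} (hj : j ∈ halfCircle) :
    (r : ℂ) * j ≠ 0 :=
  mul_ne_zero (by exact_mod_cast hr.ne') (ne_zero_of_mem_halfCircle hj)

theorem mul_mem_slitPlane {r : ℝ} (hr : 0 < r) {w : ℂ} (hw : w ∈ Complex.slitPlane) :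
    (r : ℂ) * w ∈ Complex.slitPlane := by
  rw [Complex.mem_slitPlane_iff] at hw ⊢
  rw [Complex.re_ofReal_mul, Complex.im_ofReal_mul]
  exact hw.imp (mul_pos hr) (mul_ne_zero hr.ne')

theorem logMap_of_norm_one {w : ℂ} (hw : ‖w‖ = 1) : logMap w = expMap (w.arg : ℝ) := by
  rw [logMap]
  congr 1
  exact Complex.ext (by rw [stripLog_re, Complex.ofReal_re])
    (by rw [stripLog_im, hw, Real.log_one, neg_zero, Complex.ofReal_im])

theorem injOn_logMap_mul_halfCircle {r : ℝ} (hr : 0 < r) :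
    InjOn (fun j : ℂ => logMap (r * j)) halfCircle := by
  intro i hi j hj h
  have hm : ∀ j ∈ halfCircle, (r : ℂ) * j ∈ Complex.slitPlane := fun j hj =>
    mem_slitPlane_of_re_nonneg (mul_re_nonneg_of_mem_halfCircle hr hj)
      (mul_ne_zero_of_mem_halfCircle hr hj)
  refine mul_left_cancel₀ (by exact_mod_cast hr.ne' : (r : ℂ) ≠ 0)
    (eq_of_logMap_eq (hm i hi) (hm j hj) h ?_)
  rw [norm_ofReal_mul_halfCircle hr hi, norm_ofReal_mul_halfCircle hr hj, sub_self, abs_zero]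
  exact Real.pi_pos

theorem exists_isotopy_expMap_segment {κ : ℝ → ℝ}
    (hκ : ContinuousOn κ (Icc (-(Real.pi / 2)) (Real.pi / 2)))
    (hκm : StrictMonoOn κ (Icc (-(Real.pi / 2)) (Real.pi / 2)))
    (hκ0 : κ (-(Real.pi / 2)) = -(Real.pi / 2)) (hκ1 : κ (Real.pi / 2) = Real.pi / 2) :
    ∃ g ∈ isotopyGroup RP2,
      (∀ x ∈ Icc (-(Real.pi / 2)) (Real.pi / 2), g (expMap (x : ℝ)) = expMap (κ x : ℝ)) ∧
      (∀ x ∈ rimCircle, g x = x) ∧ g (planeMap 0) = planeMap 0 := by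
  have hpi := Real.pi_gt_three
  have hinj : ∀ x ∈ Icc (-(Real.pi / 2)) (Real.pi / 2) ×ℂ Icc (-1) 1,
      ∀ y ∈ Icc (-(Real.pi / 2)) (Real.pi / 2) ×ℂ Icc (-1) 1, expMap x = expMap y → x = y := by
    intro x hx y hy h
    refine eq_of_expMap_eq h ?_
    have h1 : x.im ∈ Icc (-1 : ℝ) 1 := hx.2
    have h2 : y.im ∈ Icc (-1 : ℝ) 1 := hy.2
    rw [abs_lt]
    constructor <;> linarith [h1.1, h1.2, h2.1, h2.2]
  have hsub : Ioo (-(Real.pi / 2)) (Real.pi / 2) ×ℂ Ioo (-1) 1 ⊆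
      Icc (-(Real.pi / 2)) (Real.pi / 2) ×ℂ Icc (-1) 1 := fun z hz =>
    ⟨Ioo_subset_Icc_self hz.1, Ioo_subset_Icc_self hz.2⟩
  obtain ⟨g, hg, h1, -, h3⟩ := exists_isotopy_twist (B := expMap) (x₀ := -(Real.pi / 2))
    (x₁ := Real.pi / 2) (δ := 1) (by linarith) one_pos continuous_expMap.continuousOn
    (fun x hx y hy => hinj x (hsub hx) y (hsub hy))
    (isOpenMap_expMap _ (isOpen_Ioo.reProdIm isOpen_Ioo))
    (fun x hx y hy hy' h => hy' (hinj x (hsub hx) y hy h ▸ hx)) hκ hκm hκ0 hκ1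
  refine ⟨g, hg, h1, fun x hx => h3 x ?_, h3 _ ?_⟩
  · rintro ⟨ζ, hζ, rfl⟩
    rw [expMap_mem_rimCircle] at hx
    exact (abs_lt.2 hζ.1).ne hx
  · rintro ⟨ζ, -, h⟩
    exact expMap_ne ζ h

theorem exists_isotopy_halfCircle {f : RP2 ≃ₜ RP2} {G : ℂ ≃ₜ ℂ} {φ : ℂ → ℂ} {a : ℝ} {χ : ℂ ≃ₜ ℂ}
    (hG : IsHalfLift f G) (hχ : IsUniformization G φ a χ) :
    ∃ g ∈ isotopyGroup RP2, (∀ j ∈ halfCircle, g (logMap j) = logMap (χ j)) ∧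
      (∀ x ∈ rimCircle, g x = x) ∧ g (planeMap 0) = planeMap 0 := by
  have hpi := Real.pi_pos
  have hnorm : ∀ x : ℝ, ‖Complex.exp (Complex.I * x)‖ = 1 := fun x => by
    rw [mul_comm, Complex.norm_exp_ofReal_mul_I]
  have hnorm' : ∀ j : ℂ, ‖j‖ = 1 → ‖χ j‖ = 1 := fun j hj => by rw [hχ.norm_eq j hj.ge, hj]
  have hre : ∀ x ∈ Icc (-(Real.pi / 2)) (Real.pi / 2), 0 ≤ (Complex.exp (Complex.I * (x : ℝ))).re := by
    intro x hx
    rw [Complex.exp_re]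
    simpa using Real.cos_nonneg_of_mem_Icc hx
  have hslit : ∀ x ∈ Icc (-(Real.pi / 2)) (Real.pi / 2),
      χ (Complex.exp (Complex.I * (x : ℝ))) ∈ Complex.slitPlane := fun x hx =>
    mem_slitPlane_of_re_nonneg (hχ.re_nonneg hG (hre x hx)) fun h => by
      have := hnorm' _ (hnorm x)
      rw [h, norm_zero] at this
      exact zero_ne_one this
  let κ : ℝ → ℝ := fun x => (χ (Complex.exp (Complex.I * x))).arg
  have hκ : ContinuousOn κ (Icc (-(Real.pi / 2)) (Real.pi / 2)) := fun x hx => by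
    have h1 : ContinuousAt (fun x : ℝ => χ (Complex.exp (Complex.I * x))) x :=
      (χ.continuous.comp (by fun_prop)).continuousAt
    exact (ContinuousAt.comp (f := fun x : ℝ => χ (Complex.exp (Complex.I * x)))
      (Complex.continuousAt_arg (hslit x hx)) h1).continuousWithinAt
  have hI1 : Complex.exp (Complex.I * (Real.pi / 2 : ℝ)) = ((1 : ℝ) : ℂ) * Complex.I := by
    rw [mul_comm]; push_cast; rw [Complex.exp_pi_div_two_mul_I, one_mul]
  have hI2 : Complex.exp (Complex.I * (-(Real.pi / 2) : ℝ)) = ((-1 : ℝ) : ℂ) * Complex.I := by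
    rw [mul_comm]; push_cast; rw [← neg_div, Complex.exp_neg_pi_div_two_mul_I]; ring
  have hκ1 : κ (Real.pi / 2) = Real.pi / 2 := by
    simp only [κ]
    rw [hI1, hχ.apply_I hG (by norm_num), Complex.ofReal_one, one_mul, Complex.arg_I]
  have hκ0 : κ (-(Real.pi / 2)) = -(Real.pi / 2) := by
    simp only [κ]
    rw [hI2, hχ.apply_I hG (by norm_num), Complex.ofReal_neg, Complex.ofReal_one, neg_one_mul,
      Complex.arg_neg_I]
  have hκi : InjOn κ (Icc (-(Real.pi / 2)) (Real.pi / 2)) := by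
    intro x hx y hy h
    have h1 := χ.injective (Complex.ext_norm_arg
      ((hnorm' _ (hnorm x)).trans (hnorm' _ (hnorm y)).symm) h)
    have h2 := congrArg stripLog h1
    have h3 : ∀ x ∈ Icc (-(Real.pi / 2)) (Real.pi / 2),
        stripLog (Complex.exp (Complex.I * (x : ℝ))) = (x : ℝ) := fun x hx =>
      stripLog_exp_I_mul (by rw [Complex.ofReal_re]; linarith [hx.1])
        (by rw [Complex.ofReal_re]; linarith [hx.2])
    rw [h3 x hx, h3 y hy] at h2
    exact_mod_cast h2
  obtain ⟨g, hg, h1, h2, h3⟩ := exists_isotopy_expMap_segment hκ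
    (hκ.strictMonoOn_of_injOn_Icc (by linarith) (by rw [hκ0, hκ1]; linarith) hκi) hκ0 hκ1
  refine ⟨g, hg, fun j hj => ?_, h2, h3⟩
  have hj1 := norm_of_mem_halfCircle hj
  have h4 := abs_le.1 (Complex.abs_arg_le_pi_div_two_iff.2 hj.2)
  have h5 : Complex.exp (Complex.I * j.arg) = j := by
    have := Complex.norm_mul_exp_arg_mul_I j
    rwa [hj1, Complex.ofReal_one, one_mul, mul_comm] at this
  rw [logMap_of_norm_one hj1, h1 _ h4, logMap_of_norm_one (hnorm' j hj1)]
  simp only [κ, h5]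

theorem exists_fix_chord {f : RP2 ≃ₜ RP2}
    (hf : ∀ z : ℂ, ‖z‖ ≤ Real.exp (-(Real.pi / 2)) → f (planeMap z) = planeMap z) :
    ∃ e : RP2 ≃ₜ RP2, (e ∈ isotopyGroup RP2 → f ∈ isotopyGroup RP2) ∧
      (∀ x ∈ Icc (-(Real.pi / 2)) (Real.pi / 2), e (expMap (x : ℝ)) = expMap (x : ℝ)) ∧
      e (planeMap 0) = planeMap 0 ∧ ∀ x ∈ rimCircle, e x ∈ rimCircle := by
  obtain ⟨F, hF, hF'⟩ := exists_homeomorph_isExpLift hf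
  obtain ⟨G, hG⟩ := exists_isHalfLift hF hF'
  obtain ⟨φ, a, χ, hχ⟩ := exists_isUniformization hG.isDiscChart
  obtain ⟨k, hk, hkj, hkT, hk0⟩ := exists_isotopy_halfCircle hG hχ
  have ha := hχ.riemann.pos
  have hpi := Real.pi_gt_three
  have hrim : ∀ x, f x ∈ rimCircle ↔ x ∈ rimCircle := fun x =>
    ⟨fun h => by rwa [f.injective (apply_eq_of_mem_rimCircle hf h)] at h,
      fun h => by rwa [apply_eq_of_mem_rimCircle hf h]⟩
  have hf0 : f (planeMap 0) = planeMap 0 := hf 0 (by simpa using Real.exp_nonneg _)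
  -- linearization near the origin
  obtain ⟨r₂, hr₂, hlin⟩ := exists_isotopy_linearize (B := logMap) (W := Complex.slitPlane)
    (J := halfCircle) (O := {w : ℂ | 1 / 2 < ‖w‖ ∧ ‖w‖ < 2} ∩ Complex.slitPlane) (φ := φ) (a := a)
    (ρ := 1) (r₁ := 1) continuousOn_logMap isOpen_image_logMap isCompact_halfCircle
    (((isOpen_lt continuous_const continuous_norm).inter
      (isOpen_lt continuous_norm continuous_const)).inter Complex.isOpen_slitPlane)
    (fun j hj => by
      have := norm_of_mem_halfCircle hj
      refine ⟨?_, mem_slitPlane_of_re_nonneg hj.2 (ne_zero_of_mem_halfCircle hj)⟩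
      simp only [mem_ofPred_eq, this]; norm_num)
    ha one_pos hχ.riemann.diff hχ.riemann.zero hχ.riemann.deriv_zero one_pos
    (by
      intro r hr z hz w hw hzw
      have hr' : (r : ℂ) ≠ 0 := by exact_mod_cast hr.1.ne'
      refine mul_left_cancel₀ hr' (eq_of_logMap_eq (mul_mem_slitPlane hr.1 hz.2)
        (mul_mem_slitPlane hr.1 hw.2) hzw ?_)
      have hlog : ∀ w : ℂ, (1 / 2 < ‖w‖ ∧ ‖w‖ < 2) →
          Real.log ‖(r : ℂ) * w‖ - Real.log r ∈ Ioo (-1 : ℝ) 1 := by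
        intro w hw
        have hw0 : 0 < ‖w‖ := lt_trans (by norm_num) hw.1
        rw [norm_mul, Complex.norm_of_nonneg hr.1.le, Real.log_mul hr.1.ne' hw0.ne',
          add_sub_cancel_left]
        have h2 : Real.log 2 < 1 := by linarith [Real.log_two_lt_d9]
        have h3 := Real.log_lt_log hw0 hw.2
        have h4 := Real.log_lt_log (by norm_num) hw.1
        rw [one_div, Real.log_inv] at h4
        constructor <;> linarith
      have h1 := hlog z hz.1
      have h2 := hlog w hw.1
      rw [abs_lt]
      constructor <;> linarith [h1.1, h1.2, h2.1, h2.2])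
    (fun r hr w hw => mul_mem_slitPlane hr.1 hw.2)
  set r₀ := min r₂ (min (1 / 2) (1 / a)) with hr₀
  have hr₀0 : 0 < r₀ := by positivity
  have hr₀2 : r₀ ≤ r₂ := min_le_left _ _
  have hr₀1 : r₀ ≤ 1 / 2 := (min_le_right _ _).trans (min_le_left _ _)
  have hr₀a : r₀ * a ≤ 1 := by
    have : r₀ ≤ 1 / a := (min_le_right _ _).trans (min_le_right _ _)
    rwa [le_div_iff₀ ha] at this
  obtain ⟨g₂, hg₂, hg₂s, hg₂T⟩ := hlin r₀ ⟨hr₀0, hr₀2⟩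
  have hg₂0 : g₂ (planeMap 0) = planeMap 0 := by
    refine hg₂T {planeMap 0} ⊥ ?_ ?_ _ rfl
    · intro w hw
      rw [mem_singleton_iff, Submodule.mem_bot]
      exact iff_of_false (logMap_ne w) (Complex.slitPlane_ne_zero hw)
    · intro w hw _
      rw [Submodule.mem_bot] at hw ⊢
      rw [hw, hχ.riemann.zero]
  have hg₂r : ∀ x ∈ rimCircle, g₂ x ∈ rimCircle := by
    refine hg₂T rimCircle (LinearMap.ker Complex.reLm) ?_ ?_
    · intro w hw
      rw [logMap_mem_rimCircle (Complex.slitPlane_ne_zero hw), LinearMap.mem_ker]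
      rfl
    · intro w hw h
      have hw : w.re = 0 := hw
      change (φ w).re = 0
      rw [← axisRefl_eq_self_iff, ← hχ.conformal_axisRefl hG (mem_ball_zero_iff.2 h),
        axisRefl_eq_self_iff.2 hw]
  -- the slide along radii
  obtain ⟨g₃, hg₃, hg₃s, hg₃T⟩ := exists_isotopy_slide (B := logMap) (W := Complex.slitPlane)
    (J := halfCircle) Complex.isOpen_slitPlane continuousOn_logMap isOpen_image_logMap
    (fun z hz => by
      obtain ⟨V, hV, -, h⟩ := exists_nhds_injOn_logMap hz
      exact ⟨V, hV, h⟩) isCompact_halfCircle (mul_pos hr₀0 ha) hr₀a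
    (fun r hr j hj => mem_slitPlane_of_re_nonneg
      (mul_re_nonneg_of_mem_halfCircle ((mul_pos hr₀0 ha).trans_le hr.1) hj)
      (mul_ne_zero_of_mem_halfCircle ((mul_pos hr₀0 ha).trans_le hr.1) hj))
    (fun r hr => injOn_logMap_mul_halfCircle ((mul_pos hr₀0 ha).trans_le hr.1))
  have hg₃0 : g₃ (planeMap 0) = planeMap 0 :=
    (hg₃T {planeMap 0} (fun w _ s _ _ h => absurd h (logMap_ne w)) _).2 rfl
  have hg₃r : ∀ x, g₃ x ∈ rimCircle ↔ x ∈ rimCircle := by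
    refine hg₃T rimCircle fun w hw s hs hsw h => ?_
    rw [logMap_mem_rimCircle (Complex.slitPlane_ne_zero hw)] at h
    rw [logMap_mem_rimCircle (Complex.slitPlane_ne_zero hsw), Complex.re_ofReal_mul, h, mul_zero]
  -- the slide along the images of radii
  have hWo : IsOpen (χ ⁻¹' Complex.slitPlane) := Complex.isOpen_slitPlane.preimage χ.continuous
  have hne : ∀ z : ℂ, z ≠ 0 → χ z ≠ 0 := fun z hz h => hz (χ.injective (h.trans hχ.zero.symm))
  have hrw : ∀ w ∈ χ ⁻¹' Complex.slitPlane, f (logMap (χ w)) ∈ rimCircle ↔ w.re = 0 := by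
    intro w hw
    rw [hrim, logMap_mem_rimCircle (Complex.slitPlane_ne_zero hw), hχ.re_eq_zero_iff hG]
  have hpos : ∀ s ∈ Icc r₀ 1, 0 < s := fun s hs => hr₀0.trans_le hs.1
  obtain ⟨g₁, hg₁, hg₁s, hg₁T⟩ := exists_isotopy_slide (B := fun z => f (logMap (χ z)))
    (W := χ ⁻¹' Complex.slitPlane) (J := halfCircle) hWo
    (f.continuous.comp_continuousOn (continuousOn_logMap.comp χ.continuous.continuousOn
      fun _ h => h))
    (fun V hV hVo => by
      have h1 := f.isOpenMap _ (isOpen_image_logMap (χ '' V)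
        (image_subset_iff.2 hV) (χ.isOpenMap _ hVo))
      rwa [image_image, image_image] at h1)
    (fun z hz => by
      obtain ⟨V, hV, -, h⟩ := exists_nhds_injOn_logMap hz
      exact ⟨χ ⁻¹' V, χ.continuous.continuousAt hV, fun x hx y hy hxy =>
        χ.injective (h hx hy (f.injective hxy))⟩) isCompact_halfCircle hr₀0
    (by linarith)
    (fun s hs j hj => mem_slitPlane_of_re_nonneg
      (hχ.re_nonneg hG (mul_re_nonneg_of_mem_halfCircle (hpos s hs) hj))
      (hne _ (mul_ne_zero_of_mem_halfCircle (hpos s hs) hj)))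
    (fun s hs i hi j hj hij => by
      have hs' : (s : ℂ) ≠ 0 := by exact_mod_cast (hpos s hs).ne'
      have hni := norm_ofReal_mul_halfCircle (hpos s hs) hi
      have hnj := norm_ofReal_mul_halfCircle (hpos s hs) hj
      exact mul_left_cancel₀ hs' (hχ.eq_of_logMap_eq hG
        (mul_ne_zero_of_mem_halfCircle (hpos s hs) hi) (hni.le.trans hs.2) (hni.trans hnj.symm)
        (f.injective hij)))
  have hg₁0 : g₁ (planeMap 0) = planeMap 0 := by
    refine (hg₁T {planeMap 0} (fun w _ s _ _ h => ?_) _).2 rfl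
    have h : f (logMap (χ w)) = planeMap 0 := h
    rw [← hf0] at h
    exact absurd (f.injective h) (logMap_ne _)
  have hg₁r : ∀ x, g₁ x ∈ rimCircle ↔ x ∈ rimCircle := by
    refine hg₁T rimCircle fun w hw s hs hsw h => ?_
    rw [hrw w hw] at h
    rw [hrw _ hsw, Complex.re_ofReal_mul, h, mul_zero]
  have hgf : g₃⁻¹ * (g₂⁻¹ * g₁) ∈ isotopyGroup RP2 :=
    mul_mem (inv_mem hg₃) (mul_mem (inv_mem hg₂) hg₁)
  refine ⟨(g₃⁻¹ * (g₂⁻¹ * g₁) * f * k)⁻¹, fun he => ?_, fun x hx => ?_, ?_, fun x hx => ?_⟩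
  · rwa [inv_mem_iff, Subgroup.mul_mem_cancel_right _ hk, Subgroup.mul_mem_cancel_left _ hgf] at he
  · refine (Homeomorph.symm_apply_eq (g₃⁻¹ * (g₂⁻¹ * g₁) * f * k)).2 ?_
    obtain ⟨j, hjx⟩ : ∃ j : ℂ, j = Complex.exp (Complex.I * x) := ⟨_, rfl⟩
    have hj1 : ‖j‖ = 1 := by rw [hjx, mul_comm, Complex.norm_exp_ofReal_mul_I]
    have hj : j ∈ halfCircle := by
      refine ⟨mem_sphere_zero_iff_norm.2 hj1, ?_⟩
      rw [mem_ofPred_eq, hjx, Complex.exp_re]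
      simpa using Real.cos_nonneg_of_mem_Icc hx
    have hx' : expMap (x : ℝ) = logMap j := by
      rw [logMap, hjx, stripLog_exp_I_mul]
      · rw [Complex.ofReal_re]; linarith [hx.1]
      · rw [Complex.ofReal_re]; linarith [hx.2]
    have e1 : g₁ (f (logMap (χ j))) = logMap (φ (r₀ * j)) := by
      have h1 := hg₁s j hj
      simp only [Complex.ofReal_one, one_mul] at h1
      have hlt : ‖(r₀ : ℂ) * j‖ < 1 := by
        rw [norm_ofReal_mul_halfCircle hr₀0 hj]
        linarith
      rw [h1, ← hχ.eq _ (mem_ball_zero_iff.2 hlt), hG.lift _ (hχ.re_nonneg hG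
        (mul_re_nonneg_of_mem_halfCircle hr₀0 hj)) (hne _ (mul_ne_zero_of_mem_halfCircle hr₀0 hj))]
    have e2 : g₂⁻¹ (logMap (φ (r₀ * j))) = logMap ((r₀ * a : ℝ) * j) :=
      (Homeomorph.symm_apply_eq g₂).2 (hg₂s j hj).symm
    have e3 : g₃⁻¹ (logMap ((r₀ * a : ℝ) * j)) = logMap j := by
      have h1 := hg₃s j hj
      rw [Complex.ofReal_one, one_mul] at h1
      exact (Homeomorph.symm_apply_eq g₃).2 h1.symm
    simp only [Homeomorph.mul_apply]
    rw [hx', hkj j hj, e1, e2, e3]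
  · refine (Homeomorph.symm_apply_eq (g₃⁻¹ * (g₂⁻¹ * g₁) * f * k)).2 ?_
    have e2 : g₂⁻¹ (planeMap 0) = planeMap 0 := (Homeomorph.symm_apply_eq g₂).2 hg₂0.symm
    have e3 : g₃⁻¹ (planeMap 0) = planeMap 0 := (Homeomorph.symm_apply_eq g₃).2 hg₃0.symm
    simp only [Homeomorph.mul_apply]
    rw [hk0, hf0, hg₁0, e2, e3]
  · have h1 : g₂ (g₃ x) ∈ rimCircle := hg₂r _ ((hg₃r x).2 hx)
    have h2 : g₁⁻¹ (g₂ (g₃ x)) ∈ rimCircle :=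
      (hg₁r _).1 (by rwa [show g₁ (g₁⁻¹ (g₂ (g₃ x))) = _ from g₁.apply_symm_apply _])
    convert h2 using 1
    refine (Homeomorph.symm_apply_eq (g₃⁻¹ * (g₂⁻¹ * g₁) * f * k)).2 ?_
    simp only [Homeomorph.mul_apply]
    rw [hkT _ h2, apply_eq_of_mem_rimCircle hf h2,
      show g₁ (g₁⁻¹ (g₂ (g₃ x))) = _ from g₁.apply_symm_apply _,
      show g₂⁻¹ (g₂ (g₃ x)) = _ from g₂.symm_apply_apply _]
    exact (g₃.symm_apply_apply x).symm

end FixChord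

section Rectangle

open Set Filter Topology Metric

theorem exp_neg_pi_div_two_lt_one : Real.exp (-(Real.pi / 2)) < 1 :=
  Real.exp_lt_one_iff.2 (by linarith [Real.pi_pos])

theorem mem_rimCircle_iff {x : RP2} :
    x ∈ rimCircle ↔ ∃ j ∈ sphere (0 : ℂ) 1, planeMap (Real.exp (-(Real.pi / 2)) * j) = x := by
  constructor
  · rintro ⟨ζ, hζ, rfl⟩
    wlog h : ζ.re = -(Real.pi / 2) generalizing ζ
    · have h1 : ζ.re = Real.pi / 2 := by
        rcases abs_choice ζ.re with h2 | h2 <;> rw [h2] at hζ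
        · exact hζ
        · exact absurd (by linarith) h
      rw [← expMap_glide]
      exact this (glide ζ) (by rw [glide_re, abs_neg]; exact hζ) (by rw [glide_re, h1])
    refine ⟨Complex.exp (ζ.im * Complex.I), mem_sphere_zero_iff_norm.2
      (Complex.norm_exp_ofReal_mul_I _), ?_⟩
    rw [Complex.ofReal_exp, ← Complex.exp_add, ← h, Complex.re_add_im]
    rfl
  · rintro ⟨j, hj, rfl⟩
    refine ⟨(-(Real.pi / 2) : ℝ) + j.arg * Complex.I, ?_, ?_⟩
    · simp only [Complex.add_re, Complex.ofReal_re, Complex.re_ofReal_mul, Complex.I_re, mul_zero,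
        add_zero, abs_neg]
      exact abs_of_pos (by linarith [Real.pi_pos])
    · have h1 := Complex.norm_mul_exp_arg_mul_I j
      rw [mem_sphere_zero_iff_norm.1 hj, Complex.ofReal_one, one_mul] at h1
      rw [expMap, Complex.exp_add, h1, Complex.ofReal_exp]

theorem exists_fix_disc_chord {f : RP2 ≃ₜ RP2}
    (hf : ∀ z : ℂ, ‖z‖ ≤ Real.exp (-(Real.pi / 2)) → f (planeMap z) = planeMap z) :
    ∃ e : RP2 ≃ₜ RP2, (e ∈ isotopyGroup RP2 → f ∈ isotopyGroup RP2) ∧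
      (∀ z : ℂ, ‖z‖ ≤ Real.exp (-(Real.pi / 2)) → e (planeMap z) = planeMap z) ∧
      ∀ x ∈ Icc (-(Real.pi / 2)) (Real.pi / 2), e (expMap (x : ℝ)) = expMap (x : ℝ) := by
  obtain ⟨e, hef, he, he0, heT⟩ := exists_fix_chord hf
  have hpi := Real.pi_pos
  have hr1 := exp_neg_pi_div_two_lt_one
  have hr0 := Real.exp_pos (-(Real.pi / 2))
  have hchord : ∀ x : ℝ, expMap x = planeMap (Real.exp x : ℝ) := fun x => by
    rw [expMap, Complex.ofReal_exp]
  have hend : e (planeMap (Real.exp (-(Real.pi / 2)) * 1)) =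
      planeMap (Real.exp (-(Real.pi / 2)) * 1) := by
    rw [mul_one, ← hchord]
    exact he _ ⟨le_rfl, by linarith⟩
  have hend' : e (planeMap (Real.exp (-(Real.pi / 2)) * -1)) =
      planeMap (Real.exp (-(Real.pi / 2)) * -1) := by
    have h1 : planeMap (Real.exp (-(Real.pi / 2)) * -1) = expMap (Real.pi / 2 : ℝ) := by
      rw [hchord, planeMap_eq_iff]
      right
      rw [Complex.conj_ofReal, mul_neg_one, neg_mul, ← Complex.ofReal_mul, ← Real.exp_add]
      simp
    rw [h1]
    exact he _ ⟨by linarith, le_rfl⟩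
  set r := Real.exp (-(Real.pi / 2)) with hr
  have hrc : (r : ℂ) ≠ 0 := by exact_mod_cast hr0.ne'
  have hball : ∀ j ∈ sphere (0 : ℂ) 1, (r : ℂ) * j ∈ ball (0 : ℂ) 1 := fun j hj => by
    rw [mem_ball_zero_iff, norm_mul, mem_sphere_zero_iff_norm.1 hj, mul_one,
      Complex.norm_of_nonneg hr0.le]
    exact hr1
  have hT : ∀ j ∈ sphere (0 : ℂ) 1, ∃ j' ∈ sphere (0 : ℂ) 1,
      planeMap (r * j') = e (planeMap (r * j)) := fun j hj =>
    mem_rimCircle_iff.1 (heT _ (mem_rimCircle_iff.2 ⟨j, hj, rfl⟩))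
  choose! χ hχ1 hχ2 using hT
  have hχ : ∀ j ∈ sphere (0 : ℂ) 1, χ j = planeInv (e (planeMap (r * j))) / r := fun j hj => by
    rw [← hχ2 j hj, planeInv_planeMap (hball _ (hχ1 j hj)), mul_div_cancel_left₀ _ hrc]
  have hχc : ContinuousOn χ (sphere 0 1) := by
    refine ContinuousOn.congr (ContinuousOn.div_const (continuousOn_planeInv.comp
      (e.continuous.comp (continuous_planeMap.comp
        (continuous_const.mul continuous_id))).continuousOn fun j hj => ?_) _) hχ
    exact ⟨_, hball _ (hχ1 j hj), hχ2 j hj⟩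
  have hχi : InjOn χ (sphere 0 1) := fun i hi j hj hij => by
    have h1 := hχ2 i hi
    rw [hij, hχ2 j hj] at h1
    exact (mul_left_cancel₀ hrc (planeMap_injOn (hball _ hj) (hball _ hi)
      (e.injective h1))).symm
  have hfix : ∀ j ∈ sphere (0 : ℂ) 1, e (planeMap (r * j)) = planeMap (r * j) → χ j = j :=
    fun j hj h => by
      rw [hχ j hj, h, planeInv_planeMap (hball _ hj), mul_div_cancel_left₀ _ hrc]
  obtain ⟨k, hk, hkT, hk0, hkt⟩ := exists_isotopy_circle hr0 hr1 hχc hχi hχ1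
  have hkt := hkt (hfix _ (by simp) hend) (hfix _ (by simp) hend')
  have hke : ∀ x y, k x = e y → (k⁻¹ * e) y = x := fun x y h =>
    (Homeomorph.symm_apply_eq k).2 h.symm
  obtain ⟨u, hu, hue, hu1⟩ := exists_isotopy_of_fix_circle (f := k⁻¹ * e) hr0 hr1
    (fun j hj => hke _ _ ((hkT j hj).trans (hχ2 j hj))) (hke _ _ (hk0.trans he0.symm))
  refine ⟨u⁻¹ * (k⁻¹ * e), fun h => hef ?_, fun z hz => ?_, fun x hx => ?_⟩
  · rwa [Subgroup.mul_mem_cancel_left _ (inv_mem hu),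
      Subgroup.mul_mem_cancel_left _ (inv_mem hk)] at h
  · rw [Homeomorph.mul_apply, ← hue z hz]
    exact u.symm_apply_apply _
  · rw [Homeomorph.mul_apply, hke (expMap x) _ (by rw [he x hx, hchord, hkt])]
    refine (Homeomorph.symm_apply_eq u).2 (hu1 _ ?_).symm
    rintro ⟨z, hz, hzx⟩
    rw [mem_ball_zero_iff] at hz
    rw [hchord, planeMap_eq_iff] at hzx
    rcases hzx with rfl | h
    · rw [Complex.norm_of_nonneg (Real.exp_pos _).le, hr, Real.exp_lt_exp] at hz
      linarith [hx.1]
    · have h1 := congrArg norm h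
      rw [Complex.conj_ofReal, norm_mul, norm_neg, norm_one,
        Complex.norm_of_nonneg (Real.exp_pos _).le] at h1
      have h2 : ‖z‖ * Real.exp x < r * Real.exp x := mul_lt_mul_of_pos_right hz (Real.exp_pos _)
      rw [h1, hr, ← Real.exp_add, Real.one_lt_exp_iff] at h2
      linarith [hx.2]

theorem mem_rectangle {ζ : ℂ} :
    ζ ∈ Ioo (-(Real.pi / 2)) (Real.pi / 2) ×ℂ Ioo 0 Real.pi ↔
      |ζ.re| < Real.pi / 2 ∧ 0 < ζ.im ∧ ζ.im < Real.pi := by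
  rw [Complex.mem_reProdIm, mem_Ioo, mem_Ioo, abs_lt]

theorem mapsTo_rectangle {F : ℂ ≃ₜ ℂ}
    (h : ∀ ζ : ℂ, ζ.im = 0 ∨ ζ.im = Real.pi ∨ Real.pi / 2 ≤ |ζ.re| → F ζ = ζ) :
    MapsTo F (Ioo (-(Real.pi / 2)) (Real.pi / 2) ×ℂ Ioo 0 Real.pi)
      (Ioo (-(Real.pi / 2)) (Real.pi / 2) ×ℂ Ioo 0 Real.pi) := by
  have hpi := Real.pi_pos
  intro ζ hζ
  rw [mem_rectangle] at hζ ⊢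
  have key : ∀ η, η.im ∈ Ioo 0 Real.pi → ¬ ((F η).im = 0 ∨ (F η).im = Real.pi) := fun η hη hF => by
    have h1 := F.injective (h (F η) (by tauto))
    rw [h1] at hF
    rcases hF with hF | hF <;> rw [hF] at hη
    · exact lt_irrefl _ hη.1
    · exact lt_irrefl _ hη.2
  refine ⟨?_, ?_⟩
  · by_contra! h1
    have h2 := F.injective (h (F ζ) (Or.inr (Or.inr h1)))
    rw [h2] at h1
    linarith [hζ.1]
  · let b : ℂ := ⟨Real.pi, Real.pi / 2⟩
    have hbF : F b = b := h b (Or.inr (Or.inr (by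
      change Real.pi / 2 ≤ |Real.pi|
      rw [abs_of_pos hpi]; linarith)))
    have hconn : IsPreconnected ((fun η => (F η).im) '' (Complex.im ⁻¹' Ioo 0 Real.pi)) :=
      ((convex_Ioo 0 Real.pi).linear_preimage Complex.imLm).isPreconnected.image _
        (Complex.continuous_im.comp F.continuous).continuousOn
    have hord := hconn.ordConnected
    have hb : Real.pi / 2 ∈ (fun η => (F η).im) '' (Complex.im ⁻¹' Ioo 0 Real.pi) :=
      ⟨b, ⟨by change 0 < Real.pi / 2; linarith, by change Real.pi / 2 < Real.pi; linarith⟩, by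
        simp only [hbF, b]⟩
    have hz : (F ζ).im ∈ (fun η => (F η).im) '' (Complex.im ⁻¹' Ioo 0 Real.pi) :=
      ⟨ζ, ⟨hζ.2.1, hζ.2.2⟩, rfl⟩
    constructor
    · by_contra! h1
      obtain ⟨η, hη, h2⟩ := hord.out hz hb ⟨h1, by linarith⟩
      exact key η hη (Or.inl h2)
    · by_contra! h1
      obtain ⟨η, hη, h2⟩ := hord.out hb hz ⟨by linarith, h1⟩
      exact key η hη (Or.inr h2)

theorem exists_expMap_eq (x : RP2) :
    (∃ z : ℂ, ‖z‖ ≤ Real.exp (-(Real.pi / 2)) ∧ planeMap z = x) ∨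
      ∃ ζ ∈ Icc (-(Real.pi / 2)) (Real.pi / 2) ×ℂ Icc 0 Real.pi, expMap ζ = x := by
  obtain ⟨z, rfl⟩ := planeMap_surjective x
  rcases eq_or_ne z 0 with rfl | hz
  · exact Or.inl ⟨0, by rw [norm_zero]; exact (Real.exp_pos _).le, rfl⟩
  have h1 : expMap (Complex.log z) = planeMap z := by rw [expMap, Complex.exp_log hz]
  rcases le_or_gt (Complex.log z).re (-(Real.pi / 2)) with h2 | h2
  · refine Or.inl ⟨_, ?_, h1⟩
    rw [Complex.norm_exp]
    exact Real.exp_le_exp.2 h2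
  rcases le_or_gt (Real.pi / 2) (Complex.log z).re with h3 | h3
  · refine Or.inl ⟨Complex.exp (glide (Complex.log z)), ?_, (expMap_glide _).trans h1⟩
    rw [Complex.norm_exp, glide_re]
    exact Real.exp_le_exp.2 (by linarith)
  right
  rcases le_or_gt 0 (Complex.log z).im with h4 | h4
  · exact ⟨_, ⟨⟨h2.le, h3.le⟩, ⟨h4, Complex.log_im_le_pi z⟩⟩, h1⟩
  · refine ⟨glide (Complex.log z), ?_, (expMap_glide _).trans h1⟩
    rw [Complex.mem_reProdIm, glide_re, glide_im]
    have := Complex.neg_pi_lt_log_im z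
    exact ⟨⟨by linarith, by linarith⟩, ⟨by linarith, by linarith⟩⟩

theorem notMem_image_rectangle {z : ℂ} (hz : ‖z‖ ≤ Real.exp (-(Real.pi / 2))) :
    planeMap z ∉ expMap '' (Ioo (-(Real.pi / 2)) (Real.pi / 2) ×ℂ Ioo 0 Real.pi) := by
  rintro ⟨ζ, hζ, h⟩
  have h0 := abs_lt.1 (mem_rectangle.1 hζ).1
  rw [expMap, planeMap_eq_iff] at h
  rcases h with rfl | h
  · rw [Complex.norm_exp, Real.exp_le_exp] at hz
    linarith
  · have h1 := congrArg norm h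
    rw [norm_mul, norm_neg, norm_one, Complex.norm_conj, Complex.norm_exp] at h1
    have h2 := mul_le_mul_of_nonneg_left hz (Real.exp_pos ζ.re).le
    rw [h1, ← Real.exp_add, Real.one_le_exp_iff] at h2
    linarith

theorem mem_isotopyGroup_of_fix_disc_chord {e : RP2 ≃ₜ RP2}
    (he : ∀ z : ℂ, ‖z‖ ≤ Real.exp (-(Real.pi / 2)) → e (planeMap z) = planeMap z)
    (hchord : ∀ x ∈ Icc (-(Real.pi / 2)) (Real.pi / 2), e (expMap (x : ℝ)) = expMap (x : ℝ)) :
    e ∈ isotopyGroup RP2 := by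
  have hpi := Real.pi_pos
  obtain ⟨F, hF, -⟩ := exists_homeomorph_isExpLift he
  have hreal : ∀ x : ℝ, F x = x := by
    intro x
    rcases le_or_gt (Real.pi / 2) |x| with hx | hx
    · exact hF.eq_of_le_abs (by rwa [Complex.ofReal_re])
    · have h0 : (-(Real.pi / 2)) ∈ Icc (-(Real.pi / 2)) (Real.pi / 2) := ⟨le_rfl, by linarith⟩
      refine eqOn_of_expMap_comp_eqOn (s := Complex.ofReal '' Icc (-(Real.pi / 2)) (Real.pi / 2))
        (g₂ := id) (isPreconnected_Icc.image _ Complex.continuous_ofReal.continuousOn)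
        F.continuous.continuousOn continuousOn_id ?_ ⟨_, h0, rfl⟩ ?_
        ⟨x, ⟨(abs_lt.1 hx).1.le, (abs_lt.1 hx).2.le⟩, rfl⟩
      · rintro _ ⟨y, hy, rfl⟩
        exact (hF.lift _).trans (hchord y hy)
      · refine hF.eq_of_le_abs ?_
        rw [Complex.ofReal_re, abs_neg]
        exact le_abs_self _
  have hfix : ∀ ζ : ℂ, ζ.im = 0 ∨ ζ.im = Real.pi ∨ Real.pi / 2 ≤ |ζ.re| → F ζ = ζ := by
    rintro ζ (h | h | h)
    · rw [show ζ = (ζ.re : ℝ) from Complex.ext rfl h]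
      exact hreal _
    · have h1 : ζ = glide ((-ζ.re : ℝ) : ℂ) := Complex.ext
        (by rw [glide_re, Complex.ofReal_re, neg_neg])
        (by rw [glide_im, Complex.ofReal_im, h]; ring)
      rw [h1, hF.glide, hreal]
    · exact hF.eq_of_le_abs h
  have hmaps := mapsTo_rectangle hfix
  have hmaps' := mapsTo_rectangle (F := F.symm) fun ζ h =>
    (Homeomorph.symm_apply_eq F).2 (hfix ζ h).symm
  set U := Ioo (-(Real.pi / 2)) (Real.pi / 2) ×ℂ Ioo 0 Real.pi with hU
  set K := Icc (-(Real.pi / 2)) (Real.pi / 2) ×ℂ Icc 0 Real.pi with hK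
  have hUo : IsOpen U := isOpen_Ioo.reProdIm isOpen_Ioo
  have hKc : IsCompact K := isCompact_Icc.reProdIm isCompact_Icc
  have hUK : U ⊆ K := fun ζ hζ => ⟨Ioo_subset_Icc_self hζ.1, Ioo_subset_Icc_self hζ.2⟩
  have hKU : ∀ ζ ∈ K, ζ ∉ U → F ζ = ζ := fun ζ hζ h => hfix ζ (by
    by_contra! h1
    exact h (mem_rectangle.2 ⟨h1.2.2, lt_of_le_of_ne hζ.2.1 h1.1.symm,
      lt_of_le_of_ne hζ.2.2 h1.2.1⟩))
  classical
  have hmem : ∀ ζ, U.piecewise F id ζ ∈ U ↔ ζ ∈ U := fun ζ => by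
    by_cases h : ζ ∈ U
    · rw [piecewise_eq_of_mem _ _ _ h]
      exact iff_of_true (hmaps h) h
    · rw [piecewise_eq_of_notMem _ _ _ h, id]
  have hinj : ∀ ζ ∈ U, ∀ η ∈ K, expMap ζ = expMap η → ζ = η := fun ζ hζ η hη h =>
    eq_of_expMap_eq h (abs_lt.2 ⟨by linarith [hζ.2.1, hζ.2.2, hη.2.1, hη.2.2],
      by linarith [hζ.2.1, hζ.2.2, hη.2.1, hη.2.2]⟩)
  obtain ⟨g, hg, hgK, hgU⟩ := exists_isotopy_alexander (B := expMap) (F := U.piecewise F id) hKc hUK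
    continuous_expMap.continuousOn (fun ζ hζ η hη h => hinj ζ hζ η (hUK hη) h)
    (isOpenMap_expMap _ hUo) (fun ζ hζ η hη hηU h => hηU (hinj ζ hζ η hη h ▸ hζ))
    (c := ⟨0, Real.pi / 2⟩)
    ((((convex_Ioo _ _).linear_preimage Complex.reLm).inter
      ((convex_Ioo _ _).linear_preimage Complex.imLm)).starConvex
      ⟨⟨by change -(Real.pi / 2) < 0; linarith, by change 0 < Real.pi / 2; linarith⟩,
        ⟨by change 0 < Real.pi / 2; linarith, by change Real.pi / 2 < Real.pi; linarith⟩⟩)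
    (continuous_piecewise (fun ζ hζ => hKU ζ (closure_minimal hUK hKc.isClosed hζ.1) (by
      rw [hUo.frontier_eq] at hζ
      exact hζ.2)) F.continuous.continuousOn continuousOn_id)
    ⟨fun ζ η h => by
      have h1 : ζ ∈ U ↔ η ∈ U := by rw [← hmem ζ, ← hmem η, h]
      by_cases h2 : ζ ∈ U
      · rw [piecewise_eq_of_mem _ _ _ h2, piecewise_eq_of_mem _ _ _ (h1.1 h2)] at h
        exact F.injective h
      · rwa [piecewise_eq_of_notMem _ _ _ h2, piecewise_eq_of_notMem _ _ _ (h1.not.1 h2)] at h,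
      fun ζ => by
        by_cases h : ζ ∈ U
        · exact ⟨F.symm ζ, by rw [piecewise_eq_of_mem _ _ _ (hmaps' h), F.apply_symm_apply]⟩
        · exact ⟨ζ, piecewise_eq_of_notMem _ _ _ h⟩⟩
    (fun ζ hζ => piecewise_eq_of_notMem _ _ _ hζ)
  have hge : g = e := by
    ext x
    rcases exists_expMap_eq x with ⟨z, hz, rfl⟩ | ⟨ζ, hζ, rfl⟩
    · rw [he z hz, hgU _ (notMem_image_rectangle hz)]
    · rw [hgK ζ hζ, ← hF.lift]
      by_cases h : ζ ∈ U
      · rw [piecewise_eq_of_mem _ _ _ h]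
      · rw [piecewise_eq_of_notMem _ _ _ h, hKU ζ hζ h, id]
  exact hge ▸ hg

theorem mem_isotopyGroup_RP2 (f : RP2 ≃ₜ RP2) : f ∈ isotopyGroup RP2 :=
  mem_isotopyGroup_of_forall_eqOn_disc (Real.exp_pos _) exp_neg_pi_div_two_lt_one (fun _ hf => by
    obtain ⟨_, h, he, hchord⟩ := exists_fix_disc_chord hf
    exact h (mem_isotopyGroup_of_fix_disc_chord he hchord)) f

end Rectangle

/-- **Proposition 8.6.** Every homeomorphism of the real projective plane is isotopic to
the identity; i.e. `Homeo(ℝP²)` is arcwise connected. -/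
theorem homeo_RP2_isotopic_to_id (f : RP2 ≃ₜ RP2) : IsotopicToId RP2 f := by
  exact mem_isotopyGroup.1 (mem_isotopyGroup_RP2 f)
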